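/- Let S be a non-negative smooth function on ℝ^n with compact support in [−1,1]^n and ∫ S = 1, let S_k f = f ∗ S_k where S_k(x) = 2^{kn} S(2^k x), and let {c_ℓ}_{ℓ≥0} be a complex sequence with |c_ℓ| = O(2^{−aℓ}) for some a > 0. Define S̃_k f = Σ_{ℓ=0}^∞ c_ℓ S_{k−ℓ} f. Then for every 1 < p < ∞ there is a constant C_p such that for every Schwartz function f on ℝ^n and every λ > 0, ‖λ √(N_λ{S̃_k f : k ∈ ℤ})‖_{L^p(ℝ^n)} ≤ C_p ‖f‖_{L^p(ℝ^n)}, uniformly in λ. -/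

import Mathlib

open MeasureTheory Filter Set Metric
open scoped ENNReal NNReal Topology

noncomputable section

/-- The λ-jump counting function of a family of complex numbers indexed by `J ⊆ ι`. -/
def jumpCount {ι : Type*} [LinearOrder ι] (lam : ℝ) (J : Set ι) (a : ι → ℂ) : ℝ≥0∞ :=
  ⨆ (N : ℕ) (s : Fin N → ι) (t : Fin N → ι) (_ : ∀ i, s i ∈ J) (_ : ∀ i, t i ∈ J)
    (_ : ∀ i, s i < t i) (_ : ∀ i j, i < j → t i < s j)
    (_ : ∀ i, lam < ‖a (t i) - a (s i)‖), (N : ℝ≥0∞)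

/-- Euclidean space ℝ^n. -/
abbrev En (n : ℕ) := EuclideanSpace ℝ (Fin n)

/-- The convolution S_k f(x) = ∫ f(x−y) 2^{kn} S(2^k y) dy. -/
def Sconv (n : ℕ) (S : En n → ℝ) (k : ℤ) (f : En n → ℂ) (x : En n) : ℂ :=
  ∫ y : En n, f (x - y) * (((2 : ℝ) ^ (k * n) * S ((2 : ℝ) ^ k • y) : ℝ) : ℂ)

/-- The operator S̃_k f = Σ_{ℓ≥0} c_ℓ S_{k−ℓ} f. -/
def StildeConv (n : ℕ) (S : En n → ℝ) (c : ℕ → ℂ) (k : ℤ) (f : En n → ℂ) (x : En n) : ℂ :=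
  ∑' ℓ : ℕ, c ℓ * Sconv n S (k - ℓ) f x

/-! ### Inequalities in `ℝ≥0∞` -/

theorem le_of_le_mul_rpow {T B K : ℝ≥0∞} {q : ℝ} (hq : 1 ≤ q) (hT : T ≠ ∞)
    (h : T ≤ K * (T ^ (1 - 1 / q) * B ^ (1 / q))) : T ≤ K ^ q * B := by
  have hq0 : 0 < q := by linarith
  rcases eq_or_ne T 0 with rfl | hT0
  · exact zero_le
  have hsplit : T = T ^ (1 - 1 / q) * T ^ (1 / q) := by
    rw [← ENNReal.rpow_add _ _ hT0 hT]; simp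
  have hne0 : T ^ (1 - 1 / q) ≠ 0 := by simp [hT0, hT]
  have hnet : T ^ (1 - 1 / q) ≠ ∞ := by simp [hT0, hT]
  have h1 : T ^ (1 / q) ≤ K * B ^ (1 / q) := by
    have : T ^ (1 - 1 / q) * T ^ (1 / q) ≤ T ^ (1 - 1 / q) * (K * B ^ (1 / q)) := by
      rw [← hsplit]
      calc T ≤ _ := h
        _ = _ := by ring
    exact (ENNReal.mul_le_mul_iff_right hne0 hnet).1 this
  have h2 := ENNReal.rpow_le_rpow h1 hq0.le
  rw [ENNReal.mul_rpow_of_nonneg _ _ hq0.le, ← ENNReal.rpow_mul, ← ENNReal.rpow_mul,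
    one_div_mul_cancel hq0.ne'] at h2
  simpa using h2

theorem rpow_tangent_le {a b q : ℝ} (ha : 0 ≤ a) (hb : 0 ≤ b) (hq : 1 ≤ q) :
    b ^ q + q * b ^ (q - 1) * (a - b) ≤ a ^ q := by
  rcases hb.eq_or_lt with rfl | hb
  · rcases hq.eq_or_lt with rfl | hq'
    · simp
    · rw [Real.zero_rpow (by linarith), Real.zero_rpow (by linarith)]
      simpa using Real.rpow_nonneg ha q
  have h := one_add_mul_self_le_rpow_one_add (s := a / b - 1)
    (by have : 0 ≤ a / b := by positivity
        linarith) hq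
  have h2 : 1 + (a / b - 1) = a / b := by ring
  rw [h2, Real.div_rpow ha hb.le, le_div_iff₀ (by positivity)] at h
  rw [Real.rpow_sub_one hb.ne']
  calc _ = (1 + q * (a / b - 1)) * b ^ q := by field_simp
    _ ≤ _ := h

theorem rpow_add_le_add_mul (A d : ℝ≥0∞) {q : ℝ} (hq : 1 ≤ q) :
    (A + d) ^ q ≤ A ^ q + ENNReal.ofReal q * (d * (A + d) ^ (q - 1)) := by
  have hq0 : 0 < q := by linarith
  rcases eq_or_ne A ∞ with rfl | hA
  · simp [hq0]
  rcases eq_or_ne d ∞ with rfl | hd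
  · have : (∞ : ℝ≥0∞) * (A + ∞) ^ (q - 1) = ∞ := by
      rcases hq.eq_or_lt with rfl | hq'
      · simp
      · simp [hq']
    rw [this, ENNReal.mul_top (by simpa using hq0)]
    simp
  lift A to ℝ≥0 using hA
  lift d to ℝ≥0 using hd
  have h := rpow_tangent_le (a := A) (b := A + d) A.2 (A + d).2 hq
  obtain ⟨r, hr⟩ : ∃ r : ℝ≥0, (r : ℝ) = q := ⟨⟨q, hq0.le⟩, rfl⟩
  have e : ENNReal.ofReal q = (r : ℝ≥0∞) := by rw [← hr, ENNReal.ofReal_coe_nnreal]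
  rw [e, ← ENNReal.coe_add, ← ENNReal.coe_rpow_of_nonneg _ hq0.le,
    ← ENNReal.coe_rpow_of_nonneg _ hq0.le, ← ENNReal.coe_rpow_of_nonneg _ (by linarith)]
  norm_cast
  rw [← NNReal.coe_le_coe]
  push_cast
  rw [hr]
  nlinarith [h]

/-- A power of a sum is controlled by the increments weighted by the partial sums. -/
theorem sum_rpow_le (u : ℕ → ℝ≥0∞) {q : ℝ} (hq : 1 ≤ q) (N : ℕ) :
    (∑ i ∈ Finset.range N, u i) ^ q ≤ ENNReal.ofReal q *
      ∑ i ∈ Finset.range N, u i * (∑ j ∈ Finset.range (i + 1), u j) ^ (q - 1) := by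
  induction N with
  | zero => simp [show 0 < q by linarith]
  | succ N ih =>
    rw [Finset.sum_range_succ, Finset.sum_range_succ (n := N), mul_add]
    refine (rpow_add_le_add_mul _ _ hq).trans ?_
    rw [← Finset.sum_range_succ]
    exact add_le_add ih le_rfl

section Measure

variable {X : Type*} [MeasurableSpace X] {μ : Measure X}

theorem lintegral_rpow_sub_one_mul_le {A G : X → ℝ≥0∞} {q : ℝ} (hq : 1 ≤ q)
    (hA : AEMeasurable A μ) (hG : AEMeasurable G μ) :
    ∫⁻ x, A x ^ (q - 1) * G x ∂μ ≤
      (∫⁻ x, A x ^ q ∂μ) ^ (1 - 1 / q) * (∫⁻ x, G x ^ q ∂μ) ^ (1 / q) := by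
  have hq0 : 0 < q := by linarith
  have h1 : 1 / q ≤ 1 := by rw [div_le_one hq0]; exact hq
  have := ENNReal.lintegral_mul_norm_pow_le (μ := μ) (hA.pow_const q) (hG.pow_const q)
    (p := 1 - 1 / q) (q := 1 / q) (by linarith) (by positivity) (by ring)
  refine le_trans (le_of_eq ?_) this
  congr 1
  ext x
  rw [← ENNReal.rpow_mul, ← ENNReal.rpow_mul]
  congr 2
  · field_simp
  · rw [mul_one_div_cancel hq0.ne', ENNReal.rpow_one]

theorem lintegral_rpow_le_of_le_mul {A G : X → ℝ≥0∞} {K : ℝ≥0∞} {q : ℝ} (hq : 1 ≤ q)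
    (hA : AEMeasurable A μ) (hG : AEMeasurable G μ) (hfin : ∫⁻ x, A x ^ q ∂μ ≠ ∞)
    (h : ∫⁻ x, A x ^ q ∂μ ≤ K * ∫⁻ x, A x ^ (q - 1) * G x ∂μ) :
    ∫⁻ x, A x ^ q ∂μ ≤ K ^ q * ∫⁻ x, G x ^ q ∂μ :=
  le_of_le_mul_rpow hq hfin (h.trans (by gcongr; exact lintegral_rpow_sub_one_mul_le hq hA hG))

/-! ### Averages over the cells of a partition -/

/-- The fibres of `P` form a partition into measurable sets of finite positive measure. -/
structure IsCellMap {ι : Type*} (μ : Measure X) (P : X → ι) : Prop where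
  measurableSet : ∀ c, MeasurableSet (P ⁻¹' {c})
  ne_zero : ∀ x, μ (P ⁻¹' {P x}) ≠ 0
  ne_top : ∀ x, μ (P ⁻¹' {P x}) ≠ ∞

/-- The average of `g` over the cell of `P` containing `x`. -/
def cellAvg {ι : Type*} (μ : Measure X) (P : X → ι) (g : X → ℝ≥0∞) (x : X) : ℝ≥0∞ :=
  (μ (P ⁻¹' {P x}))⁻¹ * ∫⁻ y in P ⁻¹' {P x}, g y ∂μ

variable {ι : Type*} {P : X → ι}

theorem measurable_of_factorsThrough {β : Type*} [MeasurableSpace β] [Countable ι] (hP : IsCellMap μ P)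
    {h : X → β} (hh : Function.FactorsThrough h P) : Measurable h := by
  intro s _
  have : h ⁻¹' s = ⋃ c ∈ P '' (h ⁻¹' s), P ⁻¹' {c} := by
    ext x
    simp only [mem_preimage, mem_iUnion, mem_singleton_iff, exists_prop, exists_eq_right']
    constructor
    · intro hx
      exact ⟨x, hx, rfl⟩
    · rintro ⟨y, hy, hyx⟩
      rw [mem_preimage, hh hyx] at hy
      exact hy
  rw [this]
  exact MeasurableSet.biUnion (to_countable _) fun c _ => hP.measurableSet c

theorem cellAvg_factorsThrough (g : X → ℝ≥0∞) :
    Function.FactorsThrough (cellAvg μ P g) P := by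
  intro x y h
  simp only [cellAvg, h]

theorem lintegral_eq_tsum_cell [Countable ι] (hP : IsCellMap μ P) (g : X → ℝ≥0∞) :
    ∫⁻ x, g x ∂μ = ∑' c, ∫⁻ x in P ⁻¹' {c}, g x ∂μ := by
  rw [← lintegral_iUnion hP.measurableSet]
  · rw [← Set.preimage_iUnion, iUnion_of_singleton]
    simp
  · intro c d hcd
    exact Disjoint.preimage P (by simpa using hcd)

theorem setLIntegral_cell_mul (hP : IsCellMap μ P) {g h : X → ℝ≥0∞} (hg : Measurable g)
    (hh : Function.FactorsThrough h P) (x : X) :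
    ∫⁻ y in P ⁻¹' {P x}, g y * h y ∂μ = (∫⁻ y in P ⁻¹' {P x}, g y ∂μ) * h x := by
  rw [← lintegral_mul_const _ hg]
  refine setLIntegral_congr_fun (hP.measurableSet _) fun y hy => ?_
  simp only [hh (show P y = P x from hy)]

theorem lintegral_cellAvg_mul [Countable ι] (hP : IsCellMap μ P) {g h : X → ℝ≥0∞} (hg : Measurable g)
    (hh : Function.FactorsThrough h P) :
    ∫⁻ x, cellAvg μ P g x * h x ∂μ = ∫⁻ x, g x * h x ∂μ := by
  rw [lintegral_eq_tsum_cell hP, lintegral_eq_tsum_cell hP (fun x => g x * h x)]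
  congr 1
  ext c
  by_cases hc : ∃ x, P x = c
  · obtain ⟨x, rfl⟩ := hc
    rw [setLIntegral_cell_mul hP (measurable_of_factorsThrough hP (cellAvg_factorsThrough g)) hh,
      setLIntegral_cell_mul hP hg hh]
    congr 1
    have : ∫⁻ y in P ⁻¹' {P x}, cellAvg μ P g y ∂μ =
        ∫⁻ _ in P ⁻¹' {P x}, cellAvg μ P g x ∂μ :=
      setLIntegral_congr_fun (hP.measurableSet _)
        fun y hy => cellAvg_factorsThrough g (show P y = P x from hy)
    rw [this, setLIntegral_const, cellAvg, mul_right_comm,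
      ENNReal.inv_mul_cancel (hP.ne_zero x) (hP.ne_top x), one_mul]
  · have : P ⁻¹' {c} = ∅ := by
      ext x
      simp only [mem_preimage, mem_singleton_iff, mem_empty_iff_false, iff_false]
      exact fun h => hc ⟨x, h⟩
    simp [this]

theorem lintegral_cellAvg_mul_comm [Countable ι] (hP : IsCellMap μ P) {g h : X → ℝ≥0∞} (hg : Measurable g)
    (hh : Measurable h) :
    ∫⁻ x, cellAvg μ P g x * h x ∂μ = ∫⁻ x, g x * cellAvg μ P h x ∂μ := by
  rw [← lintegral_cellAvg_mul hP hg (cellAvg_factorsThrough h)]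
  simp_rw [mul_comm (cellAvg μ P g _)]
  rw [lintegral_cellAvg_mul hP hh (cellAvg_factorsThrough g)]

theorem cellAvg_mono {g h : X → ℝ≥0∞} (hgh : ∀ x, g x ≤ h x) (x : X) :
    cellAvg μ P g x ≤ cellAvg μ P h x := by
  unfold cellAvg
  gcongr
  exact hgh _

theorem cellAvg_le_const (hP : IsCellMap μ P) {g : X → ℝ≥0∞} {M : ℝ≥0∞} (hg : ∀ x, g x ≤ M)
    (x : X) : cellAvg μ P g x ≤ M := by
  calc cellAvg μ P g x ≤ cellAvg μ P (fun _ => M) x := cellAvg_mono hg x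
    _ = M := by
      rw [cellAvg, setLIntegral_const, mul_left_comm,
        ENNReal.inv_mul_cancel (hP.ne_zero x) (hP.ne_top x), mul_one]

theorem cellAvg_rpow_le (hP : IsCellMap μ P) {g : X → ℝ≥0∞} (hg : Measurable g) {q : ℝ}
    (hq : 1 ≤ q) (x : X) : cellAvg μ P g x ^ q ≤ cellAvg μ P (fun y => g y ^ q) x := by
  have hq0 : 0 < q := by linarith
  have h0 := hP.ne_zero x
  have ht := hP.ne_top x
  have h := lintegral_rpow_sub_one_mul_le (μ := μ.restrict (P ⁻¹' {P x})) hq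
    (A := fun _ => 1) aemeasurable_const hg.aemeasurable
  simp only [ENNReal.one_rpow, one_mul, lintegral_const, Measure.restrict_apply_univ] at h
  have h2 := ENNReal.rpow_le_rpow h hq0.le
  rw [ENNReal.mul_rpow_of_nonneg _ _ hq0.le, ← ENNReal.rpow_mul, ← ENNReal.rpow_mul,
    one_div_mul_cancel hq0.ne', ENNReal.rpow_one] at h2
  unfold cellAvg
  rw [ENNReal.mul_rpow_of_nonneg _ _ hq0.le]
  refine (mul_le_mul_right h2 _).trans (le_of_eq ?_)
  rw [← mul_assoc]
  congr 1
  rw [ENNReal.inv_rpow, ← ENNReal.rpow_neg, ← ENNReal.rpow_add _ _ h0 ht, ← ENNReal.rpow_neg_one]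
  congr 1
  field_simp
  ring

theorem lintegral_cellAvg [Countable ι] (hP : IsCellMap μ P) {g : X → ℝ≥0∞} (hg : Measurable g) :
    ∫⁻ x, cellAvg μ P g x ∂μ = ∫⁻ x, g x ∂μ := by
  simpa using lintegral_cellAvg_mul hP hg (h := fun _ => 1) (fun _ _ _ => rfl)

theorem lintegral_cellAvg_rpow_le [Countable ι] (hP : IsCellMap μ P) {g : X → ℝ≥0∞} (hg : Measurable g) {q : ℝ}
    (hq : 1 ≤ q) : ∫⁻ x, cellAvg μ P g x ^ q ∂μ ≤ ∫⁻ x, g x ^ q ∂μ := by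
  rw [← lintegral_cellAvg hP (hg.pow_const q)]
  exact lintegral_mono (cellAvg_rpow_le hP hg hq)

end Measure

/-! ### Square function inequalities for nested partitions -/

section Nested

variable {X : Type*} [MeasurableSpace X] {μ : Measure X} {ι : Type*}

/-- A sequence of successively finer partitions into cells. -/
structure IsNested (μ : Measure X) (π : ℕ → X → ι) : Prop where
  cell : ∀ i, IsCellMap μ (π i)
  succ : ∀ i, Function.FactorsThrough (π i) (π (i + 1))

variable {π : ℕ → X → ι}

theorem IsNested.mono (hπ : IsNested μ π) {i j : ℕ} (hij : i ≤ j) :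
    Function.FactorsThrough (π i) (π j) := by
  induction j, hij using Nat.le_induction with
  | base => exact fun _ _ h => h
  | succ j _ ih => exact fun x y h => ih (hπ.succ j h)

theorem IsNested.factorsThrough (hπ : IsNested μ π) {i j : ℕ} (hij : i ≤ j) {β : Type*}
    {h : X → β} (hh : Function.FactorsThrough h (π i)) : Function.FactorsThrough h (π j) :=
  fun _ _ hxy => hh (hπ.mono hij hxy)

theorem IsNested.factorsThrough_sum_cellAvg (hπ : IsNested μ π) (g : ℕ → X → ℝ≥0∞) (i : ℕ) :
    Function.FactorsThrough
      (fun x => ∑ j ∈ Finset.range (i + 1), cellAvg μ (π j) (g j) x) (π i) := by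
  intro x y hxy
  refine Finset.sum_congr rfl fun j hj => ?_
  exact cellAvg_factorsThrough _ (hπ.mono (by simp at hj; omega) hxy)

theorem finset_sum_rpow_le_of_le_one {α : Type*} (s : Finset α) (u : α → ℝ≥0∞) {q : ℝ}
    (hq0 : 0 < q) (hq : q ≤ 1) : (∑ i ∈ s, u i) ^ q ≤ ∑ i ∈ s, u i ^ q := by
  classical
  induction s using Finset.induction_on with
  | empty => simp [hq0]
  | insert a s ha ih =>
    rw [Finset.sum_insert ha, Finset.sum_insert ha]
    exact (ENNReal.rpow_add_le_add_rpow _ _ hq0.le hq).trans (by gcongr)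

theorem lintegral_sum_rpow_ne_top {N : ℕ} {u : ℕ → X → ℝ≥0∞} {q : ℝ} (hq : 0 < q)
    (hu : ∀ i, Measurable (u i)) (h : ∀ i < N, ∫⁻ x, u i x ^ q ∂μ ≠ ∞) :
    ∫⁻ x, (∑ i ∈ Finset.range N, u i x) ^ q ∂μ ≠ ∞ := by
  have hsum : ∑ i ∈ Finset.range N, ∫⁻ x, u i x ^ q ∂μ ≠ ∞ := by
    rw [ENNReal.sum_ne_top]
    exact fun i hi => h i (by simpa using hi)
  rcases le_total q 1 with hq1 | hq1
  · refine ne_top_of_le_ne_top hsum ?_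
    rw [← lintegral_finsetSum _ fun i _ => (hu i).pow_const q]
    exact lintegral_mono fun x => finset_sum_rpow_le_of_le_one _ _ hq hq1
  · refine ne_top_of_le_ne_top
      (b := (N : ℝ≥0∞) ^ (q - 1) * ∑ i ∈ Finset.range N, ∫⁻ x, u i x ^ q ∂μ)
      (ENNReal.mul_ne_top (by finiteness) hsum) ?_
    rw [← lintegral_finsetSum _ fun i _ => (hu i).pow_const q,
      ← lintegral_const_mul _ (by fun_prop)]
    refine lintegral_mono fun x => ?_
    simpa using ENNReal.rpow_sum_le_const_mul_sum_rpow (Finset.range N) (fun i => u i x) hq1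

/-- The sum of averages is bounded by the sum of the functions in `L^q`, `q ≥ 1`. -/
theorem lintegral_sum_cellAvg_rpow_le [Countable ι] (hπ : IsNested μ π) {g : ℕ → X → ℝ≥0∞}
    (hg : ∀ i, Measurable (g i)) {q : ℝ} (hq : 1 ≤ q) (N : ℕ) :
    ∫⁻ x, (∑ i ∈ Finset.range N, cellAvg μ (π i) (g i) x) ^ q ∂μ ≤
      ENNReal.ofReal q ^ q * ∫⁻ x, (∑ i ∈ Finset.range N, g i x) ^ q ∂μ := by
  have hq0 : 0 < q := by linarith
  have hE : ∀ i, Measurable (cellAvg μ (π i) (g i)) := fun i =>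
    measurable_of_factorsThrough (hπ.cell i) (cellAvg_factorsThrough _)
  by_cases htop : ∫⁻ x, (∑ i ∈ Finset.range N, g i x) ^ q ∂μ = ∞
  · rw [htop, ENNReal.mul_top]
    · exact le_top
    · simp [hq0]
  refine lintegral_rpow_le_of_le_mul hq (by fun_prop) (by fun_prop) ?_ ?_
  · refine lintegral_sum_rpow_ne_top hq0 hE fun i hi => ?_
    refine ne_top_of_le_ne_top htop ((lintegral_cellAvg_rpow_le (hπ.cell i) (hg i) hq).trans ?_)
    refine lintegral_mono fun x => ?_
    gcongr
    exact Finset.single_le_sum (f := fun i => g i x) (fun _ _ => zero_le) (by simpa using hi)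
  · calc _ ≤ ∫⁻ x, ENNReal.ofReal q * ∑ i ∈ Finset.range N, cellAvg μ (π i) (g i) x *
            (∑ j ∈ Finset.range (i + 1), cellAvg μ (π j) (g j) x) ^ (q - 1) ∂μ :=
          lintegral_mono fun x => sum_rpow_le _ hq N
      _ = ENNReal.ofReal q * ∑ i ∈ Finset.range N, ∫⁻ x, cellAvg μ (π i) (g i) x *
            (∑ j ∈ Finset.range (i + 1), cellAvg μ (π j) (g j) x) ^ (q - 1) ∂μ := by
          rw [lintegral_const_mul _ (by fun_prop), lintegral_finsetSum _ (by fun_prop)]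
      _ = ENNReal.ofReal q * ∑ i ∈ Finset.range N, ∫⁻ x, g i x *
            (∑ j ∈ Finset.range (i + 1), cellAvg μ (π j) (g j) x) ^ (q - 1) ∂μ := by
          congr 1
          refine Finset.sum_congr rfl fun i _ => ?_
          refine lintegral_cellAvg_mul (hπ.cell i) (hg i) ?_
          intro x y hxy
          have := hπ.factorsThrough_sum_cellAvg g i hxy
          simp only at this ⊢
          rw [this]
      _ = ENNReal.ofReal q * ∫⁻ x, ∑ i ∈ Finset.range N, g i x *
            (∑ j ∈ Finset.range (i + 1), cellAvg μ (π j) (g j) x) ^ (q - 1) ∂μ := by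
          rw [lintegral_finsetSum _ (by fun_prop)]
      _ ≤ _ := by
          gcongr with x
          rw [mul_comm, Finset.sum_mul]
          refine Finset.sum_le_sum fun i hi => ?_
          gcongr
          simp at hi
          omega

/-- Stein's inequality, `p ≥ 2`. -/
theorem lintegral_sum_cellAvg_sq_le_of_two_le [Countable ι] (hπ : IsNested μ π)
    {g : ℕ → X → ℝ≥0∞} (hg : ∀ i, Measurable (g i)) {p : ℝ} (hp : 2 ≤ p) (N : ℕ) :
    ∫⁻ x, (∑ i ∈ Finset.range N, cellAvg μ (π i) (g i) x ^ (2 : ℝ)) ^ (p / 2) ∂μ ≤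
      ENNReal.ofReal (p / 2) ^ (p / 2) *
        ∫⁻ x, (∑ i ∈ Finset.range N, g i x ^ (2 : ℝ)) ^ (p / 2) ∂μ := by
  refine le_trans (lintegral_mono fun x => ?_) (lintegral_sum_cellAvg_rpow_le hπ
    (g := fun i x => g i x ^ (2 : ℝ)) (by fun_prop) (by linarith) N)
  gcongr with i
  exact cellAvg_rpow_le (hπ.cell i) (hg i) (by norm_num) x

theorem sum_mul_le_sqrt {α : Type*} (s : Finset α) (u v : α → ℝ≥0∞) :
    ∑ i ∈ s, u i * v i ≤
      (∑ i ∈ s, u i ^ (2 : ℝ)) ^ (1 / 2 : ℝ) * (∑ i ∈ s, v i ^ (2 : ℝ)) ^ (1 / 2 : ℝ) :=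
  ENNReal.inner_le_Lp_mul_Lq s u v (by constructor <;> norm_num)

/-- Stein's inequality, `1 < p ≤ 2`. -/
theorem lintegral_sum_cellAvg_sq_le_of_le_two [Countable ι] (hπ : IsNested μ π)
    {g : ℕ → X → ℝ≥0∞} (hg : ∀ i, Measurable (g i)) (hbd : ∀ i, ∃ M : ℝ≥0, ∀ x, g i x ≤ M)
    {p p' : ℝ} (hpp : p.HolderConjugate p') (hp : p ≤ 2) (N : ℕ) :
    ∫⁻ x, (∑ i ∈ Finset.range N, cellAvg μ (π i) (g i) x ^ (2 : ℝ)) ^ (p / 2) ∂μ ≤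
      (ENNReal.ofReal (p' / 2) ^ (1 / 2 : ℝ)) ^ p *
        ∫⁻ x, (∑ i ∈ Finset.range N, g i x ^ (2 : ℝ)) ^ (p / 2) ∂μ := by
  have hp1 : 1 < p := hpp.lt
  have hp0 : 0 < p := by linarith
  have hp'1 : 1 < p' := hpp.symm.lt
  have hp'2 : 2 ≤ p' := by
    have := hpp.inv_add_inv_eq_one
    have h1 : p'⁻¹ ≤ 2⁻¹ := by
      have : 2⁻¹ ≤ p⁻¹ := inv_anti₀ hp0 hp
      linarith [hpp.inv_add_inv_eq_one]
    exact (inv_le_inv₀ (by linarith) (by norm_num)).1 h1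
  set e : ℕ → X → ℝ≥0∞ := fun i => cellAvg μ (π i) (g i) with he
  have hE : ∀ i, Measurable (e i) := fun i =>
    measurable_of_factorsThrough (hπ.cell i) (cellAvg_factorsThrough _)
  have hEtop : ∀ i x, e i x ≠ ∞ := by
    intro i x
    obtain ⟨M, hM⟩ := hbd i
    exact ne_top_of_le_ne_top ENNReal.coe_ne_top (cellAvg_le_const (hπ.cell i) hM x)
  by_cases htop : ∫⁻ x, (∑ i ∈ Finset.range N, g i x ^ (2 : ℝ)) ^ (p / 2) ∂μ = ∞
  · rw [htop, ENNReal.mul_top]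
    · exact le_top
    · have : ENNReal.ofReal (p' / 2) ^ (1 / 2 : ℝ) ≠ 0 := by
        simp [ENNReal.rpow_eq_zero_iff]; linarith
      exact (ENNReal.rpow_pos (pos_iff_ne_zero.2 this) (by finiteness)).ne'
  set B : X → ℝ≥0∞ := fun x => (∑ i ∈ Finset.range N, e i x ^ (2 : ℝ)) ^ (1 / 2 : ℝ) with hB
  set G : X → ℝ≥0∞ := fun x => (∑ i ∈ Finset.range N, g i x ^ (2 : ℝ)) ^ (1 / 2 : ℝ) with hG
  have hBm : Measurable B := by fun_prop
  have hGm : Measurable G := by fun_prop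
  have hBp : ∀ x, (∑ i ∈ Finset.range N, e i x ^ (2 : ℝ)) ^ (p / 2) = B x ^ p := by
    intro x
    rw [hB, ← ENNReal.rpow_mul]; congr 1; ring
  have hGp : ∀ x, (∑ i ∈ Finset.range N, g i x ^ (2 : ℝ)) ^ (p / 2) = G x ^ p := by
    intro x
    rw [hG, ← ENNReal.rpow_mul]; congr 1; ring
  have hB2 : ∀ x, B x ^ (2 : ℝ) = ∑ i ∈ Finset.range N, e i x ^ (2 : ℝ) := by
    intro x
    rw [hB, ← ENNReal.rpow_mul]; norm_num
  have hBtop : ∀ x, B x ≠ ∞ := by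
    intro x
    refine ENNReal.rpow_ne_top_of_nonneg (by norm_num) ?_
    rw [ENNReal.sum_ne_top]
    exact fun i _ => ENNReal.rpow_ne_top_of_nonneg (by norm_num) (hEtop i x)
  have hBfin : ∫⁻ x, B x ^ p ∂μ ≠ ∞ := by
    simp_rw [← hBp]
    refine lintegral_sum_rpow_ne_top (by positivity) (by fun_prop) fun i hi => ?_
    refine ne_top_of_le_ne_top htop ?_
    have h2 : ∀ x, (e i x ^ (2 : ℝ)) ^ (p / 2) = e i x ^ p := by
      intro x; rw [← ENNReal.rpow_mul]; congr 1; ring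
    simp_rw [h2]
    refine (lintegral_cellAvg_rpow_le (hπ.cell i) (hg i) hp1.le).trans (lintegral_mono fun x => ?_)
    rw [show g i x ^ p = (g i x ^ (2 : ℝ)) ^ (p / 2) by rw [← ENNReal.rpow_mul]; congr 1; ring]
    gcongr
    exact Finset.single_le_sum (f := fun i => g i x ^ (2 : ℝ)) (fun _ _ => zero_le)
      (by simpa using hi)
  set r : ℕ → X → ℝ≥0∞ := fun i x => e i x * B x ^ (p - 2) with hr
  have hrm : ∀ i, Measurable (r i) := fun i => by fun_prop
  have hRE : ∀ i, Measurable (cellAvg μ (π i) (r i)) := fun i =>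
    measurable_of_factorsThrough (hπ.cell i) (cellAvg_factorsThrough _)
  have hBsplit : ∀ x, B x ^ p = ∑ i ∈ Finset.range N, e i x * r i x := by
    intro x
    simp only [hr, ← mul_assoc, ← Finset.sum_mul]
    have : ∑ i ∈ Finset.range N, e i x * e i x = B x ^ (2 : ℝ) := by
      rw [hB2]
      refine Finset.sum_congr rfl fun i _ => ?_
      rw [ENNReal.rpow_two, sq]
    rw [this]
    rcases eq_or_ne (B x) 0 with h0 | h0
    · simp [h0, hp0]
    · rw [← ENNReal.rpow_add _ _ h0 (hBtop x)]; congr 1; ring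
  have hr2 : ∀ x, (∑ i ∈ Finset.range N, r i x ^ (2 : ℝ)) ^ (p' / 2) ≤ B x ^ p := by
    intro x
    rcases eq_or_ne (B x) 0 with h0 | h0
    · have h1 : ∀ i ∈ Finset.range N, e i x = 0 := by
        intro i hi
        have := hB2 x
        rw [h0] at this
        simp only [ENNReal.zero_rpow_of_pos (show (0 : ℝ) < 2 by norm_num)] at this
        have h3 := (Finset.sum_eq_zero_iff.1 this.symm) i hi
        simpa using h3
      have : ∑ i ∈ Finset.range N, r i x ^ (2 : ℝ) = 0 :=
        Finset.sum_eq_zero fun i hi => by simp [hr, h1 i hi]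
      rw [this, ENNReal.zero_rpow_of_pos (by linarith)]
      exact zero_le
    · have : ∑ i ∈ Finset.range N, r i x ^ (2 : ℝ) = B x ^ (2 * (p - 1)) := by
        simp only [hr, ENNReal.mul_rpow_of_nonneg _ _ (show (0 : ℝ) ≤ 2 by norm_num),
          ← Finset.sum_mul, ← hB2]
        rw [← ENNReal.rpow_mul (B x), ← ENNReal.rpow_add _ _ h0 (hBtop x)]
        congr 1; ring
      rw [this, ← ENNReal.rpow_mul]
      refine le_of_eq ?_
      congr 1
      have := hpp.sub_one_mul_conj
      linarith
  have key : ∫⁻ x, B x ^ p ∂μ ≤ ENNReal.ofReal (p' / 2) ^ (1 / 2 : ℝ) *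
      ((∫⁻ x, B x ^ p ∂μ) ^ (1 - 1 / p) * (∫⁻ x, G x ^ p ∂μ) ^ (1 / p)) := by
    calc ∫⁻ x, B x ^ p ∂μ = ∑ i ∈ Finset.range N, ∫⁻ x, e i x * r i x ∂μ := by
          simp_rw [hBsplit]
          rw [lintegral_finsetSum _ (by fun_prop)]
      _ = ∑ i ∈ Finset.range N, ∫⁻ x, g i x * cellAvg μ (π i) (r i) x ∂μ :=
          Finset.sum_congr rfl fun i _ => lintegral_cellAvg_mul_comm (hπ.cell i) (hg i) (hrm i)
      _ = ∫⁻ x, ∑ i ∈ Finset.range N, g i x * cellAvg μ (π i) (r i) x ∂μ := by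
          rw [lintegral_finsetSum _ (by fun_prop)]
      _ ≤ ∫⁻ x, G x * (∑ i ∈ Finset.range N,
            cellAvg μ (π i) (r i) x ^ (2 : ℝ)) ^ (1 / 2 : ℝ) ∂μ :=
          lintegral_mono fun x => sum_mul_le_sqrt _ _ _
      _ ≤ (∫⁻ x, G x ^ p ∂μ) ^ (1 / p) * (∫⁻ x, ((∑ i ∈ Finset.range N,
            cellAvg μ (π i) (r i) x ^ (2 : ℝ)) ^ (1 / 2 : ℝ)) ^ p' ∂μ) ^ (1 / p') :=
          ENNReal.lintegral_mul_le_Lp_mul_Lq μ hpp (by fun_prop) (by fun_prop)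
      _ ≤ (∫⁻ x, G x ^ p ∂μ) ^ (1 / p) * (ENNReal.ofReal (p' / 2) ^ (p' / 2) *
            ∫⁻ x, B x ^ p ∂μ) ^ (1 / p') := by
          gcongr
          have := lintegral_sum_cellAvg_sq_le_of_two_le hπ hrm hp'2 N
          refine le_trans (le_of_eq ?_) (this.trans ?_)
          · congr 1; ext x; rw [← ENNReal.rpow_mul]; congr 1; ring
          · gcongr with x
            exact hr2 x
      _ = _ := by
          rw [ENNReal.mul_rpow_of_nonneg _ _ (by positivity), ← ENNReal.rpow_mul]
          have h1 : p' / 2 * (1 / p') = 1 / 2 := by field_simp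
          have h2 : 1 / p' = 1 - 1 / p := by
            have := hpp.inv_add_inv_eq_one
            simp only [one_div]; linarith
          rw [h1, h2]; ring
  change ∫⁻ x, (∑ i ∈ Finset.range N, e i x ^ (2 : ℝ)) ^ (p / 2) ∂μ ≤ _
  rw [lintegral_congr hBp, lintegral_congr hGp]
  exact le_of_le_mul_rpow hp1.le hBfin key

/-- The constant in Stein's inequality. -/
def steinConst (p : ℝ) : ℝ≥0∞ :=
  if 2 ≤ p then ENNReal.ofReal (p / 2) ^ (p / 2)
  else (ENNReal.ofReal (p / (p - 1) / 2) ^ (1 / 2 : ℝ)) ^ p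

theorem steinConst_ne_top {p : ℝ} (hp : 1 < p) : steinConst p ≠ ∞ := by
  unfold steinConst
  split_ifs
  · exact ENNReal.rpow_ne_top_of_nonneg (by linarith) (by finiteness)
  · exact ENNReal.rpow_ne_top_of_nonneg (by linarith)
      (ENNReal.rpow_ne_top_of_nonneg (by norm_num) (by finiteness))

/-- Stein's inequality for averages over nested partitions. -/
theorem lintegral_sum_cellAvg_sq_le [Countable ι] (hπ : IsNested μ π)
    {g : ℕ → X → ℝ≥0∞} (hg : ∀ i, Measurable (g i)) (hbd : ∀ i, ∃ M : ℝ≥0, ∀ x, g i x ≤ M)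
    {p : ℝ} (hp : 1 < p) (N : ℕ) :
    ∫⁻ x, (∑ i ∈ Finset.range N, cellAvg μ (π i) (g i) x ^ (2 : ℝ)) ^ (p / 2) ∂μ ≤
      steinConst p * ∫⁻ x, (∑ i ∈ Finset.range N, g i x ^ (2 : ℝ)) ^ (p / 2) ∂μ := by
  unfold steinConst
  split_ifs with h
  · exact lintegral_sum_cellAvg_sq_le_of_two_le hπ hg h N
  · exact lintegral_sum_cellAvg_sq_le_of_le_two hπ hg hbd
      (Real.HolderConjugate.conjExponent hp) (by linarith) N

end Nested

theorem rpow_le_tangent {a b q : ℝ} (ha : 0 ≤ a) (hb : 0 < b) (hq0 : 0 ≤ q) (hq : q ≤ 1) :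
    a ^ q ≤ b ^ q + q * b ^ (q - 1) * (a - b) := by
  have h := rpow_one_add_le_one_add_mul_self (s := a / b - 1)
    (by have : 0 ≤ a / b := by positivity
        linarith) hq0 hq
  have h2 : 1 + (a / b - 1) = a / b := by ring
  rw [h2, Real.div_rpow ha hb.le, div_le_iff₀ (by positivity)] at h
  rw [Real.rpow_sub_one hb.ne']
  calc _ ≤ (1 + q * (a / b - 1)) * b ^ q := h
    _ = _ := by field_simp

theorem rpow_add_mul_le_rpow_add {A d : ℝ≥0∞} (hA : A ≠ ∞) (hd : d ≠ ∞) {q : ℝ} (hq0 : 0 < q)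
    (hq : q ≤ 1) : A ^ q + ENNReal.ofReal q * (d * (A + d) ^ (q - 1)) ≤ (A + d) ^ q := by
  lift A to ℝ≥0 using hA
  lift d to ℝ≥0 using hd
  rcases eq_or_ne (A + d) 0 with h0 | h0
  · have h1 : A = 0 := by simp_all
    have h2 : d = 0 := by simp_all
    simp [h1, h2, hq0]
  have hpos : (0 : ℝ) < A + d := by exact_mod_cast pos_iff_ne_zero.2 h0
  have h := rpow_le_tangent (a := A) (b := A + d) A.2 hpos hq0.le hq
  obtain ⟨r, hr⟩ : ∃ r : ℝ≥0, (r : ℝ) = q := ⟨⟨q, hq0.le⟩, rfl⟩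
  have e : ENNReal.ofReal q = (r : ℝ≥0∞) := by rw [← hr, ENNReal.ofReal_coe_nnreal]
  rw [e, ← ENNReal.coe_add, ← ENNReal.coe_rpow_of_nonneg _ hq0.le,
    ← ENNReal.coe_rpow_of_nonneg _ hq0.le, ← ENNReal.coe_rpow_of_ne_zero h0]
  norm_cast
  rw [← NNReal.coe_le_coe]
  push_cast
  rw [hr]
  nlinarith [h]

theorem sum_mul_rpow_le_of_le_one (u : ℕ → ℝ≥0∞) (hu : ∀ i, u i ≠ ∞) {q : ℝ} (hq0 : 0 < q)
    (hq : q ≤ 1) (N : ℕ) : ENNReal.ofReal q *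
      ∑ i ∈ Finset.range N, u i * (∑ j ∈ Finset.range (i + 1), u j) ^ (q - 1) ≤
      (∑ i ∈ Finset.range N, u i) ^ q := by
  induction N with
  | zero => simp
  | succ N ih =>
    rw [Finset.sum_range_succ, Finset.sum_range_succ (n := N) (f := u), mul_add]
    refine le_trans ?_ (rpow_add_mul_le_rpow_add (ENNReal.sum_ne_top.2 fun i _ => hu i) (hu N)
      hq0 hq)
    rw [← Finset.sum_range_succ]
    exact add_le_add ih le_rfl

section Nested

variable {X : Type*} [MeasurableSpace X] {μ : Measure X} {ι : Type*} {π : ℕ → X → ι}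

theorem lintegral_mul_le_of_cellAvg_le [Countable ι] {P : X → ι} (hP : IsCellMap μ P)
    {β h : X → ℝ≥0∞} {δ : ℝ≥0∞} (hβ : Measurable β) (hδ : ∀ x, cellAvg μ P β x ≤ δ)
    (hh : Function.FactorsThrough h P) : ∫⁻ x, β x * h x ∂μ ≤ δ * ∫⁻ x, h x ∂μ := by
  rw [← lintegral_cellAvg_mul hP hβ hh,
    ← lintegral_const_mul _ (measurable_of_factorsThrough hP hh)]
  gcongr with x
  exact hδ x

variable {β u : ℕ → X → ℝ≥0∞} {δ : ℝ≥0∞}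

theorem IsNested.factorsThrough_mul_sum_rpow (hπ : IsNested μ π)
    (hu : ∀ i, Function.FactorsThrough (u i) (π i)) (q : ℝ) (i : ℕ) :
    Function.FactorsThrough
      (fun x => u i x * (∑ j ∈ Finset.range (i + 1), u j x) ^ q) (π i) := by
  intro x y hxy
  simp only
  rw [hu i hxy, Finset.sum_congr rfl fun j hj =>
    hu j (hπ.mono (Nat.lt_succ_iff.1 (Finset.mem_range.1 hj)) hxy)]

theorem lintegral_sum_mul_rpow_le_of_one_le [Countable ι] (hπ : IsNested μ π)
    (hβ : ∀ i, Measurable (β i)) (hβ1 : ∀ i x, β i x ≤ 1)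
    (hδ : ∀ i x, cellAvg μ (π i) (β i) x ≤ δ) (hu : ∀ i, Function.FactorsThrough (u i) (π i))
    {q : ℝ} (hq : 1 ≤ q) (N : ℕ) :
    ∫⁻ x, (∑ i ∈ Finset.range N, β i x * u i x) ^ q ∂μ ≤
      ENNReal.ofReal q * (δ * ∫⁻ x, (∑ i ∈ Finset.range N, u i x) ^ q ∂μ) := by
  have hum : ∀ i, Measurable (u i) := fun i => measurable_of_factorsThrough (hπ.cell i) (hu i)
  calc _ ≤ ∫⁻ x, ENNReal.ofReal q * ∑ i ∈ Finset.range N, β i x * (u i x *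
            (∑ j ∈ Finset.range (i + 1), u j x) ^ (q - 1)) ∂μ := by
          refine lintegral_mono fun x => (sum_rpow_le _ hq N).trans ?_
          refine mul_le_mul_right (Finset.sum_le_sum fun i _ => ?_) _
          rw [mul_assoc]
          gcongr with j
          calc β j x * u j x ≤ 1 * u j x := by gcongr; exact hβ1 j x
            _ = _ := one_mul _
    _ = ENNReal.ofReal q * ∑ i ∈ Finset.range N, ∫⁻ x, β i x * (u i x *
            (∑ j ∈ Finset.range (i + 1), u j x) ^ (q - 1)) ∂μ := by
          rw [lintegral_const_mul _ (by fun_prop), lintegral_finsetSum _ (by fun_prop)]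
    _ ≤ ENNReal.ofReal q * ∑ i ∈ Finset.range N, δ * ∫⁻ x, u i x *
            (∑ j ∈ Finset.range (i + 1), u j x) ^ (q - 1) ∂μ := by
          gcongr with i
          exact lintegral_mul_le_of_cellAvg_le (hπ.cell i) (hβ i) (hδ i)
            (hπ.factorsThrough_mul_sum_rpow hu _ i)
    _ ≤ _ := by
          rw [← Finset.mul_sum, ← lintegral_finsetSum _ (by fun_prop)]
          gcongr with x
          calc ∑ i ∈ Finset.range N, u i x * (∑ j ∈ Finset.range (i + 1), u j x) ^ (q - 1)
              ≤ ∑ i ∈ Finset.range N, u i x * (∑ j ∈ Finset.range N, u j x) ^ (q - 1) := by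
                refine Finset.sum_le_sum fun i hi => ?_
                gcongr
                simp at hi
                omega
            _ = (∑ j ∈ Finset.range N, u j x) ^ (1 : ℝ) *
                  (∑ j ∈ Finset.range N, u j x) ^ (q - 1) := by
                rw [← Finset.sum_mul, ENNReal.rpow_one]
            _ ≤ _ := by
                rw [← ENNReal.rpow_add_of_nonneg _ _ (by norm_num) (by linarith)]
                simp

theorem lintegral_sum_mul_rpow_le_of_le_one [Countable ι] (hπ : IsNested μ π)
    (hβ : ∀ i, Measurable (β i))
    (hδ : ∀ i x, cellAvg μ (π i) (β i) x ≤ δ) (hu : ∀ i, Function.FactorsThrough (u i) (π i))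
    (hutop : ∀ i x, u i x ≠ ∞) {q : ℝ} (hq0 : 0 < q) (hq : q ≤ 1) (N : ℕ) :
    ∫⁻ x, (∑ i ∈ Finset.range N, β i x * u i x) ^ q ∂μ ≤
      (δ * (ENNReal.ofReal q)⁻¹) ^ q * ∫⁻ x, (∑ i ∈ Finset.range N, u i x) ^ q ∂μ := by
  have hum : ∀ i, Measurable (u i) := fun i => measurable_of_factorsThrough (hπ.cell i) (hu i)
  set V : X → ℝ≥0∞ := fun x => ∑ i ∈ Finset.range N, u i x with hV
  have hVm : Measurable V := by fun_prop
  set R : X → ℝ≥0∞ := fun x => ∑ i ∈ Finset.range N, β i x * (u i x *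
    (∑ j ∈ Finset.range (i + 1), u j x) ^ (q - 1)) with hR
  have hRm : Measurable R := by fun_prop
  have hpt : ∀ x, (∑ i ∈ Finset.range N, β i x * u i x) ^ q ≤ (V x ^ q) ^ (1 - q) * R x ^ q := by
    intro x
    rw [← ENNReal.rpow_mul, mul_comm q, ENNReal.rpow_mul,
      ← ENNReal.mul_rpow_of_nonneg _ _ hq0.le]
    gcongr
    rw [hR, Finset.mul_sum]
    refine Finset.sum_le_sum fun i hi => ?_
    rw [mul_left_comm]
    gcongr
    set W := ∑ j ∈ Finset.range (i + 1), u j x with hW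
    have hWV : W ≤ V x := by
      refine Finset.sum_le_sum_of_subset ?_
      simp at hi
      simpa using hi
    have huW : u i x ≤ W :=
      Finset.single_le_sum (f := fun j => u j x) (fun _ _ => zero_le) (by simp)
    rcases eq_or_ne W 0 with h0 | h0
    · rw [h0] at huW
      simp [le_zero_iff.1 huW]
    have hWt : W ≠ ∞ := ENNReal.sum_ne_top.2 fun j _ => hutop j x
    calc u i x = W ^ (1 - q) * (u i x * W ^ (q - 1)) := by
          rw [mul_left_comm, ← ENNReal.rpow_add _ _ h0 hWt]
          simp
      _ ≤ _ := by
          gcongr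
  have hRint : ∫⁻ x, R x ∂μ ≤ δ * (ENNReal.ofReal q)⁻¹ * ∫⁻ x, V x ^ q ∂μ := by
    calc ∫⁻ x, R x ∂μ = ∑ i ∈ Finset.range N, ∫⁻ x, β i x * (u i x *
            (∑ j ∈ Finset.range (i + 1), u j x) ^ (q - 1)) ∂μ := by
          rw [lintegral_finsetSum _ (by fun_prop)]
      _ ≤ ∑ i ∈ Finset.range N, δ * ∫⁻ x, u i x *
            (∑ j ∈ Finset.range (i + 1), u j x) ^ (q - 1) ∂μ := by
          gcongr with i
          exact lintegral_mul_le_of_cellAvg_le (hπ.cell i) (hβ i) (hδ i)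
            (hπ.factorsThrough_mul_sum_rpow hu _ i)
      _ = δ * ∫⁻ x, ∑ i ∈ Finset.range N, u i x *
            (∑ j ∈ Finset.range (i + 1), u j x) ^ (q - 1) ∂μ := by
          rw [← Finset.mul_sum, lintegral_finsetSum _ (by fun_prop)]
      _ ≤ δ * ∫⁻ x, (ENNReal.ofReal q)⁻¹ * V x ^ q ∂μ := by
          gcongr with x
          rw [mul_comm, ← div_eq_mul_inv, ENNReal.le_div_iff_mul_le (by simp [hq0]) (by simp),
            mul_comm]
          exact sum_mul_rpow_le_of_le_one _ (fun i => hutop i x) hq0 hq N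
      _ = _ := by rw [lintegral_const_mul _ (by fun_prop), mul_assoc]
  calc _ ≤ ∫⁻ x, (V x ^ q) ^ (1 - q) * R x ^ q ∂μ := lintegral_mono hpt
    _ ≤ (∫⁻ x, V x ^ q ∂μ) ^ (1 - q) * (∫⁻ x, R x ∂μ) ^ q :=
        ENNReal.lintegral_mul_norm_pow_le (by fun_prop) (by fun_prop) (by linarith) hq0.le
          (by ring)
    _ ≤ (∫⁻ x, V x ^ q ∂μ) ^ (1 - q) *
          (δ * (ENNReal.ofReal q)⁻¹ * ∫⁻ x, V x ^ q ∂μ) ^ q := by gcongr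
    _ = _ := by
        rw [ENNReal.mul_rpow_of_nonneg _ _ hq0.le, mul_left_comm,
          ← ENNReal.rpow_add_of_nonneg _ _ (by linarith) hq0.le]
        simp [hV]

/-- The constant in the sparse weight inequality. -/
def sparseConst (q : ℝ) : ℝ≥0∞ := ENNReal.ofReal q + (ENNReal.ofReal q)⁻¹ ^ q

theorem sparseConst_ne_top {q : ℝ} (hq : 0 < q) : sparseConst q ≠ ∞ :=
  ENNReal.add_ne_top.2 ⟨by simp, ENNReal.rpow_ne_top_of_nonneg hq.le (by simp [hq])⟩

/-- Multiplying adapted functions by sparse weights gains a power of the density. -/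
theorem lintegral_sum_mul_rpow_le [Countable ι] (hπ : IsNested μ π)
    (hβ : ∀ i, Measurable (β i)) (hβ1 : ∀ i x, β i x ≤ 1)
    (hδ : ∀ i x, cellAvg μ (π i) (β i) x ≤ δ) (hu : ∀ i, Function.FactorsThrough (u i) (π i))
    (hut : ∀ i x, u i x ≠ ∞) {q : ℝ} (hq0 : 0 < q) (N : ℕ) :
    ∫⁻ x, (∑ i ∈ Finset.range N, β i x * u i x) ^ q ∂μ ≤
      sparseConst q * δ ^ min 1 q * ∫⁻ x, (∑ i ∈ Finset.range N, u i x) ^ q ∂μ := by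
  rcases le_total 1 q with hq | hq
  · rw [min_eq_left hq, ENNReal.rpow_one, mul_assoc]
    refine (lintegral_sum_mul_rpow_le_of_one_le hπ hβ hβ1 hδ hu hq N).trans ?_
    gcongr
    exact le_self_add
  · refine (lintegral_sum_mul_rpow_le_of_le_one hπ hβ hδ hu hut hq0 hq N).trans ?_
    rw [min_eq_right hq, ENNReal.mul_rpow_of_nonneg _ _ hq0.le, mul_comm (δ ^ q)]
    gcongr
    exact le_add_self

end Nested

/-! ### Doob's maximal inequality -/

/-- The maximum of the first `n` terms of a sequence. -/
def runSup (u : ℕ → ℝ≥0∞) (n : ℕ) : ℝ≥0∞ := (Finset.range n).sup u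

@[simp] theorem runSup_zero (u : ℕ → ℝ≥0∞) : runSup u 0 = 0 := by simp [runSup]

theorem runSup_succ (u : ℕ → ℝ≥0∞) (n : ℕ) : runSup u (n + 1) = u n ⊔ runSup u n := by
  simp [runSup, Finset.range_add_one]

theorem runSup_mono (u : ℕ → ℝ≥0∞) : Monotone (runSup u) :=
  fun _ _ h => Finset.sup_mono (by simpa using h)

theorem le_runSup (u : ℕ → ℝ≥0∞) {i n : ℕ} (h : i < n) : u i ≤ runSup u n :=
  Finset.le_sup (by simpa using h)

theorem runSup_le_sum (u : ℕ → ℝ≥0∞) (n : ℕ) : runSup u n ≤ ∑ i ∈ Finset.range n, u i :=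
  Finset.sup_le fun _ hi => Finset.single_le_sum (fun _ _ => zero_le) hi

theorem runSup_ne_top {u : ℕ → ℝ≥0∞} (hu : ∀ i, u i ≠ ∞) (n : ℕ) : runSup u n ≠ ∞ :=
  ne_top_of_le_ne_top (ENNReal.sum_ne_top.2 fun i _ => hu i) (runSup_le_sum u n)

theorem rpow_le_rpow_add_tsub_mul {a b : ℝ≥0∞} (hb : b ≠ ∞) (hab : a ≤ b) {p : ℝ}
    (hp : 1 < p) :
    b ^ p ≤ a ^ p + ENNReal.ofReal (p / (p - 1)) * ((b ^ (p - 1) - a ^ (p - 1)) * b) := by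
  have hp0 : 0 < p := by linarith
  have hp1 : 0 < p - 1 := by linarith
  have ha : a ≠ ∞ := ne_top_of_le_ne_top hb hab
  lift b to ℝ≥0 using hb
  lift a to ℝ≥0 using ha
  have h := rpow_tangent_le (a := b) (b := a) b.2 a.2 hp.le
  have hab' : a ≤ b := by exact_mod_cast hab
  have hmon : a ^ (p - 1) ≤ b ^ (p - 1) := by gcongr
  obtain ⟨r, hr⟩ : ∃ r : ℝ≥0, (r : ℝ) = p / (p - 1) := ⟨⟨p / (p - 1), by positivity⟩, rfl⟩
  have e : ENNReal.ofReal (p / (p - 1)) = (r : ℝ≥0∞) := by rw [← hr, ENNReal.ofReal_coe_nnreal]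
  rw [e, ← ENNReal.coe_rpow_of_nonneg _ hp0.le, ← ENNReal.coe_rpow_of_nonneg _ hp0.le,
    ← ENNReal.coe_rpow_of_nonneg _ hp1.le, ← ENNReal.coe_rpow_of_nonneg _ hp1.le]
  norm_cast
  rw [← NNReal.coe_le_coe]
  push_cast [NNReal.coe_sub hmon]
  rw [hr]
  have h1 : (a : ℝ) ^ p = a ^ (p - 1) * a := by
    conv_lhs => rw [show p = (p - 1) + 1 by ring]
    exact Real.rpow_add_one' a.2 (by linarith)
  have h2 : (b : ℝ) ^ p = b ^ (p - 1) * b := by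
    conv_lhs => rw [show p = (p - 1) + 1 by ring]
    exact Real.rpow_add_one' b.2 (by linarith)
  rw [← sub_nonneg]
  have : (a : ℝ) ^ p + p / (p - 1) * (((b : ℝ) ^ (p - 1) - a ^ (p - 1)) * b) - b ^ p
      = (b ^ p - (a ^ p + p * a ^ (p - 1) * (b - a))) / (p - 1) := by
    rw [h1, h2]; field_simp; ring
  rw [this]
  exact div_nonneg (by linarith) hp1.le

theorem runSup_rpow_le {u : ℕ → ℝ≥0∞} (hu : ∀ i, u i ≠ ∞) {p : ℝ} (hp : 1 < p) (n : ℕ) :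
    runSup u n ^ p ≤ ENNReal.ofReal (p / (p - 1)) *
      ∑ i ∈ Finset.range n, (runSup u (i + 1) ^ (p - 1) - runSup u i ^ (p - 1)) * u i := by
  induction n with
  | zero => simp [show 0 < p by linarith]
  | succ n ih =>
    rw [Finset.sum_range_succ, mul_add]
    refine le_trans ?_ (add_le_add ih le_rfl)
    rcases le_total (u n) (runSup u n) with h | h
    · rw [runSup_succ, sup_eq_right.2 h]
      exact le_self_add
    · have := rpow_le_rpow_add_tsub_mul (hu n) h hp
      rwa [runSup_succ, sup_eq_left.2 h]

theorem add_sum_range_tsub {v : ℕ → ℝ≥0∞} (hv : Monotone v) (n : ℕ) :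
    v 0 + ∑ i ∈ Finset.range n, (v (i + 1) - v i) = v n := by
  induction n with
  | zero => simp
  | succ n ih => rw [Finset.sum_range_succ, ← add_assoc, ih, add_tsub_cancel_of_le (hv n.le_succ)]

section Nested

variable {X : Type*} [MeasurableSpace X] {μ : Measure X} {ι : Type*} {π : ℕ → X → ι}

theorem IsNested.factorsThrough_runSup {β : ℕ → X → ℝ≥0∞} (hπ : IsNested μ π)
    (hβ : ∀ i, Function.FactorsThrough (β i) (π i)) {n i : ℕ} (hi : n ≤ i + 1) :
    Function.FactorsThrough (fun x => runSup (fun j => β j x) n) (π i) := by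
  intro x y hxy
  refine Finset.sup_congr rfl fun j hj => ?_
  exact hβ j (hπ.mono (by simp at hj; omega) hxy)

theorem measurable_runSup {u : ℕ → X → ℝ≥0∞} (hu : ∀ i, Measurable (u i)) (n : ℕ) :
    Measurable fun x => runSup (fun i => u i x) n := by
  induction n with
  | zero => simp
  | succ n ih =>
    simp_rw [runSup_succ]
    exact (hu n).sup ih

theorem measurable_cellAvg [Countable ι] {P : X → ι} (hP : IsCellMap μ P) (f : X → ℝ≥0∞) :
    Measurable (cellAvg μ P f) := measurable_of_factorsThrough hP (cellAvg_factorsThrough f)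

theorem lintegral_runSup_rpow_ne_top [Countable ι] (hπ : IsNested μ π) {f : X → ℝ≥0∞}
    (hf : Measurable f) {p : ℝ} (hp : 1 < p) (hfin : ∫⁻ x, f x ^ p ∂μ ≠ ∞) (n : ℕ) :
    ∫⁻ x, runSup (fun i => cellAvg μ (π i) f x) n ^ p ∂μ ≠ ∞ := by
  refine ne_top_of_le_ne_top (b := ∑ i ∈ Finset.range n, ∫⁻ x, cellAvg μ (π i) f x ^ p ∂μ)
    (ENNReal.sum_ne_top.2 fun i _ => ne_top_of_le_ne_top hfin
      (lintegral_cellAvg_rpow_le (hπ.cell i) hf hp.le)) ?_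
  have hm := fun i => measurable_cellAvg (hπ.cell i) f
  rw [← lintegral_finsetSum _ (by fun_prop)]
  refine lintegral_mono fun x => ?_
  induction n with
  | zero => simp [show 0 < p by linarith]
  | succ n ih =>
    simp only [runSup_succ, Finset.sum_range_succ] at ih ⊢
    rcases le_total (cellAvg μ (π n) f x) (runSup (fun i => cellAvg μ (π i) f x) n) with h | h
    · rw [sup_eq_right.2 h]
      exact ih.trans le_self_add
    · rw [sup_eq_left.2 h]
      exact le_add_self

/-- Doob's maximal inequality for nested partitions. -/
theorem lintegral_runSup_rpow_le [Countable ι] (hπ : IsNested μ π) {f : X → ℝ≥0∞}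
    (hf : Measurable f) {M : ℝ≥0} (hM : ∀ x, f x ≤ M) {p : ℝ} (hp : 1 < p)
    (hfin : ∫⁻ x, f x ^ p ∂μ ≠ ∞) (n : ℕ) :
    ∫⁻ x, runSup (fun i => cellAvg μ (π i) f x) n ^ p ∂μ ≤
      ENNReal.ofReal (p / (p - 1)) ^ p * ∫⁻ x, f x ^ p ∂μ := by
  have hm := fun i => measurable_cellAvg (hπ.cell i) f
  have hsm := fun n => measurable_runSup hm n
  have htop : ∀ i x, cellAvg μ (π i) f x ≠ ∞ := fun i x =>
    ne_top_of_le_ne_top (by simp) (cellAvg_le_const (hπ.cell i) hM x)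
  refine lintegral_rpow_le_of_le_mul hp.le (hsm n).aemeasurable hf.aemeasurable
    (lintegral_runSup_rpow_ne_top hπ hf hp hfin n) ?_
  set w : ℕ → X → ℝ≥0∞ := fun i x => runSup (fun i => cellAvg μ (π i) f x) (i + 1) ^ (p - 1) -
    runSup (fun i => cellAvg μ (π i) f x) i ^ (p - 1) with hw
  have hwm : ∀ i, Measurable (w i) := fun i =>
    ((hsm (i + 1)).pow_const _).sub ((hsm i).pow_const _)
  have hwa : ∀ i, Function.FactorsThrough (w i) (π i) := by
    intro i x y hxy
    have h1 := hπ.factorsThrough_runSup (β := fun i => cellAvg μ (π i) f)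
      (fun i => cellAvg_factorsThrough f) (n := i + 1) (i := i) le_rfl hxy
    have h2 := hπ.factorsThrough_runSup (β := fun i => cellAvg μ (π i) f)
      (fun i => cellAvg_factorsThrough f) (n := i) (i := i) (by omega) hxy
    simp only [hw] at h1 h2 ⊢
    rw [h1, h2]
  calc _ ≤ ∫⁻ x, ENNReal.ofReal (p / (p - 1)) *
          ∑ i ∈ Finset.range n, cellAvg μ (π i) f x * w i x ∂μ := by
        refine lintegral_mono fun x => (runSup_rpow_le (fun i => htop i x) hp n).trans_eq ?_
        simp only [hw, mul_comm (cellAvg μ _ f x)]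
    _ = ENNReal.ofReal (p / (p - 1)) * ∑ i ∈ Finset.range n, ∫⁻ x, f x * w i x ∂μ := by
        rw [lintegral_const_mul _ (by fun_prop), lintegral_finsetSum _ (by fun_prop)]
        simp_rw [fun i => lintegral_cellAvg_mul (hπ.cell i) hf (hwa i)]
    _ = _ := by
        rw [← lintegral_finsetSum _ (by fun_prop)]
        congr 2
        ext x
        rw [← Finset.mul_sum, mul_comm]
        congr 1
        have hmono : Monotone fun i => runSup (fun i => cellAvg μ (π i) f x) i ^ (p - 1) :=
          fun i j hij => ENNReal.rpow_le_rpow (runSup_mono _ hij) (by linarith)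
        simp only [hw]
        have := add_sum_range_tsub hmono n
        simpa [show 0 < p - 1 by linarith] using this

end Nested

/-! ### Anchored martingales -/

/-- `a` follows `x`: at each step it either stays put or jumps to the current value of `x`. -/
structure IsAnchor (x a : ℕ → ℝ) : Prop where
  zero : a 0 = x 0
  succ : ∀ i, a (i + 1) = a i ∨ a (i + 1) = x (i + 1)

theorem IsAnchor.exists_eq {x a : ℕ → ℝ} (h : IsAnchor x a) (i : ℕ) : ∃ j ≤ i, a i = x j := by
  induction i with
  | zero => exact ⟨0, le_rfl, h.zero⟩
  | succ i ih =>
    rcases h.succ i with h1 | h1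
    · obtain ⟨j, hj, e⟩ := ih
      exact ⟨j, by omega, h1.trans e⟩
    · exact ⟨i + 1, le_rfl, h1⟩

/-- The remainder of the first order Taylor expansion of `φ` with derivative `φ'`. -/
def bregman (φ φ' : ℝ → ℝ) (a b : ℝ) : ℝ := φ b - φ a - φ' a * (b - a)

theorem sum_bregman {x a : ℕ → ℝ} (h : ∀ i, a (i + 1) = a i ∨ a (i + 1) = x (i + 1))
    (φ φ' : ℝ → ℝ) (n : ℕ) :
    ∑ i ∈ Finset.range n, bregman φ φ' (a i) (a (i + 1)) + bregman φ φ' (a n) (x n) =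
      bregman φ φ' (a 0) (x 0) + φ (x n) - φ (x 0) -
        ∑ i ∈ Finset.range n, φ' (a i) * (x (i + 1) - x i) := by
  induction n with
  | zero => simp
  | succ n ih =>
    rw [Finset.sum_range_succ, Finset.sum_range_succ]
    rcases h n with h1 | h1 <;> rw [h1] <;> simp only [bregman] at ih ⊢ <;> linarith

theorem mul_sq_le_bregman_rpow_mul {a b M p : ℝ} (ha : 0 ≤ a) (hb : 0 ≤ b) (haM : a ≤ M)
    (hbM : b ≤ M) (hp : 1 < p) (hp2 : p ≤ 2) :
    p * (p - 1) / 4 * (b - a) ^ 2 ≤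
      bregman (fun t => t ^ p) (fun t => p * t ^ (p - 1)) a b * M ^ (2 - p) := by
  rcases (ha.trans haM).eq_or_lt with rfl | hM
  · have h1 : a = 0 := le_antisymm haM ha
    have h2 : b = 0 := le_antisymm hbM hb
    subst h1 h2
    simp [bregman]
  have key : ∀ s t : ℝ, 0 ≤ s → s ≤ t → t ≤ M →
      (p - 1) * M ^ (p - 2) * (t - s) ≤ t ^ (p - 1) - s ^ (p - 1) := by
    intro s t hs hst htM
    rcases (hs.trans hst).eq_or_lt with rfl | ht
    · have : s = 0 := le_antisymm hst hs
      simp [this]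
    have h := rpow_le_tangent hs ht (q := p - 1) (by linarith) (by linarith)
    have h2 : M ^ (p - 2) ≤ t ^ (p - 2) := Real.rpow_le_rpow_of_nonpos ht htM (by linarith)
    rw [show p - 1 - 1 = p - 2 by ring] at h
    have h3 : (p - 1) * M ^ (p - 2) * (t - s) ≤ (p - 1) * t ^ (p - 2) * (t - s) := by
      have : 0 ≤ t - s := by linarith
      have : 0 ≤ p - 1 := by linarith
      gcongr
    linarith
  set c := (a + b) / 2 with hc
  have hc0 : 0 ≤ c := by positivity
  have h1 := rpow_tangent_le hb hc0 hp.le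
  have h2 := rpow_tangent_le hc0 ha hp.le
  have h3 : p * (p - 1) / 4 * M ^ (p - 2) * (b - a) ^ 2 ≤
      bregman (fun t => t ^ p) (fun t => p * t ^ (p - 1)) a b := by
    have hk : (p - 1) * M ^ (p - 2) * (c - a) * (c - a) ≤
        (c ^ (p - 1) - a ^ (p - 1)) * (c - a) := by
      rcases le_total a c with h | h
      · exact mul_le_mul_of_nonneg_right (key a c ha h (by rw [hc]; linarith)) (by linarith)
      · have := mul_le_mul_of_nonneg_right (key c a hc0 h haM) (sub_nonneg.2 h)
        linarith
    have hk2 := mul_le_mul_of_nonneg_left hk (by linarith : (0 : ℝ) ≤ p)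
    have e1 : c - a = (b - a) / 2 := by rw [hc]; ring
    have e2 : b - c = (b - a) / 2 := by rw [hc]; ring
    rw [e1] at hk2 h2
    rw [e2] at h1
    simp only [bregman]
    nlinarith
  have h4 : M ^ (p - 2) * M ^ (2 - p) = 1 := by
    rw [← Real.rpow_add hM]; simp
  calc _ = p * (p - 1) / 4 * M ^ (p - 2) * (b - a) ^ 2 * M ^ (2 - p) := by
        linear_combination (p * (p - 1) / 4 * (b - a) ^ 2) * (-h4)
    _ ≤ _ := by gcongr

theorem bregman_rpow_nonneg {a b p : ℝ} (ha : 0 ≤ a) (hb : 0 ≤ b) (hp : 1 ≤ p) :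
    0 ≤ bregman (fun t => t ^ p) (fun t => p * t ^ (p - 1)) a b := by
  have := rpow_tangent_le hb ha hp
  simp only [bregman]
  linarith

/-- The constant in the anchored square function estimate for `p ≤ 2`. -/
def anchorConst (p : ℝ) : ℝ≥0∞ :=
  if p ≤ 2 then ENNReal.ofReal (4 / (p * (p - 1))) ^ (p / 2) *
    (ENNReal.ofReal (p / (p - 1)) ^ p) ^ (1 - p / 2)
  else (3 * ENNReal.ofReal (p / 2)) ^ (p / 2) * ENNReal.ofReal (p / (p - 1)) ^ p

theorem anchorConst_ne_top {p : ℝ} (hp : 1 < p) : anchorConst p ≠ ∞ := by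
  have h1 : ENNReal.ofReal (p / (p - 1)) ^ p ≠ ∞ :=
    ENNReal.rpow_ne_top_of_nonneg (by linarith) (by simp)
  unfold anchorConst
  split_ifs with h
  · exact ENNReal.mul_ne_top (ENNReal.rpow_ne_top_of_nonneg (by linarith) (by simp))
      (ENNReal.rpow_ne_top_of_nonneg (by linarith) h1)
  · exact ENNReal.mul_ne_top (ENNReal.rpow_ne_top_of_nonneg (by linarith) (by finiteness)) h1

section Nested

variable {X : Type*} [MeasurableSpace X] {μ : Measure X} {ι : Type*} {π : ℕ → X → ι}

theorem lintegral_mul_cellAvg_eq [Countable ι] (hπ : IsNested μ π) {f h : X → ℝ≥0∞}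
    (hf : Measurable f) {i j : ℕ} (hij : i ≤ j) (hh : Function.FactorsThrough h (π i)) :
    ∫⁻ x, h x * cellAvg μ (π j) f x ∂μ = ∫⁻ x, h x * cellAvg μ (π i) f x ∂μ := by
  simp_rw [mul_comm (h _)]
  rw [lintegral_cellAvg_mul (hπ.cell i) hf hh,
    lintegral_cellAvg_mul (hπ.cell j) hf (hπ.factorsThrough hij hh)]

variable {f : X → ℝ≥0∞} {M : ℝ≥0} {a : ℕ → X → ℝ}

theorem le_toReal_runSup {u : ℕ → ℝ≥0∞} (hu : ∀ i, u i ≠ ∞) {i n : ℕ} (h : i < n) :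
    (u i).toReal ≤ (runSup u n).toReal :=
  (ENNReal.toReal_le_toReal (hu i) (runSup_ne_top hu n)).2 (le_runSup u h)

theorem IsAnchor.nonneg {u : ℕ → ℝ≥0∞} {a : ℕ → ℝ} (h : IsAnchor (fun i => (u i).toReal) a)
    (i : ℕ) : 0 ≤ a i := by
  obtain ⟨j, -, e⟩ := h.exists_eq i
  rw [e]
  exact ENNReal.toReal_nonneg

theorem IsAnchor.le_runSup {u : ℕ → ℝ≥0∞} (hu : ∀ i, u i ≠ ∞) {a : ℕ → ℝ}
    (h : IsAnchor (fun i => (u i).toReal) a) {i n : ℕ} (hi : i < n) :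
    a i ≤ (runSup u n).toReal := by
  obtain ⟨j, hj, e⟩ := h.exists_eq i
  rw [e]
  exact le_toReal_runSup hu (by omega)

theorem lintegral_anchor_le_of_le_two [Countable ι] (hπ : IsNested μ π) (hf : Measurable f)
    (hM : ∀ x, f x ≤ M) (ha : ∀ i, Function.FactorsThrough (a i) (π i))
    (hx : ∀ t, IsAnchor (fun i => (cellAvg μ (π i) f t).toReal) fun i => a i t)
    {p : ℝ} (hp : 1 < p) (hp2 : p ≤ 2) (hfin : ∫⁻ x, f x ^ p ∂μ ≠ ∞) (N : ℕ) :
    ∫⁻ t, (∑ i ∈ Finset.range N, ENNReal.ofReal ((a (i + 1) t - a i t) ^ 2)) ^ (p / 2) ∂μ ≤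
      ENNReal.ofReal (4 / (p * (p - 1))) ^ (p / 2) *
        (ENNReal.ofReal (p / (p - 1)) ^ p) ^ (1 - p / 2) * ∫⁻ x, f x ^ p ∂μ := by
  have htop : ∀ t i, cellAvg μ (π i) f t ≠ ∞ := fun t i =>
    ne_top_of_le_ne_top (by simp) (cellAvg_le_const (hπ.cell i) hM t)
  have hxm := fun i => measurable_cellAvg (hπ.cell i) f
  have ham := fun i => measurable_of_factorsThrough (hπ.cell i) (ha i)
  set m : X → ℝ≥0∞ := fun t => runSup (fun i => cellAvg μ (π i) f t) (N + 1) with hm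
  have hmm : Measurable m := measurable_runSup hxm _
  have hmtop : ∀ t, m t ≠ ∞ := fun t => runSup_ne_top (htop t) _
  have hmfin : ∫⁻ t, m t ^ p ∂μ ≠ ∞ := lintegral_runSup_rpow_ne_top hπ hf hp hfin _
  have hp0 : 0 < p := by linarith
  set Φ := bregman (fun t => t ^ p) (fun t => p * t ^ (p - 1)) with hΦ
  have hΦm : Measurable (Function.uncurry Φ) := by
    simp only [hΦ]
    unfold bregman
    unfold Function.uncurry
    fun_prop
  have hΦm' : ∀ i, Measurable fun t => Φ (a i t) (a (i + 1) t) := fun i =>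
    hΦm.comp ((ham i).prodMk (ham (i + 1)))
  have hΦ0 : ∀ i t, 0 ≤ Φ (a i t) (a (i + 1) t) := fun i t =>
    bregman_rpow_nonneg ((hx t).nonneg i) ((hx t).nonneg _) hp.le
  set Ψ : X → ℝ≥0∞ := fun t => ∑ i ∈ Finset.range N, ENNReal.ofReal (Φ (a i t) (a (i + 1) t))
    with hΨ
  have hΨm : Measurable Ψ := by fun_prop
  set K := ENNReal.ofReal (4 / (p * (p - 1))) with hK
  have hpp : 0 < p * (p - 1) := mul_pos hp0 (by linarith)
  have hpt : ∀ t, ∑ i ∈ Finset.range N, ENNReal.ofReal ((a (i + 1) t - a i t) ^ 2) ≤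
      K * (m t ^ (2 - p) * Ψ t) := by
    intro t
    simp only [hΨ, Finset.mul_sum]
    refine Finset.sum_le_sum fun i hi => ?_
    have hi' := Finset.mem_range.1 hi
    have h := mul_sq_le_bregman_rpow_mul ((hx t).nonneg i) ((hx t).nonneg (i + 1))
      ((hx t).le_runSup (htop t) (n := N + 1) (by omega))
      ((hx t).le_runSup (htop t) (n := N + 1) (by omega)) hp hp2
    have e : m t ^ (2 - p) = ENNReal.ofReal ((m t).toReal ^ (2 - p)) := by
      rw [← ENNReal.ofReal_rpow_of_nonneg ENNReal.toReal_nonneg (by linarith),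
        ENNReal.ofReal_toReal (hmtop t)]
    rw [e, ← ENNReal.ofReal_mul (by positivity), ← ENNReal.ofReal_mul (by positivity)]
    refine ENNReal.ofReal_le_ofReal ?_
    rw [div_mul_eq_mul_div, le_div_iff₀ hpp]
    simp only [hm, hΦ]
    linarith
  have hT : ∀ i ∈ Finset.range N, ∫⁻ t, ENNReal.ofReal (p * a i t ^ (p - 1)) *
      cellAvg μ (π i) f t ∂μ ≠ ∞ := by
    intro i hi
    have hi' := Finset.mem_range.1 hi
    refine ne_top_of_le_ne_top (ENNReal.mul_ne_top (ENNReal.ofReal_ne_top (r := p)) hmfin) ?_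
    rw [← lintegral_const_mul _ (by fun_prop)]
    refine lintegral_mono fun t => ?_
    have h1 := (hx t).le_runSup (htop t) (n := N + 1) (i := i) (by omega)
    have h2 : cellAvg μ (π i) f t ≤ m t := le_runSup (fun i => cellAvg μ (π i) f t) (by omega)
    have h3 : ENNReal.ofReal (a i t) ≤ m t := by
      rw [← ENNReal.ofReal_toReal (hmtop t)]
      exact ENNReal.ofReal_le_ofReal h1
    rw [ENNReal.ofReal_mul hp0.le, mul_assoc,
      ← ENNReal.ofReal_rpow_of_nonneg ((hx t).nonneg i) (by linarith)]
    calc _ ≤ ENNReal.ofReal p * (m t ^ (p - 1) * m t ^ (1 : ℝ)) := by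
          rw [ENNReal.rpow_one]
          gcongr
      _ = _ := by
          rw [← ENNReal.rpow_add_of_nonneg _ _ (by linarith) (by norm_num)]
          simp
  have hΨint : ∫⁻ t, Ψ t ∂μ ≤ ∫⁻ t, f t ^ p ∂μ := by
    refine le_trans ?_ (lintegral_cellAvg_rpow_le (hπ.cell N) hf hp.le)
    refine (ENNReal.add_le_add_iff_right (ENNReal.sum_ne_top.2 hT)).1 ?_
    calc _ = ∫⁻ t, (Ψ t + ∑ i ∈ Finset.range N, ENNReal.ofReal (p * a i t ^ (p - 1)) *
            cellAvg μ (π (i + 1)) f t) ∂μ := by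
          rw [lintegral_add_left hΨm]
          congr 1
          rw [lintegral_finsetSum _ (by fun_prop)]
          refine Finset.sum_congr rfl fun i _ => ?_
          refine (lintegral_mul_cellAvg_eq hπ hf i.le_succ ?_).symm
          intro s t hst
          simp only [ha i hst]
      _ ≤ ∫⁻ t, (cellAvg μ (π N) f t ^ p + ∑ i ∈ Finset.range N,
            ENNReal.ofReal (p * a i t ^ (p - 1)) * cellAvg μ (π i) f t) ∂μ := by
          refine lintegral_mono fun t => ?_
          have h := sum_bregman (x := fun i => (cellAvg μ (π i) f t).toReal) (a := fun i => a i t)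
            (hx t).succ (fun t => t ^ p) (fun t => p * t ^ (p - 1)) N
          have hnn := bregman_rpow_nonneg ((hx t).nonneg N)
            (ENNReal.toReal_nonneg (a := cellAvg μ (π N) f t)) hp.le
          have hz : bregman (fun t => t ^ p) (fun t => p * t ^ (p - 1)) (a 0 t)
              (cellAvg μ (π 0) f t).toReal = 0 := by
            rw [show a 0 t = _ from (hx t).zero]
            simp [bregman]
          have h0 : 0 ≤ (cellAvg μ (π 0) f t).toReal ^ p := by positivity
          have hc : ∀ i, cellAvg μ (π i) f t = ENNReal.ofReal (cellAvg μ (π i) f t).toReal :=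
            fun i => (ENNReal.ofReal_toReal (htop t i)).symm
          have hcoef : ∀ i, 0 ≤ p * a i t ^ (p - 1) := fun i =>
            mul_nonneg hp0.le (Real.rpow_nonneg ((hx t).nonneg i) _)
          have e1 : ∀ i j, ENNReal.ofReal (p * a i t ^ (p - 1)) * cellAvg μ (π j) f t =
              ENNReal.ofReal (p * a i t ^ (p - 1) * (cellAvg μ (π j) f t).toReal) := by
            intro i j
            rw [ENNReal.ofReal_mul (hcoef i), ← hc]
          have hnn2 : ∀ i j, 0 ≤ p * a i t ^ (p - 1) * (cellAvg μ (π j) f t).toReal :=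
            fun i j => mul_nonneg (hcoef i) ENNReal.toReal_nonneg
          have e2 : cellAvg μ (π N) f t ^ p =
              ENNReal.ofReal ((cellAvg μ (π N) f t).toReal ^ p) := by
            rw [← ENNReal.ofReal_rpow_of_nonneg ENNReal.toReal_nonneg hp0.le, ← hc]
          simp only [hΨ, e1, e2]
          rw [← ENNReal.ofReal_sum_of_nonneg fun i _ => hΦ0 i t,
            ← ENNReal.ofReal_sum_of_nonneg fun i _ => hnn2 i (i + 1),
            ← ENNReal.ofReal_sum_of_nonneg fun i _ => hnn2 i i,
            ← ENNReal.ofReal_add (Finset.sum_nonneg fun i _ => hΦ0 i t)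
              (Finset.sum_nonneg fun i _ => hnn2 i (i + 1)),
            ← ENNReal.ofReal_add (by positivity) (Finset.sum_nonneg fun i _ => hnn2 i i)]
          refine ENNReal.ofReal_le_ofReal ?_
          rw [hz] at h
          simp only [mul_sub, Finset.sum_sub_distrib] at h
          simp only [hΦ]
          linarith
      _ = _ := by
          rw [lintegral_add_left (by fun_prop), lintegral_finsetSum _ (by fun_prop)]
  calc _ ≤ ∫⁻ t, K ^ (p / 2) * ((m t ^ p) ^ (1 - p / 2) * Ψ t ^ (p / 2)) ∂μ := by
        refine lintegral_mono fun t => ?_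
        rw [← ENNReal.rpow_mul, show p * (1 - p / 2) = (2 - p) * (p / 2) by ring,
          ENNReal.rpow_mul, ← ENNReal.mul_rpow_of_nonneg _ _ (by positivity),
          ← ENNReal.mul_rpow_of_nonneg _ _ (by positivity)]
        exact ENNReal.rpow_le_rpow (hpt t) (by positivity)
    _ = K ^ (p / 2) * ∫⁻ t, (m t ^ p) ^ (1 - p / 2) * Ψ t ^ (p / 2) ∂μ :=
        lintegral_const_mul _ (by fun_prop)
    _ ≤ K ^ (p / 2) * ((∫⁻ t, m t ^ p ∂μ) ^ (1 - p / 2) * (∫⁻ t, Ψ t ∂μ) ^ (p / 2)) := by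
        gcongr
        exact ENNReal.lintegral_mul_norm_pow_le (by fun_prop) (by fun_prop) (by linarith)
          (by positivity) (by ring)
    _ ≤ K ^ (p / 2) * ((ENNReal.ofReal (p / (p - 1)) ^ p * ∫⁻ t, f t ^ p ∂μ) ^ (1 - p / 2) *
          (∫⁻ t, f t ^ p ∂μ) ^ (p / 2)) := by
        have : 0 ≤ 1 - p / 2 := by linarith
        gcongr
        exact lintegral_runSup_rpow_le hπ hf hM hp hfin _
    _ = _ := by
        rw [ENNReal.mul_rpow_of_nonneg _ _ (by linarith), mul_assoc _ (_ ^ (1 - p / 2)) (_ ^ (p / 2)),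
          ← ENNReal.rpow_add_of_nonneg _ _ (by linarith) (by positivity)]
        simp [mul_assoc]

end Nested

section Nested

variable {X : Type*} [MeasurableSpace X] {μ : Measure X} {ι : Type*} {π : ℕ → X → ι}
variable {f : X → ℝ≥0∞} {M : ℝ≥0} {a : ℕ → X → ℝ}

theorem sum_mul_sum_range_comm (d w : ℕ → ℝ≥0∞) (N : ℕ) :
    ∑ i ∈ Finset.range N, d i * ∑ j ∈ Finset.range (i + 1), w j =
      ∑ j ∈ Finset.range N, w j * ∑ i ∈ Finset.Ico j N, d i := by
  simp_rw [Finset.mul_sum, Finset.range_eq_Ico]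
  rw [Finset.sum_Ico_Ico_comm]
  simp_rw [mul_comm]

theorem IsAnchor.sum_sq_add_le {x a : ℕ → ℝ} (h : IsAnchor x a) {m : ℝ} {N j : ℕ} (hj : j < N)
    (hx0 : ∀ i, 0 ≤ x i) (hxm : ∀ i ≤ N, x i ≤ m) :
    ∑ i ∈ Finset.Ico j N, (a (i + 1) - a i) ^ 2 +
        ∑ i ∈ Finset.Ico (j + 1) N, 2 * a i * x (i + 1) ≤
      3 * m ^ 2 + ∑ i ∈ Finset.Ico (j + 1) N, 2 * a i * x i := by
  have ha0 : ∀ i, 0 ≤ a i := fun i => by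
    obtain ⟨k, -, e⟩ := h.exists_eq i
    rw [e]; exact hx0 k
  have ham : ∀ i ≤ N, a i ≤ m := fun i hi => by
    obtain ⟨k, hk, e⟩ := h.exists_eq i
    rw [e]; exact hxm k (hk.trans hi)
  have hdist : ∀ s t : ℝ, 0 ≤ s → 0 ≤ t → s ≤ m → t ≤ m → (s - t) ^ 2 ≤ m ^ 2 := by
    intro s t hs ht hsm htm
    exact sq_le_sq' (by linarith) (by linarith)
  have key := sum_bregman (x := fun i => x (j + 1 + i)) (a := fun i => a (j + 1 + i))
    (fun i => h.succ (j + 1 + i)) (fun t => t ^ 2) (fun t => 2 * t) (N - (j + 1))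
  rw [Finset.sum_eq_sum_Ico_succ_bot hj]
  simp only [Finset.sum_Ico_eq_sum_range]
  have hN : j + 1 + (N - (j + 1)) = N := by omega
  have e : ∀ s t : ℝ, bregman (fun t => t ^ 2) (fun t => 2 * t) s t = (t - s) ^ 2 := by
    intro s t; simp only [bregman]; ring
  simp only [e, hN, mul_sub, Finset.sum_sub_distrib, add_zero] at key
  simp only [add_assoc] at key ⊢
  have h1 := hdist _ _ (ha0 (j + 1)) (ha0 j) (ham _ (by omega)) (ham _ (by omega))
  have h2 := hdist _ _ (hx0 (j + 1)) (ha0 (j + 1)) (hxm _ (by omega)) (ham _ (by omega))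
  have h3 : x N ^ 2 ≤ m ^ 2 := pow_le_pow_left₀ (hx0 N) (hxm N le_rfl) 2
  have h4 := sq_nonneg (x N - a N)
  have h5 := sq_nonneg (x (j + 1))
  linarith

theorem lintegral_anchor_le_of_two_lt [Countable ι] (hπ : IsNested μ π) (hf : Measurable f)
    (hM : ∀ x, f x ≤ M) (ha : ∀ i, Function.FactorsThrough (a i) (π i))
    (hx : ∀ t, IsAnchor (fun i => (cellAvg μ (π i) f t).toReal) fun i => a i t)
    {p : ℝ} (hp2 : 2 < p) (hfin : ∫⁻ x, f x ^ p ∂μ ≠ ∞) (N : ℕ) :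
    ∫⁻ t, (∑ i ∈ Finset.range N, ENNReal.ofReal ((a (i + 1) t - a i t) ^ 2)) ^ (p / 2) ∂μ ≤
      (3 * ENNReal.ofReal (p / 2)) ^ (p / 2) * ENNReal.ofReal (p / (p - 1)) ^ p *
        ∫⁻ x, f x ^ p ∂μ := by
  have hp : 1 < p := by linarith
  have htop : ∀ t i, cellAvg μ (π i) f t ≠ ∞ := fun t i =>
    ne_top_of_le_ne_top (by simp) (cellAvg_le_const (hπ.cell i) hM t)
  have hxm := fun i => measurable_cellAvg (hπ.cell i) f
  have ham := fun i => measurable_of_factorsThrough (hπ.cell i) (ha i)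
  set m : X → ℝ≥0∞ := fun t => runSup (fun i => cellAvg μ (π i) f t) (N + 1) with hm
  have hmm : Measurable m := measurable_runSup hxm _
  have hmtop : ∀ t, m t ≠ ∞ := fun t => runSup_ne_top (htop t) _
  have hmfin : ∫⁻ t, m t ^ p ∂μ ≠ ∞ := lintegral_runSup_rpow_ne_top hπ hf hp hfin _
  set q := p / 2 with hq
  have hq1 : 1 < q := by rw [hq]; linarith
  set d : ℕ → X → ℝ≥0∞ := fun i t => ENNReal.ofReal ((a (i + 1) t - a i t) ^ 2) with hd
  have hdm : ∀ i, Measurable (d i) := by fun_prop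
  set V : ℕ → X → ℝ≥0∞ := fun n t => ∑ i ∈ Finset.range n, d i t with hV
  have hVm : ∀ n, Measurable (V n) := by fun_prop
  have hVmono : ∀ t, Monotone fun n => V n t := fun t i j hij =>
    Finset.sum_le_sum_of_subset (by simpa using hij)
  have hVmono' : ∀ t, Monotone fun n => V n t ^ (q - 1) := fun t i j hij =>
    ENNReal.rpow_le_rpow (hVmono t hij) (by linarith)
  have hVa : ∀ n i, n ≤ i → Function.FactorsThrough (V n) (π i) := by
    intro n i hn s t hst
    refine Finset.sum_congr rfl fun k hk => ?_
    have hk := Finset.mem_range.1 hk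
    simp only [hd]
    rw [ha k (hπ.mono (by omega) hst), ha (k + 1) (hπ.mono (by omega) hst)]
  have hcm : ∀ t i, i < N + 1 → cellAvg μ (π i) f t ≤ m t := fun t i hi =>
    le_runSup (fun i => cellAvg μ (π i) f t) hi
  have hacm : ∀ t i, i < N + 1 → ENNReal.ofReal (a i t) ≤ m t := fun t i hi => by
    rw [← ENNReal.ofReal_toReal (hmtop t)]
    exact ENNReal.ofReal_le_ofReal ((hx t).le_runSup (htop t) hi)
  have hm2 : ∀ t, m t ^ (2 : ℝ) = ENNReal.ofReal ((m t).toReal ^ 2) := fun t => by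
    rw [ENNReal.ofReal_pow ENNReal.toReal_nonneg, ENNReal.ofReal_toReal (hmtop t)]
    simp
  have hdle : ∀ t i, i < N → d i t ≤ m t ^ (2 : ℝ) := by
    intro t i hi
    rw [hm2]
    refine ENNReal.ofReal_le_ofReal ?_
    have h1 : a i t ≤ (m t).toReal := (hx t).le_runSup (htop t) (by omega)
    have h2 : a (i + 1) t ≤ (m t).toReal := (hx t).le_runSup (htop t) (by omega)
    have h3 := (hx t).nonneg i
    have h4 := (hx t).nonneg (i + 1)
    exact sq_le_sq' (by linarith) (by linarith)
  have hVle : ∀ t, V N t ≤ N * m t ^ (2 : ℝ) := by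
    intro t
    calc V N t ≤ ∑ i ∈ Finset.range N, m t ^ (2 : ℝ) :=
          Finset.sum_le_sum fun i hi => hdle t i (Finset.mem_range.1 hi)
      _ = _ := by simp
  have hVfin : ∫⁻ t, V N t ^ q ∂μ ≠ ∞ := by
    refine ne_top_of_le_ne_top (ENNReal.mul_ne_top (a := (N : ℝ≥0∞) ^ q)
      (ENNReal.rpow_ne_top_of_nonneg (by linarith) (by simp)) hmfin) ?_
    rw [← lintegral_const_mul _ (by fun_prop)]
    refine lintegral_mono fun t => ?_
    calc V N t ^ q ≤ (N * m t ^ (2 : ℝ)) ^ q := ENNReal.rpow_le_rpow (hVle t) (by linarith)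
      _ = _ := by
        rw [ENNReal.mul_rpow_of_nonneg _ _ (by linarith), ← ENNReal.rpow_mul]
        congr 2
        rw [hq]; ring
  have hG : ∫⁻ t, (m t ^ (2 : ℝ)) ^ q ∂μ = ∫⁻ t, m t ^ p ∂μ := by
    simp_rw [← ENNReal.rpow_mul]
    congr! 3
    rw [hq]; ring
  have hVG : ∫⁻ t, V N t ^ (q - 1) * m t ^ (2 : ℝ) ∂μ ≠ ∞ := by
    refine ne_top_of_le_ne_top ?_ (lintegral_rpow_sub_one_mul_le (G := fun t => m t ^ (2 : ℝ))
      hq1.le (hVm N).aemeasurable (by fun_prop))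
    have h1 : 1 / q ≤ 1 := by rw [div_le_one (by linarith)]; exact hq1.le
    refine ENNReal.mul_ne_top (ENNReal.rpow_ne_top_of_nonneg (by linarith) hVfin)
      (ENNReal.rpow_ne_top_of_nonneg (by positivity) (by rw [hG]; exact hmfin))
  set w : ℕ → X → ℝ≥0∞ := fun i t => V (i + 1) t ^ (q - 1) - V i t ^ (q - 1) with hw
  have hwm : ∀ i, Measurable (w i) := fun i =>
    ((hVm (i + 1)).pow_const _).sub ((hVm i).pow_const _)
  have hwa : ∀ i j, i < j → Function.FactorsThrough (w i) (π j) := by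
    intro i j hij s t hst
    simp only [hw]
    rw [hVa (i + 1) j (by omega) hst, hVa i j (by omega) hst]
  have hwle : ∀ i t, i < N → w i t ≤ V N t ^ (q - 1) := fun i t hi =>
    tsub_le_self.trans (hVmono' t (by omega))
  have hwsum : ∀ n t, ∑ j ∈ Finset.range n, w j t = V n t ^ (q - 1) := by
    intro n t
    have := add_sum_range_tsub (hVmono' t) n
    simpa [show 0 < q - 1 by linarith, hV] using this
  have hkey : ∀ j, j < N → ∫⁻ t, w j t * ∑ i ∈ Finset.Ico j N, d i t ∂μ ≤
      ∫⁻ t, w j t * (3 * m t ^ (2 : ℝ)) ∂μ := by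
    intro j hj
    have hT : ∀ i ∈ Finset.Ico (j + 1) N, ∫⁻ t, w j t * ENNReal.ofReal (2 * a i t) *
        cellAvg μ (π i) f t ∂μ ≠ ∞ := by
      intro i hi
      simp only [Finset.mem_Ico] at hi
      refine ne_top_of_le_ne_top (ENNReal.mul_ne_top (a := 2) (by simp) hVG) ?_
      rw [← lintegral_const_mul _ (by fun_prop)]
      refine lintegral_mono fun t => ?_
      rw [ENNReal.ofReal_mul (by norm_num), mul_assoc, mul_assoc, mul_left_comm]
      simp only [ENNReal.ofReal_ofNat]
      gcongr
      · exact hwle j t hj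
      · rw [show (2 : ℝ) = 1 + 1 by norm_num,
          ENNReal.rpow_add_of_nonneg _ _ (by norm_num) (by norm_num), ENNReal.rpow_one]
        gcongr
        · exact hacm t i (by omega)
        · exact hcm t i (by omega)
    refine (ENNReal.add_le_add_iff_right (ENNReal.sum_ne_top.2 hT)).1 ?_
    calc _ = ∫⁻ t, (w j t * ∑ i ∈ Finset.Ico j N, d i t + ∑ i ∈ Finset.Ico (j + 1) N,
            w j t * ENNReal.ofReal (2 * a i t) * cellAvg μ (π (i + 1)) f t) ∂μ := by
          rw [lintegral_add_left (by fun_prop)]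
          congr 1
          rw [lintegral_finsetSum _ (by fun_prop)]
          refine Finset.sum_congr rfl fun i hi => ?_
          simp only [Finset.mem_Ico] at hi
          refine (lintegral_mul_cellAvg_eq hπ hf i.le_succ ?_).symm
          intro s t hst
          simp only [ha i hst, hwa j i (by omega) hst]
      _ ≤ ∫⁻ t, (w j t * (3 * m t ^ (2 : ℝ)) + ∑ i ∈ Finset.Ico (j + 1) N,
            w j t * ENNReal.ofReal (2 * a i t) * cellAvg μ (π i) f t) ∂μ := by
          refine lintegral_mono fun t => ?_
          simp only [mul_assoc (w j t), ← Finset.mul_sum, ← mul_add]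
          refine mul_le_mul_right ?_ _
          have h := (hx t).sum_sq_add_le hj (m := (m t).toReal)
            (fun i => ENNReal.toReal_nonneg) (fun i hi => le_toReal_runSup (htop t) (by omega))
          have hnn : ∀ i k, 0 ≤ 2 * a i t * (cellAvg μ (π k) f t).toReal :=
            fun i k => mul_nonneg (mul_nonneg (by norm_num) ((hx t).nonneg i))
              ENNReal.toReal_nonneg
          have e1 : ∀ i k, ENNReal.ofReal (2 * a i t) * cellAvg μ (π k) f t =
              ENNReal.ofReal (2 * a i t * (cellAvg μ (π k) f t).toReal) := by
            intro i k
            rw [ENNReal.ofReal_mul (mul_nonneg (by norm_num) ((hx t).nonneg i)),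
              ENNReal.ofReal_toReal (htop t k)]
          have e3 : (3 : ℝ≥0∞) * ENNReal.ofReal ((m t).toReal ^ 2) =
              ENNReal.ofReal (3 * (m t).toReal ^ 2) := by
            rw [ENNReal.ofReal_mul (by norm_num)]; simp
          simp only [hd, e1, hm2, e3]
          rw [← ENNReal.ofReal_sum_of_nonneg fun i _ => sq_nonneg _,
            ← ENNReal.ofReal_sum_of_nonneg fun i _ => hnn i (i + 1),
            ← ENNReal.ofReal_sum_of_nonneg fun i _ => hnn i i,
            ← ENNReal.ofReal_add (Finset.sum_nonneg fun i _ => sq_nonneg _)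
              (Finset.sum_nonneg fun i _ => hnn i (i + 1)),
            ← ENNReal.ofReal_add (by positivity) (Finset.sum_nonneg fun i _ => hnn i i)]
          exact ENNReal.ofReal_le_ofReal h
      _ = _ := by
          rw [lintegral_add_left (by fun_prop), lintegral_finsetSum _ (by fun_prop)]
  have hmain : ∫⁻ t, V N t ^ q ∂μ ≤ 3 * ENNReal.ofReal q *
      ∫⁻ t, V N t ^ (q - 1) * m t ^ (2 : ℝ) ∂μ := by
    calc _ ≤ ∫⁻ t, ENNReal.ofReal q *
            ∑ j ∈ Finset.range N, w j t * ∑ i ∈ Finset.Ico j N, d i t ∂μ := by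
          refine lintegral_mono fun t => (sum_rpow_le (fun i => d i t) hq1.le N).trans_eq ?_
          rw [← sum_mul_sum_range_comm]
          simp_rw [hwsum]
          rfl
      _ = ENNReal.ofReal q * ∑ j ∈ Finset.range N,
            ∫⁻ t, w j t * ∑ i ∈ Finset.Ico j N, d i t ∂μ := by
          rw [lintegral_const_mul _ (by fun_prop), lintegral_finsetSum _ (by fun_prop)]
      _ ≤ ENNReal.ofReal q * ∑ j ∈ Finset.range N, ∫⁻ t, w j t * (3 * m t ^ (2 : ℝ)) ∂μ := by
          exact mul_le_mul_right (Finset.sum_le_sum fun j hj =>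
            hkey j (Finset.mem_range.1 hj)) _
      _ = ENNReal.ofReal q * ∫⁻ t, 3 * (V N t ^ (q - 1) * m t ^ (2 : ℝ)) ∂μ := by
          rw [← lintegral_finsetSum _ (by fun_prop)]
          simp_rw [← Finset.sum_mul, hwsum, mul_left_comm]
      _ = _ := by
          rw [lintegral_const_mul _ (by fun_prop), ← mul_assoc, mul_comm (ENNReal.ofReal q)]
  have := lintegral_rpow_le_of_le_mul (G := fun t => m t ^ (2 : ℝ)) hq1.le (hVm N).aemeasurable
    (by fun_prop) hVfin hmain
  refine this.trans ?_
  rw [hG, mul_assoc]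
  gcongr
  exact lintegral_runSup_rpow_le hπ hf hM hp hfin _

/-- The square function of an anchored martingale is bounded on `L^p`. -/
theorem lintegral_anchor_le [Countable ι] (hπ : IsNested μ π) (hf : Measurable f)
    (hM : ∀ x, f x ≤ M) (ha : ∀ i, Function.FactorsThrough (a i) (π i))
    (hx : ∀ t, IsAnchor (fun i => (cellAvg μ (π i) f t).toReal) fun i => a i t)
    {p : ℝ} (hp : 1 < p) (hfin : ∫⁻ x, f x ^ p ∂μ ≠ ∞) (N : ℕ) :
    ∫⁻ t, (∑ i ∈ Finset.range N, ENNReal.ofReal ((a (i + 1) t - a i t) ^ 2)) ^ (p / 2) ∂μ ≤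
      anchorConst p * ∫⁻ x, f x ^ p ∂μ := by
  unfold anchorConst
  split_ifs with h
  · exact lintegral_anchor_le_of_le_two hπ hf hM ha hx hp h hfin N
  · exact lintegral_anchor_le_of_two_lt hπ hf hM ha hx (not_le.1 h) hfin N

end Nested

/-! ### Greedy anchors and jump counting -/

/-- The greedy anchor: it moves to the current value as soon as that is farther than `r`. -/
def greedy (r : ℝ) (x : ℕ → ℝ) : ℕ → ℝ
  | 0 => x 0
  | i + 1 => if r < |x (i + 1) - greedy r x i| then x (i + 1) else greedy r x i

theorem isAnchor_greedy (r : ℝ) (x : ℕ → ℝ) : IsAnchor x (greedy r x) := by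
  refine ⟨rfl, fun i => ?_⟩
  rw [greedy]
  split_ifs
  · exact Or.inr rfl
  · exact Or.inl rfl

theorem abs_sub_greedy_le {r : ℝ} (hr : 0 ≤ r) (x : ℕ → ℝ) (i : ℕ) : |x i - greedy r x i| ≤ r := by
  cases i with
  | zero => simpa [greedy] using hr
  | succ i =>
    rw [greedy]
    split_ifs with h
    · simp [hr]
    · exact not_lt.1 h

theorem lt_abs_greedy_sub {r : ℝ} {x : ℕ → ℝ} {i : ℕ} (h : greedy r x (i + 1) ≠ greedy r x i) :
    r < |greedy r x (i + 1) - greedy r x i| := by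
  by_cases h1 : r < |x (i + 1) - greedy r x i|
  · simp [greedy, h1]
  · simp [greedy, h1] at h

theorem exists_greedy_ne {lam : ℝ} (hlam : 0 < lam) {x : ℕ → ℝ} {s t : ℕ} (hst : s < t)
    (h : lam < |x t - x s|) :
    ∃ i, s ≤ i ∧ i < t ∧ greedy (lam / 2) x (i + 1) ≠ greedy (lam / 2) x i := by
  by_contra! hcon
  have hconst : ∀ i, s ≤ i → i ≤ t → greedy (lam / 2) x i = greedy (lam / 2) x s := by
    intro i hi
    induction i, hi using Nat.le_induction with
    | base => intro _; rfl
    | succ i hi ih => intro hit; rw [hcon i hi (by omega), ih (by omega)]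
  have h1 := abs_sub_greedy_le (show 0 ≤ lam / 2 by linarith) x t
  have h2 := abs_sub_greedy_le (show 0 ≤ lam / 2 by linarith) x s
  rw [hconst t hst.le le_rfl] at h1
  rw [abs_le] at h1 h2
  have : |x t - x s| ≤ lam := abs_le.2 ⟨by linarith, by linarith⟩
  linarith

theorem natCast_mul_sq_le_greedy {lam : ℝ} (hlam : 0 < lam) {x : ℕ → ℝ} {J N : ℕ}
    {s t : Fin J → ℕ} (hst : ∀ i, s i < t i) (hts : ∀ i j, i < j → t i < s j) (htN : ∀ i, t i ≤ N)
    (h : ∀ i, lam < |x (t i) - x (s i)|) :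
    J * lam ^ 2 ≤ 4 * ∑ i ∈ Finset.range N,
      (greedy (lam / 2) x (i + 1) - greedy (lam / 2) x i) ^ 2 := by
  choose e he1 he2 he3 using fun i => exists_greedy_ne hlam (hst i) (h i)
  have hinj : Function.Injective e := by
    intro i j hij
    rcases lt_trichotomy i j with hlt | heq | hlt
    · have h1 := he2 i
      have h2 := he1 j
      have h3 := hts i j hlt
      omega
    · exact heq
    · have h1 := he2 j
      have h2 := he1 i
      have h3 := hts j i hlt
      omega
  calc J * lam ^ 2 = 4 * ∑ _i : Fin J, (lam / 2) ^ 2 := by simp; ring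
    _ ≤ 4 * ∑ i : Fin J, (greedy (lam / 2) x (e i + 1) - greedy (lam / 2) x (e i)) ^ 2 := by
        refine mul_le_mul_of_nonneg_left (Finset.sum_le_sum fun i _ => ?_) (by norm_num)
        rw [← sq_abs (greedy _ _ _ - _)]
        exact pow_le_pow_left₀ (by linarith) (lt_abs_greedy_sub (he3 i)).le 2
    _ = 4 * ∑ k ∈ Finset.univ.map ⟨e, hinj⟩,
          (greedy (lam / 2) x (k + 1) - greedy (lam / 2) x k) ^ 2 := by
        rw [Finset.sum_map]; rfl
    _ ≤ _ := by
        refine mul_le_mul_of_nonneg_left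
          (Finset.sum_le_sum_of_subset_of_nonneg ?_ fun _ _ _ => sq_nonneg _) (by norm_num)
        intro k hk
        simp only [Finset.mem_map, Finset.mem_univ, Function.Embedding.coeFn_mk, true_and] at hk
        obtain ⟨i, rfl⟩ := hk
        have := he2 i
        have := htN i
        simp; omega

/-! ### Families of partitions indexed by the integers -/

theorem sum_range_window (g : ℤ → ℝ≥0∞) (K : ℕ) :
    ∑ i ∈ Finset.range (2 * K), g (-K + i) = ∑ k ∈ Finset.Ico (-K : ℤ) K, g k := by
  refine Finset.sum_bij (fun i _ => -K + i) ?_ ?_ ?_ ?_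
  · intro i hi; simp at hi ⊢; omega
  · intro i _ j _ h; simpa using h
  · intro k hk
    simp at hk
    exact ⟨(k + K).toNat, by simp; omega, by rw [Int.toNat_of_nonneg (by omega)]; ring⟩
  · intro i _; rfl

theorem tendsto_sum_window (g : ℤ → ℝ≥0∞) :
    Tendsto (fun K : ℕ => ∑ i ∈ Finset.range (2 * K), g (-K + i)) atTop (𝓝 (∑' k, g k)) := by
  simp_rw [sum_range_window]
  refine (ENNReal.summable.hasSum (f := g)).comp (tendsto_atTop_finset_of_monotone ?_ ?_)
  · intro K L h k hk
    simp at hk ⊢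
    omega
  · intro k
    exact ⟨k.natAbs + 1, by rw [Finset.mem_Ico]; omega⟩

theorem sum_window_le_tsum (g : ℤ → ℝ≥0∞) (K : ℕ) :
    ∑ i ∈ Finset.range (2 * K), g (-K + i) ≤ ∑' k, g k := by
  rw [sum_range_window]
  exact ENNReal.sum_le_tsum _

section Nested

variable {X : Type*} [MeasurableSpace X] {μ : Measure X} {ι : Type*}

theorem lintegral_tsum_rpow_le_of_window {g : ℤ → X → ℝ≥0∞} (hg : ∀ k, Measurable (g k)) {q : ℝ}
    {B : ℝ≥0∞}
    (h : ∀ K : ℕ, ∫⁻ x, (∑ i ∈ Finset.range (2 * K), g (-K + i) x) ^ q ∂μ ≤ B) :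
    ∫⁻ x, (∑' k, g k x) ^ q ∂μ ≤ B := by
  have hlim : ∀ x, Tendsto (fun K : ℕ => (∑ i ∈ Finset.range (2 * K), g (-K + i) x) ^ q) atTop
      (𝓝 ((∑' k, g k x) ^ q)) := fun x =>
    (ENNReal.continuous_rpow_const.tendsto _).comp (tendsto_sum_window fun k => g k x)
  calc _ = ∫⁻ x, liminf (fun K : ℕ => (∑ i ∈ Finset.range (2 * K), g (-K + i) x) ^ q) atTop ∂μ :=
        lintegral_congr fun x => (hlim x).liminf_eq.symm
    _ ≤ liminf (fun K : ℕ => ∫⁻ x, (∑ i ∈ Finset.range (2 * K), g (-K + i) x) ^ q ∂μ) atTop :=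
        lintegral_liminf_le fun K => by fun_prop
    _ ≤ B := by
        refine (liminf_le_liminf (Eventually.of_forall h)).trans ?_
        simp

/-- Nested partitions into cells of finite measure, indexed by the integers. -/
structure IsNestedInt (μ : Measure X) (π : ℤ → X → ι) : Prop where
  cell : ∀ k, IsCellMap μ (π k)
  succ : ∀ k, Function.FactorsThrough (π k) (π (k + 1))

variable {π : ℤ → X → ι}

theorem IsNestedInt.isNested (hπ : IsNestedInt μ π) (k : ℤ) :
    IsNested μ fun i : ℕ => π (k + i) := by
  refine ⟨fun i => hπ.cell _, fun i => ?_⟩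
  have := hπ.succ (k + i)
  simp only [Nat.cast_add, Nat.cast_one, ← add_assoc]
  exact this

variable [Countable ι]

theorem lintegral_tsum_cellAvg_sq_le (hπ : IsNestedInt μ π) {g : ℤ → X → ℝ≥0∞}
    (hg : ∀ k, Measurable (g k)) (hbd : ∀ k, ∃ M : ℝ≥0, ∀ x, g k x ≤ M) {p : ℝ} (hp : 1 < p) :
    ∫⁻ x, (∑' k, cellAvg μ (π k) (g k) x ^ (2 : ℝ)) ^ (p / 2) ∂μ ≤
      steinConst p * ∫⁻ x, (∑' k, g k x ^ (2 : ℝ)) ^ (p / 2) ∂μ := by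
  have hm := fun k => measurable_cellAvg (hπ.cell k) (g k)
  refine lintegral_tsum_rpow_le_of_window (g := fun k x => cellAvg μ (π k) (g k) x ^ (2 : ℝ))
    (by fun_prop) fun K => ?_
  refine (lintegral_sum_cellAvg_sq_le (hπ.isNested (-K)) (g := fun i => g (-K + i))
    (fun i => hg _) (fun i => hbd _) hp _).trans ?_
  gcongr with x
  exact sum_window_le_tsum (fun k => g k x ^ (2 : ℝ)) K

theorem lintegral_tsum_mul_rpow_le (hπ : IsNestedInt μ π) {β u : ℤ → X → ℝ≥0∞} {δ : ℝ≥0∞}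
    (hβ : ∀ i, Measurable (β i)) (hβ1 : ∀ i x, β i x ≤ 1)
    (hδ : ∀ i x, cellAvg μ (π i) (β i) x ≤ δ) (hu : ∀ i, Function.FactorsThrough (u i) (π i))
    (hut : ∀ i x, u i x ≠ ∞) {q : ℝ} (hq0 : 0 < q) :
    ∫⁻ x, (∑' k, β k x * u k x) ^ q ∂μ ≤
      sparseConst q * δ ^ min 1 q * ∫⁻ x, (∑' k, u k x) ^ q ∂μ := by
  have hm := fun k => measurable_of_factorsThrough (hπ.cell k) (hu k)
  refine lintegral_tsum_rpow_le_of_window (g := fun k x => β k x * u k x)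
    (by fun_prop) fun K => ?_
  refine (lintegral_sum_mul_rpow_le (hπ.isNested (-K)) (β := fun i => β (-K + i))
    (u := fun i => u (-K + i)) (fun i => hβ _) (fun i => hβ1 _) (fun i => hδ _) (fun i => hu _)
    (fun i => hut _) hq0 _).trans ?_
  gcongr with x
  exact sum_window_le_tsum (fun k => u k x) K

variable {f : X → ℝ≥0∞} {M : ℝ≥0}

/-- The square function estimate for martingale differences. -/
theorem lintegral_tsum_diff_sq_le (hπ : IsNestedInt μ π) (hf : Measurable f)
    (hM : ∀ x, f x ≤ M) {p : ℝ} (hp : 1 < p) (hfin : ∫⁻ x, f x ^ p ∂μ ≠ ∞) :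
    ∫⁻ x, (∑' k, ENNReal.ofReal
        (((cellAvg μ (π (k + 1)) f x).toReal - (cellAvg μ (π k) f x).toReal) ^ 2)) ^ (p / 2) ∂μ ≤
      anchorConst p * ∫⁻ x, f x ^ p ∂μ := by
  have hm := fun k => measurable_cellAvg (hπ.cell k) f
  refine lintegral_tsum_rpow_le_of_window (g := fun k x => ENNReal.ofReal
    (((cellAvg μ (π (k + 1)) f x).toReal - (cellAvg μ (π k) f x).toReal) ^ 2))
    (by fun_prop) fun K => ?_
  have := lintegral_anchor_le (hπ.isNested (-K)) hf hM
    (a := fun i x => (cellAvg μ (π (-K + i)) f x).toReal)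
    (fun i x y hxy => by simp only [cellAvg_factorsThrough f hxy])
    (fun t => ⟨rfl, fun i => Or.inr rfl⟩) hp hfin (2 * K)
  simpa only [Nat.cast_add, Nat.cast_one, ← add_assoc] using this

/-- The jump inequality for martingales. -/
theorem exists_jumpCount_cellAvg_le (hπ : IsNestedInt μ π) (hf : Measurable f)
    (hM : ∀ x, f x ≤ M) {p : ℝ} (hp : 1 < p) (hfin : ∫⁻ x, f x ^ p ∂μ ≠ ∞) {lam : ℝ}
    (hlam : 0 < lam) :
    ∃ G : X → ℝ≥0∞, Measurable G ∧
      (∀ x, jumpCount lam univ (fun k => ((cellAvg μ (π k) f x).toReal : ℂ)) *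
        ENNReal.ofReal (lam ^ 2) ≤ G x) ∧
      ∫⁻ x, G x ^ (p / 2) ∂μ ≤ 4 ^ (p / 2) * anchorConst p * ∫⁻ x, f x ^ p ∂μ := by
  have hm := fun k => measurable_cellAvg (hπ.cell k) f
  have hp2 : 0 < p / 2 := by linarith
  set a : ℕ → ℕ → X → ℝ := fun K i x =>
    greedy (lam / 2) (fun j => (cellAvg μ (π (-K + j)) f x).toReal) i with ha
  have haf : ∀ K i, Function.FactorsThrough (a K i) (π (-K + i)) := by
    intro K i x y hxy
    simp only [ha]
    have hx : ∀ j ≤ i, cellAvg μ (π (-K + j)) f x = cellAvg μ (π (-K + j)) f y := fun j hj =>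
      cellAvg_factorsThrough f ((hπ.isNested (-K)).mono hj hxy)
    clear hxy
    induction i with
    | zero => simp only [greedy, hx 0 le_rfl]
    | succ i ih =>
      rw [greedy, greedy, ih fun j hj => hx j (by omega), hx (i + 1) le_rfl]
  have ham : ∀ K i, Measurable (a K i) := fun K i =>
    measurable_of_factorsThrough (hπ.cell _) (haf K i)
  set V : ℕ → X → ℝ≥0∞ := fun K x => ∑ i ∈ Finset.range (2 * K),
    ENNReal.ofReal ((a K (i + 1) x - a K i x) ^ 2) with hV
  have hVm : ∀ K, Measurable (V K) := by fun_prop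
  have hVint : ∀ K, ∫⁻ x, V K x ^ (p / 2) ∂μ ≤ anchorConst p * ∫⁻ x, f x ^ p ∂μ := fun K =>
    lintegral_anchor_le (hπ.isNested (-K)) hf hM (haf K) (fun t => isAnchor_greedy _ _) hp hfin _
  refine ⟨fun x => 4 * (liminf (fun K => V K x ^ (p / 2)) atTop) ^ (p / 2)⁻¹,
    ?_, fun x => ?_, ?_⟩
  · have : Measurable fun x => liminf (fun K => V K x ^ (p / 2)) atTop :=
      Measurable.liminf fun K => (hVm K).pow_const _
    fun_prop
  · simp only [jumpCount, ENNReal.iSup_mul]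
    refine iSup_le fun J => iSup_le fun s => iSup_le fun t => iSup_le fun _ => iSup_le fun _ =>
      iSup_le fun hst => iSup_le fun hts => iSup_le fun hj => ?_
    have key : ∀ᶠ K in atTop, J * ENNReal.ofReal (lam ^ 2) / 4 ≤ V K x := by
      filter_upwards [eventually_ge_atTop (∑ i, (s i).natAbs + ∑ i, (t i).natAbs)] with K hK
      have hsK : ∀ i, (s i).natAbs ≤ K := fun i =>
        (Finset.single_le_sum (f := fun i => (s i).natAbs) (fun _ _ => Nat.zero_le _)
          (Finset.mem_univ i)).trans (by omega)
      have htK : ∀ i, (t i).natAbs ≤ K := fun i =>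
        (Finset.single_le_sum (f := fun i => (t i).natAbs) (fun _ _ => Nat.zero_le _)
          (Finset.mem_univ i)).trans (by omega)
      have hs' : ∀ i, (-K + ((s i + K).toNat : ℤ)) = s i := fun i => by have := hsK i; omega
      have ht' : ∀ i, (-K + ((t i + K).toNat : ℤ)) = t i := fun i => by have := htK i; omega
      have h := natCast_mul_sq_le_greedy hlam
        (x := fun j => (cellAvg μ (π (-K + j)) f x).toReal) (N := 2 * K)
        (s := fun i => (s i + K).toNat) (t := fun i => (t i + K).toNat)
        (fun i => by have := hsK i; have := htK i; have := hst i; omega)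
        (fun i j hij => by have := hsK j; have := htK i; have := hts i j hij; omega)
        (fun i => by have := htK i; omega)
        (fun i => by
          simp only [hs', ht']
          have := hj i
          rwa [← Complex.ofReal_sub, Complex.norm_real, Real.norm_eq_abs] at this)
      rw [ENNReal.div_le_iff (by norm_num) (by norm_num), mul_comm (V K x)]
      simp only [hV, ha]
      rw [← ENNReal.ofReal_sum_of_nonneg fun i _ => sq_nonneg _,
        show (4 : ℝ≥0∞) = ENNReal.ofReal 4 by simp, ← ENNReal.ofReal_natCast,
        ← ENNReal.ofReal_mul (by positivity), ← ENNReal.ofReal_mul (by positivity)]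
      exact ENNReal.ofReal_le_ofReal h
    have h2 : (J * ENNReal.ofReal (lam ^ 2) / 4) ^ (p / 2) ≤
        liminf (fun K => V K x ^ (p / 2)) atTop :=
      le_liminf_of_le (by isBoundedDefault)
        (key.mono fun K hK => ENNReal.rpow_le_rpow hK hp2.le)
    have h3 := ENNReal.rpow_le_rpow h2 (inv_nonneg.2 hp2.le)
    rw [← ENNReal.rpow_mul, mul_inv_cancel₀ hp2.ne', ENNReal.rpow_one,
      ENNReal.div_le_iff (by norm_num) (by norm_num), mul_comm _ (4 : ℝ≥0∞)] at h3
    exact h3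
  · calc _ = ∫⁻ x, 4 ^ (p / 2) * liminf (fun K => V K x ^ (p / 2)) atTop ∂μ := by
          refine lintegral_congr fun x => ?_
          rw [ENNReal.mul_rpow_of_nonneg _ _ hp2.le, ← ENNReal.rpow_mul, inv_mul_cancel₀ hp2.ne',
            ENNReal.rpow_one]
      _ = 4 ^ (p / 2) * ∫⁻ x, liminf (fun K => V K x ^ (p / 2)) atTop ∂μ :=
          lintegral_const_mul _ (Measurable.liminf fun K => (hVm K).pow_const _)
      _ ≤ 4 ^ (p / 2) * liminf (fun K => ∫⁻ x, V K x ^ (p / 2) ∂μ) atTop := by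
          gcongr
          exact lintegral_liminf_le fun K => (hVm K).pow_const _
      _ ≤ _ := by
          rw [mul_assoc]
          gcongr
          refine (liminf_le_liminf (Eventually.of_forall hVint)).trans ?_
          simp

end Nested

/-! ### Mixed norms -/

section MixNorm

variable {X : Type*} [MeasurableSpace X] {μ : Measure X} {p : ℝ}

/-- The `L^p` norm of an extended nonnegative function. -/
def lpNn (μ : Measure X) (p : ℝ) (g : X → ℝ≥0∞) : ℝ≥0∞ := (∫⁻ x, g x ^ p ∂μ) ^ (1 / p)

/-- The `ℓ²(ℤ)` norm. -/
def sqNorm (F : ℤ → ℝ≥0∞) : ℝ≥0∞ := lpNn Measure.count 2 F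

/-- The `L^p(ℓ²)` norm. -/
def mixNorm (μ : Measure X) (p : ℝ) (F : ℤ → X → ℝ≥0∞) : ℝ≥0∞ :=
  lpNn μ p fun x => sqNorm fun k => F k x

theorem lpNn_mono (hp : 0 ≤ p) {f g : X → ℝ≥0∞} (h : ∀ x, f x ≤ g x) : lpNn μ p f ≤ lpNn μ p g :=
  ENNReal.rpow_le_rpow (lintegral_mono fun x => ENNReal.rpow_le_rpow (h x) hp) (by positivity)

theorem lpNn_const_mul (hp : 0 < p) (c : ℝ≥0∞) {g : X → ℝ≥0∞} (hg : Measurable g) :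
    lpNn μ p (fun x => c * g x) = c * lpNn μ p g := by
  unfold lpNn
  simp_rw [ENNReal.mul_rpow_of_nonneg _ _ hp.le]
  rw [lintegral_const_mul _ (by fun_prop), ENNReal.mul_rpow_of_nonneg _ _ (by positivity),
    ← ENNReal.rpow_mul, mul_one_div_cancel hp.ne', ENNReal.rpow_one]

theorem lpNn_zero (hp : 0 < p) : lpNn μ p (fun _ => 0) = 0 := by
  simp [lpNn, ENNReal.zero_rpow_of_pos, hp]

theorem lpNn_sum_le {ι : Type*} (hp : 1 ≤ p) (s : Finset ι) {g : ι → X → ℝ≥0∞}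
    (hg : ∀ i, Measurable (g i)) :
    lpNn μ p (fun x => ∑ i ∈ s, g i x) ≤ ∑ i ∈ s, lpNn μ p (g i) := by
  classical
  induction s using Finset.induction_on with
  | empty => simp [lpNn_zero (zero_lt_one.trans_le hp)]
  | insert i s hi ih =>
    simp_rw [Finset.sum_insert hi]
    refine le_trans ?_ (add_le_add le_rfl ih)
    exact ENNReal.lintegral_Lp_add_le (hg i).aemeasurable
      (Finset.measurable_fun_sum s fun j _ => hg j).aemeasurable hp

theorem lpNn_add_le (hp : 1 ≤ p) {f g : X → ℝ≥0∞} (hf : Measurable f) (hg : Measurable g) :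
    lpNn μ p (fun x => f x + g x) ≤ lpNn μ p f + lpNn μ p g :=
  ENNReal.lintegral_Lp_add_le hf.aemeasurable hg.aemeasurable hp

theorem lpNn_tsum_le (hp : 1 ≤ p) {g : ℕ → X → ℝ≥0∞} (hg : ∀ i, Measurable (g i)) :
    lpNn μ p (fun x => ∑' i, g i x) ≤ ∑' i, lpNn μ p (g i) := by
  have hp0 : 0 < p := zero_lt_one.trans_le hp
  have hlim : ∀ x, Tendsto (fun K : ℕ => (∑ i ∈ Finset.range K, g i x) ^ p) atTop
      (𝓝 ((∑' k, g k x) ^ p)) := fun x =>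
    (ENNReal.continuous_rpow_const.tendsto _).comp ENNReal.summable.hasSum.tendsto_sum_nat
  have hB : ∀ K : ℕ, ∫⁻ x, (∑ i ∈ Finset.range K, g i x) ^ p ∂μ ≤ (∑' i, lpNn μ p (g i)) ^ p := by
    intro K
    have := (lpNn_sum_le (μ := μ) hp (Finset.range K) hg).trans (ENNReal.sum_le_tsum _)
    have := ENNReal.rpow_le_rpow this hp0.le
    rwa [lpNn, ← ENNReal.rpow_mul, one_div_mul_cancel hp0.ne', ENNReal.rpow_one] at this
  have : ∫⁻ x, (∑' i, g i x) ^ p ∂μ ≤ (∑' i, lpNn μ p (g i)) ^ p := by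
    calc _ = ∫⁻ x, liminf (fun K : ℕ => (∑ i ∈ Finset.range K, g i x) ^ p) atTop ∂μ :=
          lintegral_congr fun x => (hlim x).liminf_eq.symm
      _ ≤ liminf (fun K : ℕ => ∫⁻ x, (∑ i ∈ Finset.range K, g i x) ^ p ∂μ) atTop :=
          lintegral_liminf_le fun K => by fun_prop
      _ ≤ _ := by
          refine (liminf_le_liminf (Eventually.of_forall hB)).trans ?_
          simp
  have := ENNReal.rpow_le_rpow this (z := 1 / p) (by positivity)
  rwa [← ENNReal.rpow_mul, mul_one_div_cancel hp0.ne', ENNReal.rpow_one] at this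

theorem sqNorm_eq (F : ℤ → ℝ≥0∞) : sqNorm F = (∑' k, F k ^ (2 : ℝ)) ^ ((1 : ℝ) / 2) := by
  rw [sqNorm, lpNn, lintegral_count]

theorem sqNorm_mono {F G : ℤ → ℝ≥0∞} (h : ∀ k, F k ≤ G k) : sqNorm F ≤ sqNorm G :=
  lpNn_mono zero_le_two h

theorem sqNorm_shift (F : ℤ → ℝ≥0∞) (a : ℤ) : sqNorm (fun k => F (k + a)) = sqNorm F := by
  rw [sqNorm_eq, sqNorm_eq]
  congr 1
  exact (Equiv.addRight a).tsum_eq fun k => F k ^ (2 : ℝ)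

theorem measurable_sqNorm {F : ℤ → X → ℝ≥0∞} (hF : ∀ k, Measurable (F k)) :
    Measurable fun x => sqNorm fun k => F k x := by
  simp_rw [sqNorm_eq]
  fun_prop

theorem mixNorm_mono (hp : 0 ≤ p) {F G : ℤ → X → ℝ≥0∞} (h : ∀ k x, F k x ≤ G k x) :
    mixNorm μ p F ≤ mixNorm μ p G :=
  lpNn_mono hp fun x => sqNorm_mono fun k => h k x

theorem mixNorm_const_mul (hp : 0 < p) (c : ℝ≥0∞) {F : ℤ → X → ℝ≥0∞}
    (hF : ∀ k, Measurable (F k)) :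
    mixNorm μ p (fun k x => c * F k x) = c * mixNorm μ p F := by
  unfold mixNorm
  rw [← lpNn_const_mul hp c (measurable_sqNorm hF)]
  congr 1
  ext x
  exact lpNn_const_mul two_pos c (measurable_of_countable _)

theorem mixNorm_shift (F : ℤ → X → ℝ≥0∞) (a : ℤ) :
    mixNorm μ p (fun k => F (k + a)) = mixNorm μ p F := by
  unfold mixNorm
  congr 1
  ext x
  exact sqNorm_shift (fun k => F k x) a

theorem mixNorm_add_le (hp : 1 ≤ p) {F G : ℤ → X → ℝ≥0∞} (hF : ∀ k, Measurable (F k))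
    (hG : ∀ k, Measurable (G k)) :
    mixNorm μ p (fun k x => F k x + G k x) ≤ mixNorm μ p F + mixNorm μ p G :=
  (lpNn_mono (zero_le_one.trans hp) fun _ => lpNn_add_le one_le_two (measurable_of_countable _)
    (measurable_of_countable _)).trans
    (lpNn_add_le hp (measurable_sqNorm hF) (measurable_sqNorm hG))

theorem mixNorm_sum_le {ι : Type*} (hp : 1 ≤ p) (s : Finset ι) {F : ι → ℤ → X → ℝ≥0∞}
    (hF : ∀ i k, Measurable (F i k)) :
    mixNorm μ p (fun k x => ∑ i ∈ s, F i k x) ≤ ∑ i ∈ s, mixNorm μ p (F i) :=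
  (lpNn_mono (zero_le_one.trans hp) fun _ => lpNn_sum_le one_le_two s fun _ =>
    measurable_of_countable _).trans
    (lpNn_sum_le hp s fun i => measurable_sqNorm (hF i))

theorem mixNorm_tsum_le (hp : 1 ≤ p) {F : ℕ → ℤ → X → ℝ≥0∞} (hF : ∀ i k, Measurable (F i k)) :
    mixNorm μ p (fun k x => ∑' i, F i k x) ≤ ∑' i, mixNorm μ p (F i) :=
  (lpNn_mono (zero_le_one.trans hp) fun _ => lpNn_tsum_le one_le_two fun _ =>
    measurable_of_countable _).trans
    (lpNn_tsum_le hp fun i => measurable_sqNorm (hF i))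

theorem mixNorm_eq (F : ℤ → X → ℝ≥0∞) :
    mixNorm μ p F = (∫⁻ x, (∑' k, F k x ^ (2 : ℝ)) ^ (p / 2) ∂μ) ^ (1 / p) := by
  unfold mixNorm lpNn
  simp_rw [sqNorm_eq, ← ENNReal.rpow_mul]
  congr! 4
  ring

end MixNorm

/-! ### Shifted dyadic lattices -/

section Lattice

variable {n : ℕ}

/-- The shift of the dyadic lattice of generation `k`. -/
def latShift (b : Bool) (k : ℤ) : ℝ := if b then (-1) ^ k / 3 else 0

/-- The index of the cell of generation `k` containing a point; cells are cubes of side `2 ^ (-k)`. -/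
def lat (ω : Fin n → Bool) (k : ℤ) (x : En n) : Fin n → ℤ :=
  fun i => ⌊(2 : ℝ) ^ k * x i + latShift (ω i) k⌋

/-- The volume of a cell of generation `k`. -/
def cellVol (n : ℕ) (k : ℤ) : ℝ≥0∞ := ENNReal.ofReal ((2 : ℝ) ^ (-k)) ^ n

theorem cellVol_ne_zero (k : ℤ) : cellVol n k ≠ 0 := by
  have : (0 : ℝ) < 2 ^ (-k) := by positivity
  exact pow_ne_zero _ (ENNReal.ofReal_pos.2 this).ne'

theorem cellVol_ne_top (k : ℤ) : cellVol n k ≠ ∞ := by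
  simp [cellVol]

theorem volume_setOf_forall_mem (I : Fin n → Set ℝ) (hI : ∀ i, MeasurableSet (I i)) :
    volume {x : En n | ∀ i, x i ∈ I i} = ∏ i, volume (I i) := by
  have h := (EuclideanSpace.volume_preserving_symm_measurableEquiv_toLp (Fin n)).measure_preimage
    (MeasurableSet.univ_pi hI).nullMeasurableSet
  rw [volume_pi_pi] at h
  rw [← h]
  congr 1
  ext x
  simp

theorem lat_preimage (ω : Fin n → Bool) (k : ℤ) (c : Fin n → ℤ) :
    lat ω k ⁻¹' {c} = {x | ∀ i, x i ∈ Ico ((2 : ℝ) ^ (-k) * (c i - latShift (ω i) k))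
      ((2 : ℝ) ^ (-k) * (c i - latShift (ω i) k) + 2 ^ (-k))} := by
  ext x
  simp only [mem_preimage, mem_singleton_iff, funext_iff, lat, Int.floor_eq_iff, mem_ofPred_eq,
    mem_Ico]
  refine forall_congr' fun i => ?_
  have h2 : (0 : ℝ) < 2 ^ k := by positivity
  rw [zpow_neg, ← mul_add_one, ← div_eq_inv_mul, ← div_eq_inv_mul, div_le_iff₀' h2, lt_div_iff₀' h2]
  constructor <;> rintro ⟨h, h'⟩ <;> constructor <;> linarith

theorem volume_lat_preimage (ω : Fin n → Bool) (k : ℤ) (c : Fin n → ℤ) :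
    volume (lat ω k ⁻¹' {c}) = cellVol n k := by
  rw [lat_preimage, volume_setOf_forall_mem _ fun i => measurableSet_Ico]
  simp [Real.volume_Ico, cellVol]

theorem isCellMap_lat (ω : Fin n → Bool) (k : ℤ) : IsCellMap volume (lat ω k) where
  measurableSet c := by
    rw [lat_preimage, ofPred_forall]
    exact MeasurableSet.iInter fun i => measurableSet_Ico.preimage (by fun_prop)
  ne_zero x := by rw [volume_lat_preimage]; exact cellVol_ne_zero k
  ne_top x := by rw [volume_lat_preimage]; exact cellVol_ne_top k

theorem two_mul_latShift_sub (b : Bool) (k : ℤ) :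
    ∃ z : ℤ, 2 * latShift b k - latShift b (k + 1) = z := by
  rcases b with _ | _
  · exact ⟨0, by simp [latShift]⟩
  · rcases Int.even_or_odd k with h | h
    · exact ⟨1, by simp [latShift, zpow_add₀, h.neg_one_zpow]; norm_num⟩
    · exact ⟨-1, by simp [latShift, zpow_add₀, h.neg_one_zpow]; norm_num⟩

theorem isNestedInt_lat (ω : Fin n → Bool) : IsNestedInt volume (lat ω) where
  cell := isCellMap_lat ω
  succ k x y h := by
    ext i
    have hi := congrFun h i
    simp only [lat] at hi ⊢
    obtain ⟨z, hz⟩ := two_mul_latShift_sub (ω i) k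
    have key : ∀ t : ℝ, ⌊(2 : ℝ) ^ k * t + latShift (ω i) k⌋ =
        (⌊(2 : ℝ) ^ (k + 1) * t + latShift (ω i) (k + 1)⌋ + z) / 2 := by
      intro t
      have h2 := Int.floor_div_natCast ((2 : ℝ) ^ (k + 1) * t + latShift (ω i) (k + 1) + z) 2
      rw [Int.floor_add_intCast, Nat.cast_ofNat, Nat.cast_ofNat] at h2
      rw [← h2]
      congr 1
      rw [← hz, zpow_add₀ two_ne_zero]
      ring
    rw [key, key, hi]

theorem isNestedInt_lat_sub (ω : Fin n → Bool) (a : ℤ) :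
    IsNestedInt volume fun k => lat ω (k - a) where
  cell k := isCellMap_lat ω _
  succ k := by
    have := (isNestedInt_lat ω).succ (k - a)
    rwa [sub_add_eq_add_sub] at this

theorem cellVol_mul_cellAvg (ω : Fin n → Bool) (k : ℤ) (g : En n → ℝ≥0∞) (x : En n) :
    cellVol n k * cellAvg volume (lat ω k) g x = ∫⁻ y in lat ω k ⁻¹' {lat ω k x}, g y := by
  rw [cellAvg, volume_lat_preimage, ← mul_assoc,
    ENNReal.mul_inv_cancel (cellVol_ne_zero k) (cellVol_ne_top k), one_mul]

theorem abs_latShift_true (k : ℤ) : latShift true k = 1 / 3 ∨ latShift true k = -1 / 3 := by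
  rcases Int.even_or_odd k with h | h
  · exact Or.inl (by simp [latShift, h.neg_one_zpow])
  · exact Or.inr (by simp [latShift, h.neg_one_zpow])

theorem exists_floor_add_latShift_eq (k : ℤ) (u : ℝ) :
    ∃ b : Bool, ∀ v, |v - u| ≤ 1 / 8 → ⌊v + latShift b k⌋ = ⌊u + latShift b k⌋ := by
  suffices ∃ b : Bool, ∃ z : ℤ, ∀ v, |v - u| ≤ 1 / 8 → ⌊v + latShift b k⌋ = z by
    obtain ⟨b, z, h⟩ := this
    exact ⟨b, fun v hv => (h v hv).trans (h u (by simp)).symm⟩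
  have h0 := Int.floor_le u
  have h1 := Int.lt_floor_add_one u
  have near : ∀ z : ℤ, |u - z| ≤ 1 / 8 →
      ∃ b : Bool, ∃ z : ℤ, ∀ v, |v - u| ≤ 1 / 8 → ⌊v + latShift b k⌋ = z := by
    intro z hz
    rw [abs_le] at hz
    rcases abs_latShift_true k with h | h
    · refine ⟨true, z, fun v hv => ?_⟩
      rw [abs_le] at hv
      rw [Int.floor_eq_iff, h]
      constructor <;> linarith [hv.1, hv.2, hz.1, hz.2]
    · refine ⟨true, z - 1, fun v hv => ?_⟩
      rw [abs_le] at hv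
      rw [Int.floor_eq_iff, h]
      push_cast
      constructor <;> linarith [hv.1, hv.2, hz.1, hz.2]
  by_cases ha : u < ⌊u⌋ + 1 / 8
  · exact near ⌊u⌋ (abs_le.2 ⟨by linarith, by linarith⟩)
  by_cases hb : ⌊u⌋ + 7 / 8 ≤ u
  · exact near (⌊u⌋ + 1) (by push_cast; exact abs_le.2 ⟨by linarith, by linarith⟩)
  refine ⟨false, ⌊u⌋, fun v hv => ?_⟩
  rw [abs_le] at hv
  rw [Int.floor_eq_iff]
  simp only [latShift, Bool.false_eq_true, if_false, add_zero]
  constructor <;> linarith [hv.1, hv.2]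

/-- The cube of centre `x` and side `4 * 2 ^ (-k)`. -/
def box (k : ℤ) (x : En n) : Set (En n) := {y | ∀ i, |y i - x i| ≤ 2 * 2 ^ (-k)}

theorem measurableSet_box (k : ℤ) (x : En n) : MeasurableSet (box k x) := by
  rw [box, ofPred_forall]
  exact MeasurableSet.iInter fun i => measurableSet_le (by fun_prop) (by fun_prop)

/-- Every cube is contained in a cell of comparable size of one of the lattices. -/
theorem exists_box_subset_cell (k : ℤ) (x : En n) :
    ∃ ω : Fin n → Bool, box k x ⊆ lat ω (k - 4) ⁻¹' {lat ω (k - 4) x} := by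
  choose ω hω using fun i => exists_floor_add_latShift_eq (k - 4) ((2 : ℝ) ^ (k - 4) * x i)
  refine ⟨ω, fun y hy => ?_⟩
  ext i
  refine hω i _ ?_
  rw [← mul_sub, abs_mul, abs_of_pos (by positivity)]
  calc _ ≤ (2 : ℝ) ^ (k - 4) * (2 * 2 ^ (-k)) := by gcongr; exact hy i
    _ = 1 / 8 := by
      rw [zpow_sub₀ two_ne_zero, zpow_neg]
      field_simp
      norm_num

theorem setLIntegral_box_le (k : ℤ) (x : En n) (g : En n → ℝ≥0∞) :
    ∫⁻ y in box k x, g y ≤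
      cellVol n (k - 4) * ∑ ω : Fin n → Bool, cellAvg volume (lat ω (k - 4)) g x := by
  obtain ⟨ω, hω⟩ := exists_box_subset_cell k x
  calc _ ≤ ∫⁻ y in lat ω (k - 4) ⁻¹' {lat ω (k - 4) x}, g y := lintegral_mono_set hω
    _ = cellVol n (k - 4) * cellAvg volume (lat ω (k - 4)) g x := (cellVol_mul_cellAvg ..).symm
    _ ≤ _ := by
      gcongr
      exact Finset.single_le_sum (f := fun ω => cellAvg volume (lat ω (k - 4)) g x)
        (fun _ _ => zero_le) (Finset.mem_univ ω)

/-- The points within relative distance `2 ^ (-m)` of the boundary of a cell of the standard lattice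
of generation `j`. -/
def nearBdry (n : ℕ) (j : ℤ) (m : ℕ) : Set (En n) :=
  ⋃ i, {x | ∃ z : ℤ, |(2 : ℝ) ^ j * x i - z| ≤ 2 ^ (-m : ℤ)}

theorem measurableSet_near_int (j : ℤ) (m : ℕ) :
    MeasurableSet {t : ℝ | ∃ z : ℤ, |(2 : ℝ) ^ j * t - z| ≤ 2 ^ (-m : ℤ)} := by
  rw [ofPred_exists]
  exact MeasurableSet.iUnion fun z => measurableSet_le (by fun_prop) (by fun_prop)

theorem measurableSet_nearBdry (j : ℤ) (m : ℕ) : MeasurableSet (nearBdry n j m) :=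
  MeasurableSet.iUnion fun i => (measurableSet_near_int j m).preimage (by fun_prop)

theorem volume_near_int_inter_Ico_le (j : ℤ) (m : ℕ) (a : ℝ) :
    volume ({t : ℝ | ∃ z : ℤ, |(2 : ℝ) ^ j * t - z| ≤ 2 ^ (-m : ℤ)} ∩ Ico a (a + 2 ^ (-(j - 4)))) ≤
      ENNReal.ofReal (3 * 2 ^ (-m : ℤ)) * ENNReal.ofReal (2 ^ (-(j - 4))) := by
  have h2 : (0 : ℝ) < 2 ^ j := by positivity
  have hm : (2 : ℝ) ^ (-m : ℤ) ≤ 1 := zpow_le_one_of_nonpos₀ (by norm_num) (by simp)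
  set u : ℤ := ⌊(2 : ℝ) ^ j * a⌋ with hu
  have hu0 := Int.floor_le ((2 : ℝ) ^ j * a)
  have hu1 := Int.lt_floor_add_one ((2 : ℝ) ^ j * a)
  rw [← hu] at hu0 hu1
  have h16 : (2 : ℝ) ^ (-(j - 4)) = 16 * (2 ^ j)⁻¹ := by
    rw [neg_sub, zpow_sub₀ two_ne_zero]; norm_num [div_eq_mul_inv]
  have hsub : ({t : ℝ | ∃ z : ℤ, |(2 : ℝ) ^ j * t - z| ≤ 2 ^ (-m : ℤ)} ∩
      Ico a (a + 2 ^ (-(j - 4)))) ⊆ ⋃ z ∈ Finset.Icc (u - 1) (u + 18),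
        Icc (((2 : ℝ) ^ j)⁻¹ * (z - 2 ^ (-m : ℤ))) (((2 : ℝ) ^ j)⁻¹ * (z + 2 ^ (-m : ℤ))) := by
    rintro t ⟨⟨z, hz⟩, ht⟩
    rw [abs_le] at hz
    rw [mem_Ico, h16] at ht
    have ht0 : (2 : ℝ) ^ j * a ≤ 2 ^ j * t := by gcongr; exact ht.1
    have ht1 : (2 : ℝ) ^ j * t ≤ 2 ^ j * a + 16 := by
      calc (2 : ℝ) ^ j * t ≤ 2 ^ j * (a + 16 * (2 ^ j)⁻¹) := by gcongr; exact ht.2.le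
        _ = _ := by field_simp
    simp only [mem_iUnion, mem_Icc, Finset.mem_Icc]
    refine ⟨z, ⟨?_, ?_⟩, ?_, ?_⟩
    · have : ((u - 1 : ℤ) : ℝ) ≤ z := by push_cast; linarith [hz.2]
      exact_mod_cast this
    · have : (z : ℝ) ≤ ((u + 18 : ℤ) : ℝ) := by push_cast; linarith [hz.1]
      exact_mod_cast this
    · rw [← div_eq_inv_mul, div_le_iff₀' h2]; linarith [hz.1]
    · rw [← div_eq_inv_mul, le_div_iff₀' h2]; linarith [hz.2]
  calc _ ≤ _ := measure_mono hsub
    _ ≤ ∑ z ∈ Finset.Icc (u - 1) (u + 18), volume (Icc (((2 : ℝ) ^ j)⁻¹ * (z - 2 ^ (-m : ℤ)))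
        (((2 : ℝ) ^ j)⁻¹ * (z + 2 ^ (-m : ℤ)))) := measure_biUnion_finset_le _ _
    _ = ∑ z ∈ Finset.Icc (u - 1) (u + 18), ENNReal.ofReal (((2 : ℝ) ^ j)⁻¹ * (2 * 2 ^ (-m : ℤ))) := by
      refine Finset.sum_congr rfl fun z _ => ?_
      rw [Real.volume_Icc]
      congr 1
      ring
    _ = ENNReal.ofReal (20 * (((2 : ℝ) ^ j)⁻¹ * (2 * 2 ^ (-m : ℤ)))) := by
      rw [Finset.sum_const, Int.card_Icc, show (u + 18 + 1 - (u - 1)).toNat = 20 by lia,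
        nsmul_eq_mul, ENNReal.ofReal_mul (by norm_num : (0 : ℝ) ≤ 20), Nat.cast_ofNat,
        ENNReal.ofReal_ofNat]
    _ ≤ _ := by
      rw [← ENNReal.ofReal_mul (by positivity), h16]
      apply ENNReal.ofReal_le_ofReal
      have : 0 ≤ ((2 : ℝ) ^ j)⁻¹ * 2 ^ (-m : ℤ) := by positivity
      nlinarith

theorem cellAvg_indicator_nearBdry_le (ω : Fin n → Bool) (j : ℤ) (m : ℕ) (x : En n) :
    cellAvg volume (lat ω (j - 4)) ((nearBdry n j m).indicator 1) x ≤
      n * ENNReal.ofReal (3 * 2 ^ (-m : ℤ)) := by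
  have hone : ∀ i : Fin n, volume ({x : En n | ∃ z : ℤ, |(2 : ℝ) ^ j * x i - z| ≤ 2 ^ (-m : ℤ)} ∩
      lat ω (j - 4) ⁻¹' {lat ω (j - 4) x}) ≤
        ENNReal.ofReal (3 * 2 ^ (-m : ℤ)) * cellVol n (j - 4) := by
    intro i
    rw [lat_preimage]
    set a : Fin n → ℝ := fun i =>
      (2 : ℝ) ^ (-(j - 4)) * (lat ω (j - 4) x i - latShift (ω i) (j - 4))
    set T : Set ℝ := {t : ℝ | ∃ z : ℤ, |(2 : ℝ) ^ j * t - z| ≤ 2 ^ (-m : ℤ)}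
    have hset : {x : En n | ∃ z : ℤ, |(2 : ℝ) ^ j * x i - z| ≤ 2 ^ (-m : ℤ)} ∩
        {x | ∀ i, x i ∈ Ico (a i) (a i + 2 ^ (-(j - 4)))} ⊆
        {x | ∀ l, x l ∈ if l = i then T ∩ Ico (a l) (a l + 2 ^ (-(j - 4)))
          else Ico (a l) (a l + 2 ^ (-(j - 4)))} := by
      rintro y ⟨h1, h2⟩ l
      by_cases hl : l = i
      · subst hl
        rw [if_pos rfl]
        exact ⟨h1, h2 l⟩
      · simpa [hl] using h2 l
    refine (measure_mono hset).trans ?_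
    rw [volume_setOf_forall_mem]
    · calc _ ≤ ∏ l, (if l = i then ENNReal.ofReal (3 * 2 ^ (-m : ℤ)) else 1) *
            ENNReal.ofReal (2 ^ (-(j - 4))) := by
            refine Finset.prod_le_prod' fun l _ => ?_
            by_cases hl : l = i
            · rw [if_pos hl, if_pos hl]
              exact volume_near_int_inter_Ico_le j m (a l)
            · simp [hl]
        _ = _ := by
            rw [Finset.prod_mul_distrib, Finset.prod_ite_eq' _ i]
            simp [cellVol]
    · intro l
      split_ifs
      · exact (measurableSet_near_int j m).inter measurableSet_Ico
      · exact measurableSet_Ico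
  have hvol : ∫⁻ y in lat ω (j - 4) ⁻¹' {lat ω (j - 4) x}, (nearBdry n j m).indicator 1 y ≤
      n * ENNReal.ofReal (3 * 2 ^ (-m : ℤ)) * cellVol n (j - 4) := by
    rw [lintegral_indicator_one (measurableSet_nearBdry j m),
      Measure.restrict_apply (measurableSet_nearBdry j m), nearBdry, iUnion_inter]
    refine (measure_iUnion_fintype_le _ _).trans ?_
    refine (Finset.sum_le_sum fun i _ => hone i).trans ?_
    simp [mul_assoc]
  rw [cellAvg, volume_lat_preimage]
  refine (mul_le_mul_right hvol _).trans_eq ?_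
  rw [mul_comm, mul_assoc, ENNReal.mul_inv_cancel (cellVol_ne_zero _) (cellVol_ne_top _), mul_one]

end Lattice

/-! ### Differences of extended nonnegative reals -/

section Ediff

/-- The absolute difference of two extended nonnegative reals. -/
def ediff (a b : ℝ≥0∞) : ℝ≥0∞ := (a - b) + (b - a)

theorem ediff_comm (a b : ℝ≥0∞) : ediff a b = ediff b a := add_comm _ _

theorem ediff_of_le {a b : ℝ≥0∞} (h : a ≤ b) : ediff a b = b - a := by
  rw [ediff, tsub_eq_zero_of_le h, zero_add]

@[simp] theorem ediff_self (a : ℝ≥0∞) : ediff a a = 0 := by simp [ediff]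

theorem ediff_eq_edist {a b : ℝ≥0∞} (ha : a ≠ ∞) (hb : b ≠ ∞) :
    ediff a b = edist a.toReal b.toReal := by
  wlog h : a ≤ b generalizing a b
  · rw [ediff_comm, edist_comm]
    exact this hb ha (le_of_not_ge h)
  rw [ediff_of_le h, edist_dist, dist_comm, Real.dist_eq, ← ENNReal.toReal_sub_of_le h hb, abs_of_nonneg
    ENNReal.toReal_nonneg, ENNReal.ofReal_toReal (ENNReal.sub_ne_top hb)]

theorem ediff_ofReal {a b : ℝ} (ha : 0 ≤ a) (hb : 0 ≤ b) :
    ediff (ENNReal.ofReal a) (ENNReal.ofReal b) = ENNReal.ofReal |a - b| := by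
  rw [ediff_eq_edist ENNReal.ofReal_ne_top ENNReal.ofReal_ne_top, ENNReal.toReal_ofReal ha,
    ENNReal.toReal_ofReal hb, edist_dist, Real.dist_eq]

theorem ediff_le_of_le_add {a b d : ℝ≥0∞} (h : a ≤ b + d) (h' : b ≤ a + d) : ediff a b ≤ d := by
  wlog hab : a ≤ b generalizing a b
  · rw [ediff_comm]
    exact this h' h (le_of_not_ge hab)
  rw [ediff_of_le hab]
  exact tsub_le_iff_left.2 h'

theorem le_add_ediff (a b : ℝ≥0∞) : a ≤ b + ediff a b :=
  le_add_tsub.trans (add_le_add le_rfl le_self_add)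

theorem ediff_mul_le (a b c : ℝ≥0∞) : ediff (a * b) (a * c) ≤ a * ediff b c := by
  refine ediff_le_of_le_add ?_ ?_
  · rw [← mul_add]
    exact mul_le_mul_right (le_add_ediff b c) a
  · rw [← mul_add, ediff_comm]
    exact mul_le_mul_right (le_add_ediff c b) a

theorem mul_add_mul_le_ediff (a b c d : ℝ≥0∞) :
    a * b + c * d ≤ a * d + c * b + ediff a c * ediff b d := by
  wlog hac : a ≤ c generalizing a b c d
  · have := this c d a b (le_of_not_ge hac)
    rw [ediff_comm, ediff_comm b d]
    convert this using 1 <;> ring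
  obtain ⟨e, rfl⟩ := exists_add_of_le hac
  rcases le_total b d with h | h
  · obtain ⟨g, rfl⟩ := exists_add_of_le h
    have h1 : e ≤ a + e - a ∨ a = ∞ := by
      by_cases ha : a = ∞
      · exact Or.inr ha
      · exact Or.inl (by rw [ENNReal.add_sub_cancel_left ha])
    have h2 : g ≤ b + g - b ∨ b = ∞ := by
      by_cases hb : b = ∞
      · exact Or.inr hb
      · exact Or.inl (by rw [ENNReal.add_sub_cancel_left hb])
    rcases h1 with h1 | rfl
    · rcases h2 with h2 | rfl
      · rw [ediff_of_le hac, ediff_of_le h]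
        calc _ = a * (b + g) + (a + e) * b + e * g := by ring
          _ ≤ _ := by gcongr
      · simp only [top_add]
        refine (add_comm _ _).trans_le ?_
        rw [add_comm ((a : ℝ≥0∞) * ∞)]
        exact le_self_add
    · simp only [top_add]
      refine (add_comm _ _).trans_le ?_
      exact le_self_add
  · obtain ⟨g, rfl⟩ := exists_add_of_le h
    calc _ ≤ a * d + (a + e) * (d + g) := by
          have : a * (d + g) + (a + e) * d + e * g = a * d + (a + e) * (d + g) := by ring
          rw [← this]; exact le_self_add
      _ ≤ _ := le_self_add

theorem measurable_ediff {X : Type*} [MeasurableSpace X] {f g : X → ℝ≥0∞} (hf : Measurable f)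
    (hg : Measurable g) : Measurable fun x => ediff (f x) (g x) := by
  unfold ediff
  fun_prop

theorem ediff_lintegral_le {X : Type*} [MeasurableSpace X] {μ : Measure X} {f g : X → ℝ≥0∞}
    (hf : Measurable f) (hg : Measurable g) :
    ediff (∫⁻ x, f x ∂μ) (∫⁻ x, g x ∂μ) ≤ ∫⁻ x, ediff (f x) (g x) ∂μ := by
  refine ediff_le_of_le_add ?_ ?_
  · rw [← lintegral_add_left hg]
    exact lintegral_mono fun x => le_add_ediff _ _
  · rw [← lintegral_add_left hf]
    simp_rw [ediff_comm (f _)]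
    exact lintegral_mono fun x => le_add_ediff _ _

end Ediff

/-! ### The smooth averaging kernels -/

section Kernel

variable {n : ℕ} {S : En n → ℝ} {L : ℝ≥0}

/-- A nonnegative Lipschitz function of integral one supported in the unit cube. -/
structure IsBump (S : En n → ℝ) (L : ℝ≥0) : Prop where
  nonneg : ∀ x, 0 ≤ S x
  lip : LipschitzWith L S
  supp : ∀ x, (∃ i, 1 < |x i|) → S x = 0
  integral : ∫ x, S x = 1

/-- The dilated kernel. -/
def dilKer (S : En n → ℝ) (k : ℤ) (z : En n) : ℝ := (2 : ℝ) ^ (k * n) * S ((2 : ℝ) ^ k • z)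

/-- The smooth average at scale `2 ^ (-k)`. -/
def smAvg (S : En n → ℝ) (k : ℤ) (g : En n → ℝ≥0∞) (x : En n) : ℝ≥0∞ :=
  ∫⁻ y, ENNReal.ofReal (dilKer S k (x - y)) * g y

theorem IsBump.dilKer_nonneg (hS : IsBump S L) (k : ℤ) (z : En n) : 0 ≤ dilKer S k z :=
  mul_nonneg (by positivity) (hS.nonneg _)

theorem IsBump.continuous_dilKer (hS : IsBump S L) (k : ℤ) : Continuous (dilKer S k) := by
  have := hS.lip.continuous
  unfold dilKer
  fun_prop

theorem IsBump.measurable_dilKer (hS : IsBump S L) (k : ℤ) (x : En n) :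
    Measurable fun y => ENNReal.ofReal (dilKer S k (x - y)) := by
  have := hS.continuous_dilKer k
  fun_prop

theorem IsBump.abs_le_of_dilKer_ne_zero (hS : IsBump S L) {k : ℤ} {z : En n} (h : dilKer S k z ≠ 0)
    (i : Fin n) : |z i| ≤ 2 ^ (-k) := by
  by_contra! hi
  refine h ?_
  rw [dilKer, hS.supp _ ⟨i, ?_⟩, mul_zero]
  rw [PiLp.smul_apply, smul_eq_mul, abs_mul, abs_of_pos (by positivity)]
  calc (1 : ℝ) = 2 ^ k * 2 ^ (-k) := by rw [← zpow_add₀ two_ne_zero]; simp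
    _ < _ := by gcongr

theorem IsBump.integrable (hS : IsBump S L) : Integrable S := by
  by_contra h
  have := hS.integral
  rw [integral_undef h] at this
  exact zero_ne_one this

theorem IsBump.integral_dilKer (hS : IsBump S L) (k : ℤ) : ∫ z, dilKer S k z = 1 := by
  unfold dilKer
  rw [integral_const_mul, Measure.integral_comp_smul, hS.integral]
  simp only [zpow_mul, zpow_natCast, finrank_euclideanSpace, Fintype.card_fin, smul_eq_mul, mul_one]
  rw [abs_of_pos (by positivity), mul_inv_cancel₀ (by positivity)]

theorem IsBump.lintegral_dilKer (hS : IsBump S L) (k : ℤ) (x : En n) :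
    ∫⁻ y, ENNReal.ofReal (dilKer S k (x - y)) = 1 := by
  rw [lintegral_sub_left_eq_self (fun z => ENNReal.ofReal (dilKer S k z)) x,
    ← ofReal_integral_eq_lintegral_ofReal, hS.integral_dilKer, ENNReal.ofReal_one]
  · exact (hS.integrable.comp_smul (by positivity)).const_mul _
  · exact Eventually.of_forall fun z => hS.dilKer_nonneg k z

theorem IsBump.abs_dilKer_sub_le (hS : IsBump S L) (k : ℤ) {ε : ℝ} (hε : 0 ≤ ε) {z w : En n}
    (h : ∀ i, |z i - w i| ≤ ε) :
    |dilKer S k z - dilKer S k w| ≤ (2 : ℝ) ^ (k * n) * (L * √n * (2 ^ k * ε)) := by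
  rw [dilKer, dilKer, ← mul_sub, abs_mul, abs_of_pos (by positivity)]
  gcongr
  have h1 := hS.lip.dist_le_mul ((2 : ℝ) ^ k • z) ((2 : ℝ) ^ k • w)
  rw [Real.dist_eq] at h1
  refine h1.trans ?_
  rw [mul_assoc]
  gcongr
  rw [dist_smul₀, Real.norm_of_nonneg (by positivity)]
  have : dist z w ≤ √n * ε := by
    rw [EuclideanSpace.dist_eq]
    calc _ ≤ √(∑ i : Fin n, ε ^ 2) := by
          refine Real.sqrt_le_sqrt (Finset.sum_le_sum fun i _ => ?_)
          rw [Real.dist_eq]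
          exact pow_le_pow_left₀ (abs_nonneg _) (h i) 2
      _ = _ := by simp [Real.sqrt_sq hε]
  calc _ ≤ (2 : ℝ) ^ k * (√n * ε) := by gcongr
    _ = _ := by ring

theorem IsBump.smAvg_const (hS : IsBump S L) (k : ℤ) (c : ℝ≥0∞) (x : En n) :
    smAvg S k (fun _ => c) x = c := by
  rw [smAvg, lintegral_mul_const _ (hS.measurable_dilKer k x), hS.lintegral_dilKer, one_mul]

theorem IsBump.smAvg_congr (hS : IsBump S L) {k : ℤ} {x : En n} {g h : En n → ℝ≥0∞}
    (H : ∀ y, (∀ i, |x i - y i| ≤ 2 ^ (-k)) → g y = h y) : smAvg S k g x = smAvg S k h x := by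
  refine lintegral_congr fun y => ?_
  by_cases hy : dilKer S k (x - y) = 0
  · simp [hy]
  · rw [H y fun i => by simpa using hS.abs_le_of_dilKer_ne_zero hy i]

theorem IsBump.smAvg_le (hS : IsBump S L) {k : ℤ} {x : En n} {g : En n → ℝ≥0∞} {c : ℝ≥0∞}
    (H : ∀ y, (∀ i, |x i - y i| ≤ 2 ^ (-k)) → g y ≤ c) : smAvg S k g x ≤ c := by
  rw [← hS.smAvg_const k c x]
  refine lintegral_mono fun y => ?_
  by_cases hy : dilKer S k (x - y) = 0
  · simp [hy]
  · exact mul_le_mul_right (H y fun i => by simpa using hS.abs_le_of_dilKer_ne_zero hy i) _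

theorem IsBump.ediff_smAvg_le (hS : IsBump S L) {k : ℤ} {x : En n} {g h : En n → ℝ≥0∞}
    (hg : Measurable g) (hh : Measurable h) :
    ediff (smAvg S k g x) (smAvg S k h x) ≤ smAvg S k (fun y => ediff (g y) (h y)) x := by
  refine (ediff_lintegral_le ((hS.measurable_dilKer k x).mul hg)
    ((hS.measurable_dilKer k x).mul hh)).trans (lintegral_mono fun y => ediff_mul_le _ _ _)

theorem IsBump.measurable_smAvg (hS : IsBump S L) {k : ℤ} {g : En n → ℝ≥0∞} (hg : Measurable g) :
    Measurable (smAvg S k g) := by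
  have := (hS.continuous_dilKer k).measurable
  refine Measurable.lintegral_prod_right' (f := fun z : En n × En n =>
    ENNReal.ofReal (dilKer S k (z.1 - z.2)) * g z.2) (by fun_prop)

end Kernel

/-! ### Comparison of smooth and dyadic averages -/

section CellBounds

variable {X : Type*} [MeasurableSpace X] {μ : Measure X} {ι : Type*} {P : X → ι}

theorem cellAvg_le_of_cell (hP : IsCellMap μ P) {g : X → ℝ≥0∞} {c : ℝ≥0∞} {x : X}
    (h : ∀ y, P y = P x → g y ≤ c) : cellAvg μ P g x ≤ c := by
  rw [cellAvg, ← ENNReal.div_eq_inv_mul]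
  refine ENNReal.div_le_of_le_mul ?_
  rw [← setLIntegral_const]
  exact setLIntegral_mono' (hP.measurableSet _) fun y hy => h y hy

theorem le_cellAvg_of_cell (hP : IsCellMap μ P) {g : X → ℝ≥0∞} {c : ℝ≥0∞} {x : X}
    (h : ∀ y, P y = P x → c ≤ g y) : c ≤ cellAvg μ P g x := by
  rw [cellAvg, ← ENNReal.div_eq_inv_mul,
    ENNReal.le_div_iff_mul_le (Or.inl (hP.ne_zero x)) (Or.inl (hP.ne_top x)), ← setLIntegral_const]
  exact setLIntegral_mono' (hP.measurableSet _) fun y hy => h y hy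

end CellBounds

section Compare

variable {n : ℕ} {S : En n → ℝ} {L : ℝ≥0} {f : En n → ℝ≥0∞} {M : ℝ≥0}

/-- The average over the cells of the standard dyadic lattice of generation `j`. -/
def stdAvg (j : ℤ) (f : En n → ℝ≥0∞) : En n → ℝ≥0∞ := cellAvg volume (lat (fun _ => false) j) f

/-- The absolute dyadic martingale difference. -/
def mdiff (f : En n → ℝ≥0∞) (j : ℤ) (x : En n) : ℝ≥0∞ := ediff (stdAvg j f x) (stdAvg (j - 1) f x)

/-- The sum over all shifted lattices of the averages over cells of side `16 * 2 ^ (-j)`. -/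
def latSum (j : ℤ) (g : En n → ℝ≥0∞) (x : En n) : ℝ≥0∞ :=
  ∑ ω : Fin n → Bool, cellAvg volume (lat ω (j - 4)) g x

theorem measurable_stdAvg (j : ℤ) (f : En n → ℝ≥0∞) : Measurable (stdAvg j f) :=
  measurable_cellAvg (isCellMap_lat _ j) f

theorem stdAvg_le (j : ℤ) (hM : ∀ x, f x ≤ M) (x : En n) : stdAvg j f x ≤ M :=
  cellAvg_le_const (isCellMap_lat _ j) hM x

theorem stdAvg_factorsThrough (j : ℤ) (f : En n → ℝ≥0∞) :
    Function.FactorsThrough (stdAvg j f) (lat (fun _ => false) j) :=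
  cellAvg_factorsThrough f

theorem lat_sub_one_eq {ω : Fin n → Bool} {j : ℤ} {x y : En n} (h : lat ω j x = lat ω j y) :
    lat ω (j - 1) x = lat ω (j - 1) y :=
  (isNestedInt_lat ω).succ (j - 1) (by rwa [sub_add_cancel])

theorem measurable_mdiff (f : En n → ℝ≥0∞) (j : ℤ) : Measurable (mdiff f j) :=
  measurable_ediff (measurable_stdAvg j f) (measurable_stdAvg (j - 1) f)

theorem mdiff_factorsThrough (f : En n → ℝ≥0∞) (j : ℤ) :
    Function.FactorsThrough (mdiff f j) (lat (fun _ => false) j) := by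
  intro x y h
  rw [mdiff, mdiff, stdAvg_factorsThrough j f h, stdAvg_factorsThrough (j - 1) f (lat_sub_one_eq h)]

theorem mdiff_le (hM : ∀ x, f x ≤ M) (j : ℤ) (x : En n) : mdiff f j x ≤ M :=
  ediff_le_of_le_add ((stdAvg_le j hM x).trans le_add_self)
    ((stdAvg_le (j - 1) hM x).trans le_add_self)

theorem measurable_latSum (j : ℤ) (g : En n → ℝ≥0∞) : Measurable (latSum j g) :=
  Finset.measurable_fun_sum _ fun ω _ => measurable_cellAvg (isCellMap_lat ω _) g

theorem ofReal_zpow_mul_cellVol (k : ℤ) :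
    ENNReal.ofReal ((2 : ℝ) ^ (k * n)) * cellVol n (k - 4) = 16 ^ n := by
  rw [zpow_mul, zpow_natCast, ENNReal.ofReal_pow (by positivity), cellVol, ← mul_pow,
    ← ENNReal.ofReal_mul (by positivity), ← zpow_add₀ two_ne_zero]
  norm_num

theorem cellVol_sub_four (k : ℤ) : cellVol n (k - 4) = 16 ^ n * cellVol n k := by
  rw [cellVol, cellVol, ← mul_pow, neg_sub, sub_eq_add_neg, zpow_add₀ two_ne_zero,
    ENNReal.ofReal_mul (by positivity)]
  norm_num

theorem volume_box_ne_top (k : ℤ) (x : En n) : volume (box k x) ≠ ∞ := by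
  obtain ⟨ω, h⟩ := exists_box_subset_cell k x
  refine ne_top_of_le_ne_top ?_ (measure_mono h)
  rw [volume_lat_preimage]
  exact cellVol_ne_top _

theorem abs_sub_le_of_lat_eq {ω : Fin n → Bool} {j : ℤ} {x y : En n} (h : lat ω j x = lat ω j y)
    (i : Fin n) : |x i - y i| ≤ 2 ^ (-j) := by
  have h1 := (Int.abs_sub_lt_one_of_floor_eq_floor (congrFun h i)).le
  rw [add_sub_add_right_eq_sub, ← mul_sub, abs_mul, abs_of_pos (by positivity)] at h1
  rw [zpow_neg, ← one_div, le_div_iff₀' (by positivity)]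
  exact h1

/-- The corner of a standard dyadic cell. -/
def corner (j : ℤ) (y : En n) : En n :=
  WithLp.toLp 2 fun i => (2 : ℝ) ^ (-j) * lat (fun _ => false) j y i

theorem abs_sub_corner_le (j : ℤ) (y : En n) (i : Fin n) : |y i - corner j y i| ≤ 2 ^ (-j) := by
  have h : y i - corner j y i = (2 : ℝ) ^ (-j) * ((2 : ℝ) ^ j * y i - ⌊(2 : ℝ) ^ j * y i⌋) := by
    rw [mul_sub, ← mul_assoc, ← zpow_add₀ two_ne_zero]
    simp [corner, lat, latShift]
  rw [h, abs_mul, abs_of_pos (by positivity), Int.self_sub_floor, Int.abs_fract]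
  exact mul_le_of_le_one_right (by positivity) (Int.fract_lt_one _).le

theorem IsBump.ediff_dilKer_corner_le (hS : IsBump S L) (k : ℤ) (m : ℕ) (x y : En n) :
    ediff (ENNReal.ofReal (dilKer S k (x - y))) (ENNReal.ofReal (dilKer S k (x - corner (k + m) y))) ≤
      (box k x).indicator (fun _ => ENNReal.ofReal ((2 : ℝ) ^ (k * n)) *
        ENNReal.ofReal (L * √n * 2 ^ (-m : ℤ))) y := by
  have hmk : (2 : ℝ) ^ (-(k + m)) ≤ 2 ^ (-k) := zpow_le_zpow_right₀ one_le_two (by lia)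
  have h0 : (0 : ℝ) < 2 ^ (-k) := by positivity
  by_cases hy : y ∈ box k x
  · rw [indicator_of_mem hy, ediff_ofReal (hS.dilKer_nonneg _ _) (hS.dilKer_nonneg _ _),
      ← ENNReal.ofReal_mul (by positivity)]
    refine ENNReal.ofReal_le_ofReal ?_
    refine (hS.abs_dilKer_sub_le k (ε := 2 ^ (-(k + m))) (by positivity) fun i => ?_).trans_eq ?_
    · simpa [abs_sub_comm] using abs_sub_corner_le (k + m) y i
    · rw [← zpow_add₀ two_ne_zero]
      congr 3
      ring
  · rw [indicator_of_notMem hy]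
    have h1 : dilKer S k (x - y) = 0 := by
      by_contra h
      refine hy fun i => ?_
      have := hS.abs_le_of_dilKer_ne_zero h i
      rw [PiLp.sub_apply, abs_sub_comm] at this
      linarith
    have h2 : dilKer S k (x - corner (k + m) y) = 0 := by
      by_contra h
      refine hy fun i => ?_
      have h3 := hS.abs_le_of_dilKer_ne_zero h i
      rw [PiLp.sub_apply, abs_sub_comm] at h3
      have h4 := abs_sub_corner_le (k + m) y i
      have h5 := abs_sub_le (y i) (corner (k + m) y i) (x i)
      linarith
    simp [h1, h2]

theorem IsBump.ediff_smAvg_stdAvg_fine_le (hS : IsBump S L) (hf : Measurable f) (hM : ∀ x, f x ≤ M)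
    (k : ℤ) (m : ℕ) (x : En n) :
    ediff (smAvg S k (stdAvg (k + m + 1) f) x) (smAvg S k (stdAvg (k + m) f) x) ≤
      16 ^ n * ENNReal.ofReal (L * √n * 2 ^ (-m : ℤ)) * latSum k (mdiff f (k + m + 1)) x := by
  set K : En n → ℝ≥0∞ := fun y => ENNReal.ofReal (dilKer S k (x - y)) with hK
  set φ : En n → ℝ≥0∞ := fun y => ENNReal.ofReal (dilKer S k (x - corner (k + m) y)) with hφ
  have hKm : Measurable K := hS.measurable_dilKer k x
  have hφ0 : Function.FactorsThrough φ (lat (fun _ => false) (k + m)) := by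
    intro y z h
    simp only [hφ, corner, h]
  have hφ1 : Function.FactorsThrough φ (lat (fun _ => false) (k + m + 1)) := fun y z h =>
    hφ0 ((isNestedInt_lat _).succ (k + m) h)
  have hφm : Measurable φ := measurable_of_factorsThrough (isCellMap_lat _ _) hφ0
  set d : ℝ≥0∞ := ENNReal.ofReal ((2 : ℝ) ^ (k * n)) * ENNReal.ofReal (L * √n * 2 ^ (-m : ℤ)) with hd
  have hdt : d ≠ ∞ := ENNReal.mul_ne_top ENNReal.ofReal_ne_top ENNReal.ofReal_ne_top
  have hKφ : ∀ y, ediff (K y) (φ y) ≤ (box k x).indicator (fun _ => d) y :=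
    hS.ediff_dilKer_corner_le k m x
  have hE1 : ∫⁻ y, φ y * stdAvg (k + m + 1) f y = ∫⁻ y, φ y * f y := by
    simp_rw [mul_comm (φ _)]
    exact lintegral_cellAvg_mul (isCellMap_lat _ _) hf hφ1
  have hE0 : ∫⁻ y, φ y * stdAvg (k + m) f y = ∫⁻ y, φ y * f y := by
    simp_rw [mul_comm (φ _)]
    exact lintegral_cellAvg_mul (isCellMap_lat _ _) hf hφ0
  have hfin : ∫⁻ y, φ y * f y ≠ ∞ := by
    have : ∫⁻ y, φ y * f y ≤ (1 + d * volume (box k x)) * M := by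
      calc _ ≤ ∫⁻ y, (K y + (box k x).indicator (fun _ => d) y) * M := by
            refine lintegral_mono fun y => mul_le_mul' ?_ (hM y)
            refine (le_add_ediff (φ y) (K y)).trans (add_le_add le_rfl ?_)
            rw [ediff_comm]
            exact hKφ y
        _ = _ := by
            have hi : Measurable ((box k x).indicator fun _ => d) :=
              measurable_const.indicator (measurableSet_box k x)
            rw [lintegral_mul_const (f := fun y => K y + (box k x).indicator (fun _ => d) y) _
              (hKm.add hi), lintegral_add_left hKm,
              lintegral_indicator (measurableSet_box k x), setLIntegral_const, hK, hS.lintegral_dilKer]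
    refine ne_top_of_le_ne_top (ENNReal.mul_ne_top ?_ ENNReal.coe_ne_top) this
    exact ENNReal.add_ne_top.2 ⟨ENNReal.one_ne_top, ENNReal.mul_ne_top hdt (volume_box_ne_top k x)⟩
  have key : ∀ u v : En n → ℝ≥0∞, Measurable u → Measurable v →
      ∫⁻ y, φ y * u y = ∫⁻ y, φ y * f y → ∫⁻ y, φ y * v y = ∫⁻ y, φ y * f y →
      ∫⁻ y, K y * u y ≤ (∫⁻ y, K y * v y) + ∫⁻ y, ediff (K y) (φ y) * ediff (u y) (v y) := by
    intro u v hu hv hu' hv'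
    have h : ∫⁻ y, (K y * u y + φ y * v y) ≤
        ∫⁻ y, (K y * v y + φ y * u y + ediff (K y) (φ y) * ediff (u y) (v y)) :=
      lintegral_mono fun y => mul_add_mul_le_ediff _ _ _ _
    rw [lintegral_add_left (f := fun y => K y * u y) (hKm.mul hu),
      lintegral_add_left (f := fun y => K y * v y + φ y * u y) ((hKm.mul hv).add (hφm.mul hu)),
      lintegral_add_left (f := fun y => K y * v y) (hKm.mul hv), hu', hv', add_right_comm] at h
    exact (ENNReal.add_le_add_iff_right hfin).1 h
  have m1 := measurable_stdAvg (k + m + 1) f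
  have m0 := measurable_stdAvg (k + m) f
  have hmd : mdiff f (k + m + 1) = fun y => ediff (stdAvg (k + m + 1) f y) (stdAvg (k + m) f y) := by
    ext y
    rw [mdiff, add_sub_cancel_right]
  have hbd : ∫⁻ y, ediff (K y) (φ y) * mdiff f (k + m + 1) y ≤
      16 ^ n * ENNReal.ofReal (L * √n * 2 ^ (-m : ℤ)) * latSum k (mdiff f (k + m + 1)) x := by
    calc _ ≤ ∫⁻ y, (box k x).indicator (fun y => d * mdiff f (k + m + 1) y) y := by
          refine lintegral_mono fun y => ?_
          refine (mul_le_mul_left (hKφ y) _).trans_eq ?_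
          by_cases hy : y ∈ box k x <;> simp [hy]
      _ = d * ∫⁻ y in box k x, mdiff f (k + m + 1) y := by
          rw [lintegral_indicator (measurableSet_box k x), lintegral_const_mul _ (measurable_mdiff f _)]
      _ ≤ d * (cellVol n (k - 4) * latSum k (mdiff f (k + m + 1)) x) :=
          mul_le_mul_right (setLIntegral_box_le k x _) _
      _ = _ := by
          rw [← ofReal_zpow_mul_cellVol k, hd]
          ring
  rw [hmd] at hbd
  refine ediff_le_of_le_add ?_ ?_
  · refine (key _ _ m1 m0 hE1 hE0).trans (add_le_add le_rfl ?_)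
    rwa [hmd]
  · refine (key _ _ m0 m1 hE0 hE1).trans (add_le_add le_rfl ?_)
    simp_rw [ediff_comm (stdAvg (k + m) f _)]
    rwa [hmd]

theorem mdiff_le_latSum (f : En n → ℝ≥0∞) (j : ℤ) {x y : En n} (h : ∀ i, |x i - y i| ≤ 2 ^ (-j)) :
    mdiff f j y ≤ 16 ^ n * latSum j (mdiff f j) x := by
  have h1 : mdiff f j y ≤ stdAvg j (mdiff f j) y :=
    le_cellAvg_of_cell (isCellMap_lat _ j) fun z hz => (mdiff_factorsThrough f j hz).ge
  refine h1.trans ?_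
  have h2 : cellVol n j * stdAvg j (mdiff f j) y ≤ cellVol n (j - 4) * latSum j (mdiff f j) x := by
    rw [stdAvg, cellVol_mul_cellAvg]
    refine (lintegral_mono_set fun z hz i => ?_).trans (setLIntegral_box_le j x _)
    have h3 := abs_sub_le_of_lat_eq hz i
    have h4 := h i
    rw [abs_sub_comm] at h4
    have h5 := abs_sub_le (z i) (y i) (x i)
    linarith
  rw [cellVol_sub_four, mul_comm (16 ^ n), mul_assoc] at h2
  exact (ENNReal.mul_le_mul_iff_right (cellVol_ne_zero j) (cellVol_ne_top j)).1 h2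

theorem lat_eq_of_notMem_nearBdry {k : ℤ} {m : ℕ} {x y : En n} (hx : x ∉ nearBdry n (k - m) m)
    (h : ∀ i, |x i - y i| ≤ 2 ^ (-k)) :
    lat (fun _ => false) (k - m) y = lat (fun _ => false) (k - m) x := by
  ext i
  simp only [lat, latShift, Bool.false_eq_true, if_false, add_zero]
  set u := (2 : ℝ) ^ (k - m) * x i with hu
  set v := (2 : ℝ) ^ (k - m) * y i with hv
  have huv : |u - v| ≤ 2 ^ (-m : ℤ) := by
    rw [hu, hv, ← mul_sub, abs_mul, abs_of_pos (by positivity)]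
    calc _ ≤ (2 : ℝ) ^ (k - m) * 2 ^ (-k) := by gcongr; exact h i
      _ = _ := by rw [← zpow_add₀ two_ne_zero]; congr 1; ring
  have hx' : ∀ z : ℤ, ¬ |u - z| ≤ 2 ^ (-m : ℤ) := by
    intro z hz
    exact hx (mem_iUnion.2 ⟨i, z, hz⟩)
  rw [abs_le] at huv
  rcases lt_trichotomy ⌊v⌋ ⌊u⌋ with hlt | heq | hlt
  · have h1 := Int.floor_lt.1 hlt
    have h2 := Int.floor_le u
    exact absurd (abs_le.2 ⟨by linarith, by linarith⟩) (hx' ⌊u⌋)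
  · exact heq
  · have h1 := Int.floor_lt.1 hlt
    have h2 := Int.floor_le v
    exact absurd (abs_le.2 ⟨by linarith, by linarith⟩) (hx' ⌊v⌋)

theorem IsBump.smAvg_bdd (hS : IsBump S L) {k : ℤ} (hM : ∀ x, f x ≤ M) (x : En n) :
    smAvg S k f x ≠ ∞ :=
  ne_top_of_le_ne_top ENNReal.coe_ne_top (hS.smAvg_le (c := M) fun y _ => hM y)

theorem stdAvg_ne_top (j : ℤ) (hM : ∀ x, f x ≤ M) (x : En n) : stdAvg j f x ≠ ∞ :=
  ne_top_of_le_ne_top ENNReal.coe_ne_top (stdAvg_le j hM x)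

theorem edist_sub_sub_le (a b c d : ℝ) : edist (a - b) (c - d) ≤ edist a c + edist b d := by
  simp_rw [edist_dist, ← ENNReal.ofReal_add dist_nonneg dist_nonneg, Real.dist_eq]
  refine ENNReal.ofReal_le_ofReal ?_
  have := abs_sub (a - c) (b - d)
  rwa [show a - c - (b - d) = a - b - (c - d) by ring] at this

theorem IsBump.edist_coarse_le (hS : IsBump S L) (hM : ∀ x, f x ≤ M)
    (k : ℤ) (m : ℕ) (x : En n) :
    edist ((smAvg S k (stdAvg (k - m) f) x).toReal - (stdAvg (k - m) f x).toReal)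
      ((smAvg S k (stdAvg (k - m - 1) f) x).toReal - (stdAvg (k - m - 1) f x).toReal) ≤
      2 * 16 ^ n * ((nearBdry n (k - m) m).indicator 1 x * latSum (k - m) (mdiff f (k - m)) x) := by
  by_cases hx : x ∈ nearBdry n (k - m) m
  · have hb := fun j => hS.smAvg_bdd (k := k) (stdAvg_le j hM) x
    have hmk : (2 : ℝ) ^ (-k) ≤ 2 ^ (-(k - m)) := zpow_le_zpow_right₀ one_le_two (by lia)
    refine (edist_sub_sub_le _ _ _ _).trans ?_
    rw [← ediff_eq_edist (hb _) (hb _),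
      ← ediff_eq_edist (stdAvg_ne_top _ hM x) (stdAvg_ne_top _ hM x), indicator_of_mem hx,
      Pi.one_apply, one_mul, mul_assoc, two_mul]
    refine add_le_add ?_ ?_
    · refine (hS.ediff_smAvg_le (measurable_stdAvg _ f) (measurable_stdAvg _ f)).trans ?_
      exact hS.smAvg_le fun y hy => mdiff_le_latSum f _ fun i => (hy i).trans hmk
    · exact mdiff_le_latSum f _ fun i => by simp; positivity
  · have h1 : smAvg S k (stdAvg (k - m) f) x = stdAvg (k - m) f x := by
      rw [hS.smAvg_congr (h := fun _ => stdAvg (k - m) f x), hS.smAvg_const]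
      exact fun y hy => stdAvg_factorsThrough _ f (lat_eq_of_notMem_nearBdry hx hy)
    have h2 : smAvg S k (stdAvg (k - m - 1) f) x = stdAvg (k - m - 1) f x := by
      rw [hS.smAvg_congr (h := fun _ => stdAvg (k - m - 1) f x), hS.smAvg_const]
      exact fun y hy => stdAvg_factorsThrough _ f (lat_sub_one_eq (lat_eq_of_notMem_nearBdry hx hy))
    rw [h1, h2]
    simp

end Compare

/-! ### The square function of the difference of smooth and dyadic averages -/

section Compare

variable {n : ℕ} {S : En n → ℝ} {L : ℝ≥0} {f : En n → ℝ≥0∞} {M : ℝ≥0} {p : ℝ}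

/-- A bounded, integrable, uniformly continuous function. -/
structure IsNice (f : En n → ℝ≥0∞) (M : ℝ≥0) : Prop where
  measurable : Measurable f
  bdd : ∀ x, f x ≤ M
  integrable : ∫⁻ x, f x ≠ ∞
  unif : ∀ ε : ℝ≥0∞, 0 < ε → ∃ δ : ℝ, 0 < δ ∧ ∀ x y, dist x y < δ → ediff (f x) (f y) ≤ ε

theorem dist_le_of_lat_eq {ω : Fin n → Bool} {j : ℤ} {x y : En n} (h : lat ω j x = lat ω j y) :
    dist x y ≤ √n * 2 ^ (-j) := by
  rw [EuclideanSpace.dist_eq]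
  calc _ ≤ √(∑ i : Fin n, ((2 : ℝ) ^ (-j)) ^ 2) := by
        refine Real.sqrt_le_sqrt (Finset.sum_le_sum fun i _ => ?_)
        rw [Real.dist_eq]
        exact pow_le_pow_left₀ (abs_nonneg _) (abs_sub_le_of_lat_eq h i) 2
    _ = _ := by
        have : (0 : ℝ) ≤ 2 ^ (-j) := by positivity
        rw [Finset.sum_const, Finset.card_univ, Fintype.card_fin, nsmul_eq_mul,
          Real.sqrt_mul (Nat.cast_nonneg n), Real.sqrt_sq this]

theorem tendsto_zpow_neg_atTop (k : ℤ) :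
    Tendsto (fun m : ℕ => (2 : ℝ) ^ (-(k + m))) atTop (𝓝 0) := by
  have h : ∀ m : ℕ, (2 : ℝ) ^ (-(k + m)) = 2 ^ (-k) * (1 / 2 : ℝ) ^ m := by
    intro m
    rw [neg_add, zpow_add₀ two_ne_zero, zpow_neg, zpow_neg, zpow_natCast]
    simp
  simp_rw [h]
  simpa using (tendsto_pow_atTop_nhds_zero_of_lt_one (by norm_num : (0 : ℝ) ≤ 1 / 2)
    (by norm_num)).const_mul ((2 : ℝ) ^ (-k))

theorem IsNice.ediff_stdAvg_le {ε : ℝ≥0∞} {j : ℤ} {δ : ℝ}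
    (hδ : ∀ x y, dist x y < δ → ediff (f x) (f y) ≤ ε) (hj : √n * 2 ^ (-j) < δ) (y : En n) :
    ediff (stdAvg j f y) (f y) ≤ ε := by
  have h : ∀ z, lat (fun _ => false) j z = lat (fun _ => false) j y → ediff (f z) (f y) ≤ ε :=
    fun z hz => hδ z y ((dist_le_of_lat_eq hz).trans_lt hj)
  refine ediff_le_of_le_add ?_ ?_
  · exact cellAvg_le_of_cell (isCellMap_lat _ j) fun z hz =>
      (le_add_ediff (f z) (f y)).trans (add_le_add le_rfl (h z hz))
  · rw [← tsub_le_iff_right]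
    refine le_cellAvg_of_cell (isCellMap_lat _ j) fun z hz => ?_
    rw [tsub_le_iff_right]
    refine (le_add_ediff (f y) (f z)).trans (add_le_add le_rfl ?_)
    rw [ediff_comm]
    exact h z hz

theorem IsBump.tendsto_smAvg_stdAvg_fine (hS : IsBump S L) (hf : IsNice f M) (k : ℤ) (x : En n) :
    Tendsto (fun m : ℕ => (smAvg S k (stdAvg (k + m) f) x).toReal) atTop
      (𝓝 (smAvg S k f x).toReal) := by
  rw [EMetric.tendsto_atTop]
  intro ε hε
  obtain ⟨ε', hε', hεε'⟩ := exists_between hε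
  obtain ⟨δ, hδ, H⟩ := hf.unif ε' hε'
  have hlim := (tendsto_zpow_neg_atTop k).const_mul (√n)
  rw [mul_zero] at hlim
  obtain ⟨N, hN⟩ := eventually_atTop.1 (hlim.eventually_lt_const hδ)
  refine ⟨N, fun m hm => lt_of_le_of_lt ?_ hεε'⟩
  rw [← ediff_eq_edist (hS.smAvg_bdd (stdAvg_le _ hf.bdd) x) (hS.smAvg_bdd hf.bdd x)]
  refine (hS.ediff_smAvg_le (measurable_stdAvg _ f) hf.measurable).trans ?_
  exact hS.smAvg_le fun y _ => IsNice.ediff_stdAvg_le H (hN m hm) y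

theorem IsNice.stdAvg_le_inv_mul (j : ℤ) (f : En n → ℝ≥0∞) (x : En n) :
    stdAvg j f x ≤ (cellVol n j)⁻¹ * ∫⁻ y, f y := by
  rw [stdAvg, cellAvg, volume_lat_preimage]
  exact mul_le_mul_right (setLIntegral_le_lintegral _ _) _

theorem tendsto_inv_cellVol (hn : 1 ≤ n) (k : ℤ) :
    Tendsto (fun m : ℕ => (cellVol n (k - m))⁻¹) atTop (𝓝 0) := by
  have h : ∀ m : ℕ, (cellVol n (k - m))⁻¹ = ENNReal.ofReal (2 ^ (-(-k + m))) ^ n := by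
    intro m
    rw [cellVol, ENNReal.inv_pow, ← ENNReal.ofReal_inv_of_pos (by positivity), zpow_neg, inv_inv]
    congr 3
    ring
  simp_rw [h]
  have h1 := ((ENNReal.continuous_pow n).tendsto _).comp
    ((ENNReal.continuous_ofReal.tendsto _).comp (tendsto_zpow_neg_atTop (-k)))
  simpa [zero_pow (Nat.one_le_iff_ne_zero.1 hn), Function.comp_def] using h1

theorem IsBump.tendsto_coarse (hS : IsBump S L) (hn : 1 ≤ n) (hf : IsNice f M) (k : ℤ) (x : En n) :
    Tendsto (fun m : ℕ => (smAvg S k (stdAvg (k - m) f) x).toReal - (stdAvg (k - m) f x).toReal)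
      atTop (𝓝 0) := by
  have hlim : Tendsto (fun m : ℕ => (cellVol n (k - m))⁻¹ * ∫⁻ y, f y) atTop (𝓝 0) := by
    simpa using ENNReal.Tendsto.mul_const (tendsto_inv_cellVol hn k) (Or.inr hf.integrable)
  have h1 : Tendsto (fun m : ℕ => stdAvg (k - m) f x) atTop (𝓝 0) :=
    tendsto_of_tendsto_of_tendsto_of_le_of_le tendsto_const_nhds hlim (fun _ => zero_le)
      fun m => IsNice.stdAvg_le_inv_mul _ f x
  have h2 : Tendsto (fun m : ℕ => smAvg S k (stdAvg (k - m) f) x) atTop (𝓝 0) :=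
    tendsto_of_tendsto_of_tendsto_of_le_of_le tendsto_const_nhds hlim (fun _ => zero_le)
      fun m => hS.smAvg_le fun y _ => IsNice.stdAvg_le_inv_mul _ f y
  simpa using ((ENNReal.tendsto_toReal ENNReal.zero_ne_top).comp h2).sub
    ((ENNReal.tendsto_toReal ENNReal.zero_ne_top).comp h1)

/-- The difference of the smooth and the dyadic average. -/
def avgDiff (S : En n → ℝ) (f : En n → ℝ≥0∞) (k : ℤ) (x : En n) : ℝ≥0∞ :=
  edist (smAvg S k f x).toReal (stdAvg k f x).toReal

theorem IsBump.avgDiff_le (hS : IsBump S L) (hn : 1 ≤ n) (hf : IsNice f M) (k : ℤ) (x : En n) :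
    avgDiff S f k x ≤
      (∑' m : ℕ, 16 ^ n * ENNReal.ofReal (L * √n * 2 ^ (-m : ℤ)) *
        latSum k (mdiff f (k + m + 1)) x) +
      ∑' m : ℕ, 2 * 16 ^ n *
        ((nearBdry n (k - m) m).indicator 1 x * latSum (k - m) (mdiff f (k - m)) x) := by
  have h1 := edist_le_tsum_of_edist_le_of_tendsto₀
    (fun m : ℕ => 16 ^ n * ENNReal.ofReal (L * √n * 2 ^ (-m : ℤ)) *
      latSum k (mdiff f (k + m + 1)) x) (fun m => ?_) (hS.tendsto_smAvg_stdAvg_fine hf k x)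
  · have h2 := edist_le_tsum_of_edist_le_of_tendsto₀
      (fun m : ℕ => 2 * 16 ^ n *
        ((nearBdry n (k - m) m).indicator 1 x * latSum (k - m) (mdiff f (k - m)) x))
      (fun m => ?_) (hS.tendsto_coarse hn hf k x)
    · refine (edist_triangle _ (smAvg S k (stdAvg k f) x).toReal _).trans (add_le_add ?_ ?_)
      · simpa [edist_comm] using h1
      · simpa [edist_dist, Real.dist_eq] using h2
    · have := hS.edist_coarse_le hf.bdd k m x
      rwa [sub_sub, ← Nat.cast_succ] at this
  · have h := hS.ediff_smAvg_stdAvg_fine_le hf.measurable hf.bdd k m x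
    rw [ediff_comm, ediff_eq_edist (hS.smAvg_bdd (stdAvg_le _ hf.bdd) x)
      (hS.smAvg_bdd (stdAvg_le _ hf.bdd) x), add_assoc k, ← Nat.cast_succ] at h
    rwa [add_assoc k, ← Nat.cast_succ]

theorem mixNorm_cellAvg_le (ω : Fin n → Bool) (hp : 1 < p) {g : ℤ → En n → ℝ≥0∞}
    (hg : ∀ k, Measurable (g k)) (hb : ∀ k x, g k x ≤ M) :
    mixNorm volume p (fun k => cellAvg volume (lat ω (k - 4)) (g k)) ≤
      steinConst p ^ (1 / p) * mixNorm volume p g := by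
  have hp0 : 0 < p := zero_lt_one.trans hp
  rw [mixNorm_eq, mixNorm_eq, ← ENNReal.mul_rpow_of_nonneg _ _ (by positivity)]
  exact ENNReal.rpow_le_rpow (lintegral_tsum_cellAvg_sq_le (isNestedInt_lat_sub ω 4) hg
    (fun k => ⟨M, hb k⟩) hp) (by positivity)

theorem mixNorm_latSum_le (hp : 1 < p) {g : ℤ → En n → ℝ≥0∞}
    (hg : ∀ k, Measurable (g k)) (hb : ∀ k x, g k x ≤ M) :
    mixNorm volume p (fun k => latSum k (g k)) ≤
      2 ^ n * steinConst p ^ (1 / p) * mixNorm volume p g := by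
  refine (mixNorm_sum_le hp.le Finset.univ
    (F := fun ω k => cellAvg volume (lat ω (k - 4)) (g k))
    fun ω k => measurable_cellAvg (isCellMap_lat ω _) _).trans ?_
  refine (Finset.sum_le_sum fun ω _ => mixNorm_cellAvg_le ω hp hg hb).trans_eq ?_
  simp [mul_assoc]

theorem mixNorm_nearBdry_mul_cellAvg_le (ω : Fin n → Bool) (hp : 1 < p) (m : ℕ)
    {g : ℤ → En n → ℝ≥0∞} (hg : ∀ k, Measurable (g k)) (hb : ∀ k x, g k x ≤ M) :
    mixNorm volume p (fun k x =>
        (nearBdry n k m).indicator 1 x * cellAvg volume (lat ω (k - 4)) (g k) x) ≤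
      (sparseConst (p / 2) * (n * ENNReal.ofReal (3 * 2 ^ (-m : ℤ))) ^ min 1 (p / 2)) ^ (1 / p) *
        (steinConst p ^ (1 / p) * mixNorm volume p g) := by
  have hp0 : 0 < p := zero_lt_one.trans hp
  refine le_trans ?_ (mul_le_mul_right (mixNorm_cellAvg_le ω hp hg hb) _)
  rw [mixNorm_eq, mixNorm_eq, ← ENNReal.mul_rpow_of_nonneg _ _ (by positivity)]
  refine ENNReal.rpow_le_rpow ?_ (by positivity)
  have h := lintegral_tsum_mul_rpow_le (isNestedInt_lat_sub ω 4)
    (β := fun k => (nearBdry n k m).indicator 1)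
    (u := fun k x => cellAvg volume (lat ω (k - 4)) (g k) x ^ (2 : ℝ))
    (δ := n * ENNReal.ofReal (3 * 2 ^ (-m : ℤ))) (q := p / 2)
    (fun k => measurable_one.indicator (measurableSet_nearBdry k m))
    (fun k x => indicator_le_self' (fun _ _ => zero_le) x)
    (fun k x => cellAvg_indicator_nearBdry_le ω k m x)
    (fun k x y hxy => by simp only [cellAvg_factorsThrough (μ := volume) (g k) hxy])
    (fun k x => ENNReal.rpow_ne_top_of_nonneg zero_le_two
      (ne_top_of_le_ne_top ENNReal.coe_ne_top (cellAvg_le_const (isCellMap_lat ω _) (hb k) x)))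
    (by positivity)
  refine le_trans (le_of_eq ?_) h
  refine lintegral_congr fun x => ?_
  congr 1
  refine tsum_congr fun k => ?_
  by_cases hx : x ∈ nearBdry n k m <;> simp [hx]

theorem mixNorm_nearBdry_mul_latSum_le (hp : 1 < p) (m : ℕ)
    {g : ℤ → En n → ℝ≥0∞} (hg : ∀ k, Measurable (g k)) (hb : ∀ k x, g k x ≤ M) :
    mixNorm volume p (fun k x => (nearBdry n k m).indicator 1 x * latSum k (g k) x) ≤
      2 ^ n * ((sparseConst (p / 2) * (n * ENNReal.ofReal (3 * 2 ^ (-m : ℤ))) ^ min 1 (p / 2)) ^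
        (1 / p) * (steinConst p ^ (1 / p) * mixNorm volume p g)) := by
  simp_rw [latSum, Finset.mul_sum]
  refine (mixNorm_sum_le hp.le Finset.univ
    (F := fun ω k x => (nearBdry n k m).indicator 1 x * cellAvg volume (lat ω (k - 4)) (g k) x)
    fun ω k => (measurable_one.indicator (measurableSet_nearBdry k m)).mul
      (measurable_cellAvg (isCellMap_lat ω _) _)).trans ?_
  refine (Finset.sum_le_sum fun ω _ => mixNorm_nearBdry_mul_cellAvg_le ω hp m hg hb).trans_eq ?_
  simp

theorem tsum_rpow_ne_top {s : ℝ} (hs : 0 < s) :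
    ∑' m : ℕ, ENNReal.ofReal (2 ^ (-m : ℤ)) ^ s ≠ ∞ := by
  have h : ∀ m : ℕ, ENNReal.ofReal (2 ^ (-m : ℤ)) ^ s = (((2 : ℝ≥0∞) ^ s)⁻¹) ^ m := by
    intro m
    rw [zpow_neg, zpow_natCast, ENNReal.ofReal_inv_of_pos (by positivity),
      ENNReal.ofReal_pow zero_le_two, ENNReal.ofReal_ofNat, ENNReal.inv_rpow, ← ENNReal.inv_pow,
      ← ENNReal.rpow_natCast, ← ENNReal.rpow_natCast, ← ENNReal.rpow_mul, ← ENNReal.rpow_mul, mul_comm]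
  simp_rw [h]
  rw [ENNReal.tsum_geometric]
  refine ENNReal.inv_ne_top.2 (tsub_pos_of_lt ?_).ne'
  exact ENNReal.inv_lt_one.2 (ENNReal.one_lt_rpow (by norm_num) hs)

theorem IsBump.exists_mixNorm_avgDiff_le (hS : IsBump S L) (hn : 1 ≤ n) (hp : 1 < p) :
    ∃ C : ℝ≥0∞, C ≠ ∞ ∧ ∀ (f : En n → ℝ≥0∞) (M : ℝ≥0), IsNice f M →
      mixNorm volume p (avgDiff S f) ≤ C * mixNorm volume p (mdiff f) := by
  have hp0 : 0 < p := zero_lt_one.trans hp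
  have hT : steinConst p ^ (1 / p) ≠ ∞ :=
    ENNReal.rpow_ne_top_of_nonneg (by positivity) (steinConst_ne_top hp)
  set T := steinConst p ^ (1 / p) with hTdef
  set B : ℕ → ℝ≥0∞ := fun m =>
    (sparseConst (p / 2) * (n * ENNReal.ofReal (3 * 2 ^ (-m : ℤ))) ^ min 1 (p / 2)) ^ (1 / p) with hB
  have hBsum : ∑' m, B m ≠ ∞ := by
    have h : ∀ m, B m = (sparseConst (p / 2) ^ (1 / p) * (n * 3) ^ (min 1 (p / 2) * (1 / p))) *
        ENNReal.ofReal (2 ^ (-m : ℤ)) ^ (min 1 (p / 2) * (1 / p)) := by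
      intro m
      have : 0 ≤ min 1 (p / 2) := by positivity
      rw [hB]
      simp only
      rw [ENNReal.mul_rpow_of_nonneg _ _ (by positivity), ← ENNReal.rpow_mul,
        ENNReal.ofReal_mul (by norm_num), ENNReal.ofReal_ofNat, ← mul_assoc,
        ENNReal.mul_rpow_of_nonneg _ _ (by positivity), mul_assoc]
    simp_rw [h]
    rw [ENNReal.tsum_mul_left]
    refine ENNReal.mul_ne_top (ENNReal.mul_ne_top ?_ ?_) (tsum_rpow_ne_top (by positivity))
    · exact ENNReal.rpow_ne_top_of_nonneg (by positivity) (sparseConst_ne_top (by positivity))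
    · exact ENNReal.rpow_ne_top_of_nonneg (by positivity)
        (ENNReal.mul_ne_top (ENNReal.natCast_ne_top n) (by norm_num))
  have hAsum : ∑' m : ℕ, ENNReal.ofReal (L * √n * 2 ^ (-m : ℤ)) ≠ ∞ := by
    simp_rw [fun m : ℕ => ENNReal.ofReal_mul (p := L * √n) (q := 2 ^ (-m : ℤ)) (by positivity)]
    rw [ENNReal.tsum_mul_left]
    refine ENNReal.mul_ne_top ENNReal.ofReal_ne_top ?_
    simpa using tsum_rpow_ne_top one_pos
  refine ⟨(∑' m : ℕ, ENNReal.ofReal (L * √n * 2 ^ (-m : ℤ))) * (16 ^ n * (2 ^ n * T)) +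
    (∑' m, B m) * (2 * 16 ^ n * 2 ^ n * T), ?_, fun f M hf => ?_⟩
  · finiteness
  have m1 : ∀ (m : ℕ) (k : ℤ), Measurable fun x => 16 ^ n * ENNReal.ofReal (L * √n * 2 ^ (-m : ℤ)) *
      latSum k (mdiff f (k + m + 1)) x := fun m k => (measurable_latSum _ _).const_mul _
  have m2 : ∀ (m : ℕ) (k : ℤ), Measurable fun x =>
      (nearBdry n k m).indicator 1 x * latSum k (mdiff f k) x := fun m k =>
    (measurable_one.indicator (measurableSet_nearBdry k m)).mul (measurable_latSum _ _)
  refine (mixNorm_mono hp0.le fun k x => hS.avgDiff_le hn hf k x).trans ?_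
  refine (mixNorm_add_le hp.le (fun k => .tsum fun m => m1 m k)
    (fun k => .tsum fun m => (m2 m (k - m)).const_mul _)).trans ?_
  rw [add_mul]
  refine add_le_add ?_ ?_
  · refine (mixNorm_tsum_le hp.le m1).trans ?_
    rw [mul_assoc, ← ENNReal.tsum_mul_right]
    refine ENNReal.tsum_le_tsum fun m => ?_
    rw [mixNorm_const_mul hp0 _ fun k => measurable_latSum _ _]
    have h := mixNorm_latSum_le (n := n) (M := M) hp (g := fun k => mdiff f (k + m + 1))
      (fun k => measurable_mdiff f _) fun k x => mdiff_le hf.bdd _ x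
    have hs := mixNorm_shift (μ := volume) (p := p) (mdiff f) (m + 1)
    simp_rw [← add_assoc] at hs
    rw [hs] at h
    refine (mul_le_mul_right h _).trans_eq ?_
    ring
  · refine (mixNorm_tsum_le hp.le fun m k => (m2 m (k - m)).const_mul _).trans ?_
    rw [mul_assoc, ← ENNReal.tsum_mul_right]
    refine ENNReal.tsum_le_tsum fun m => ?_
    rw [mixNorm_const_mul hp0 _ fun k => m2 m (k - m)]
    have h := mixNorm_nearBdry_mul_latSum_le (n := n) (M := M) hp m
      (measurable_mdiff f) fun k x => mdiff_le hf.bdd k x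
    have hs := mixNorm_shift (μ := volume) (p := p)
      (fun k x => (nearBdry n k m).indicator 1 x * latSum k (mdiff f k) x) (-m)
    simp_rw [← sub_eq_add_neg] at hs
    rw [hs]
    refine (mul_le_mul_right h _).trans_eq ?_
    ring

theorem IsNice.lintegral_rpow_ne_top (hf : IsNice f M) (hp : 1 < p) : ∫⁻ x, f x ^ p ≠ ∞ := by
  have h : ∀ x, f x ^ p ≤ (M : ℝ≥0∞) ^ (p - 1) * f x := by
    intro x
    calc f x ^ p = f x ^ (p - 1) * f x := by
          nth_rewrite 3 [← ENNReal.rpow_one (f x)]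
          rw [← ENNReal.rpow_add_of_nonneg _ _ (by linarith) zero_le_one]
          congr 1
          ring
      _ ≤ _ := mul_le_mul_left (ENNReal.rpow_le_rpow (hf.bdd x) (by linarith)) _
  refine ne_top_of_le_ne_top ?_ (lintegral_mono h)
  rw [lintegral_const_mul _ hf.measurable]
  exact ENNReal.mul_ne_top (ENNReal.rpow_ne_top_of_nonneg (by linarith) ENNReal.coe_ne_top)
    hf.integrable

theorem IsNice.mixNorm_mdiff_le (hf : IsNice f M) (hp : 1 < p) :
    mixNorm volume p (mdiff f) ≤ anchorConst p ^ (1 / p) * lpNn volume p f := by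
  have hp0 : 0 < p := zero_lt_one.trans hp
  rw [← mixNorm_shift (mdiff f) 1, mixNorm_eq, lpNn, ← ENNReal.mul_rpow_of_nonneg _ _ (by positivity)]
  refine ENNReal.rpow_le_rpow ?_ (by positivity)
  refine le_trans (le_of_eq ?_) (lintegral_tsum_diff_sq_le (isNestedInt_lat fun _ => false)
    hf.measurable hf.bdd hp (hf.lintegral_rpow_ne_top hp))
  refine lintegral_congr fun x => ?_
  congr 1
  refine tsum_congr fun k => ?_
  rw [mdiff, add_sub_cancel_right, ediff_eq_edist (stdAvg_ne_top _ hf.bdd x)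
    (stdAvg_ne_top _ hf.bdd x), edist_dist, Real.dist_eq, ENNReal.rpow_two,
    ← ENNReal.ofReal_pow (abs_nonneg _), sq_abs]
  rfl

end Compare

/-! ### Elementary properties of the jump counting function -/

section Jump

theorem natCast_le_jumpCount {ι : Type*} [LinearOrder ι] {lam : ℝ} {J : Set ι} {a : ι → ℂ} {N : ℕ}
    {s t : Fin N → ι} (hs : ∀ i, s i ∈ J) (ht : ∀ i, t i ∈ J) (hst : ∀ i, s i < t i)
    (hts : ∀ i j, i < j → t i < s j) (hlam : ∀ i, lam < ‖a (t i) - a (s i)‖) :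
    (N : ℝ≥0∞) ≤ jumpCount lam J a :=
  le_iSup_of_le N <| le_iSup_of_le s <| le_iSup_of_le t <| le_iSup_of_le hs <| le_iSup_of_le ht <|
    le_iSup_of_le hst <| le_iSup_of_le hts <| le_iSup_of_le hlam le_rfl

theorem jumpCount_le {ι : Type*} [LinearOrder ι] {lam : ℝ} {J : Set ι} {a : ι → ℂ} {B : ℝ≥0∞}
    (h : ∀ (N : ℕ) (s t : Fin N → ι), (∀ i, s i ∈ J) → (∀ i, t i ∈ J) → (∀ i, s i < t i) →
      (∀ i j, i < j → t i < s j) → (∀ i, lam < ‖a (t i) - a (s i)‖) → (N : ℝ≥0∞) ≤ B) :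
    jumpCount lam J a ≤ B :=
  iSup_le fun N => iSup_le fun s => iSup_le fun t => iSup_le fun hs => iSup_le fun ht =>
    iSup_le fun hst => iSup_le fun hts => iSup_le fun hlam => h N s t hs ht hst hts hlam

theorem jumpCount_le_sum {ι κ : Type*} [LinearOrder ι] [Fintype κ] {lam : ℝ}
    {mu : κ → ℝ} {J : Set ι} {a : ι → ℂ} {b : κ → ι → ℂ}
    (h : ∀ s t, lam < ‖a t - a s‖ → ∃ i, mu i < ‖b i t - b i s‖) :
    jumpCount lam J a ≤ ∑ i, jumpCount (mu i) J (b i) := by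
  classical
  refine jumpCount_le fun N s t hs ht hst hts hlam => ?_
  choose c hc using fun j => h (s j) (t j) (hlam j)
  have hN : (N : ℝ≥0∞) = ∑ i, ((Finset.univ.filter fun j => c j = i).card : ℝ≥0∞) := by
    rw [← Nat.cast_sum, ← Finset.card_eq_sum_card_fiberwise (f := c) (s := Finset.univ)
      (t := Finset.univ) (fun _ _ => by simp), Finset.card_univ, Fintype.card_fin]
  rw [hN]
  refine Finset.sum_le_sum fun i _ => ?_
  set e := (Finset.univ.filter fun j => c j = i).orderEmbOfFin rfl with he
  have hmem : ∀ l, c (e l) = i := fun l =>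
    (Finset.mem_filter.1 (Finset.orderEmbOfFin_mem (Finset.univ.filter fun j => c j = i) rfl l)).2
  refine natCast_le_jumpCount (s := s ∘ e) (t := t ∘ e) (fun l => hs _) (fun l => ht _)
    (fun l => hst _) (fun l l' hl => hts _ _ (e.strictMono hl)) fun l => ?_
  have := hc (e l)
  rwa [hmem l] at this

theorem jumpCount_mul_sq_le {mu : ℝ} (hmu : 0 ≤ mu) (r : ℤ → ℂ) :
    jumpCount mu univ r * ENNReal.ofReal (mu ^ 2) ≤ 4 * ∑' k, ‖r k‖ₑ ^ (2 : ℝ) := by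
  rcases hmu.eq_or_lt with rfl | hmu
  · simp
  have hpos : ENNReal.ofReal (mu ^ 2) ≠ 0 := (ENNReal.ofReal_pos.2 (by positivity)).ne'
  rw [← ENNReal.le_div_iff_mul_le (Or.inl hpos) (Or.inl ENNReal.ofReal_ne_top)]
  refine jumpCount_le fun N s t _ _ hst hts hlam => ?_
  rw [ENNReal.le_div_iff_mul_le (Or.inl hpos) (Or.inl ENNReal.ofReal_ne_top)]
  have hs : Function.Injective s := StrictMono.injective fun i j hij =>
    (hst i).trans (hts i j hij)
  have ht : Function.Injective t := StrictMono.injective fun i j hij =>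
    (hts i j hij).trans (hst j)
  have hsum : ∀ u : Fin N → ℤ, Function.Injective u →
      ∑ i, ‖r (u i)‖ₑ ^ (2 : ℝ) ≤ ∑' k, ‖r k‖ₑ ^ (2 : ℝ) := by
    intro u hu
    rw [← tsum_fintype (L := .unconditional _)]
    exact ENNReal.tsum_comp_le_tsum_of_injective hu fun k => ‖r k‖ₑ ^ (2 : ℝ)
  have hone : ∀ i, ENNReal.ofReal (mu ^ 2) ≤ 2 * ‖r (t i)‖ₑ ^ (2 : ℝ) + 2 * ‖r (s i)‖ₑ ^ (2 : ℝ) := by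
    intro i
    have h1 : mu ^ 2 ≤ 2 * ‖r (t i)‖ ^ 2 + 2 * ‖r (s i)‖ ^ 2 := by
      have h2 := (hlam i).le.trans (norm_sub_le (r (t i)) (r (s i)))
      nlinarith [sq_nonneg (‖r (t i)‖ - ‖r (s i)‖), norm_nonneg (r (t i)), norm_nonneg (r (s i))]
    refine (ENNReal.ofReal_le_ofReal h1).trans_eq ?_
    rw [ENNReal.ofReal_add (by positivity) (by positivity), ENNReal.ofReal_mul zero_le_two,
      ENNReal.ofReal_mul zero_le_two, ENNReal.ofReal_pow (norm_nonneg _),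
      ENNReal.ofReal_pow (norm_nonneg _), ofReal_norm, ofReal_norm, ENNReal.rpow_two,
      ENNReal.rpow_two, ENNReal.ofReal_ofNat]
  calc (N : ℝ≥0∞) * ENNReal.ofReal (mu ^ 2) = ∑ _i : Fin N, ENNReal.ofReal (mu ^ 2) := by simp
    _ ≤ ∑ i, (2 * ‖r (t i)‖ₑ ^ (2 : ℝ) + 2 * ‖r (s i)‖ₑ ^ (2 : ℝ)) :=
        Finset.sum_le_sum fun i _ => hone i
    _ = 2 * ∑ i, ‖r (t i)‖ₑ ^ (2 : ℝ) + 2 * ∑ i, ‖r (s i)‖ₑ ^ (2 : ℝ) := by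
        rw [Finset.sum_add_distrib, Finset.mul_sum, Finset.mul_sum]
    _ ≤ 2 * ∑' k, ‖r k‖ₑ ^ (2 : ℝ) + 2 * ∑' k, ‖r k‖ₑ ^ (2 : ℝ) := by
        gcongr
        · exact hsum t ht
        · exact hsum s hs
    _ = _ := by rw [← add_mul]; norm_num

theorem ofReal_mul_sqrt_le {lam K mu : ℝ} (hK : 0 ≤ K) (hlam : lam = K * mu) (hmu : 0 ≤ mu)
    {N G : ℝ≥0∞} (h : N * ENNReal.ofReal (mu ^ 2) ≤ G) :
    ENNReal.ofReal lam * N ^ ((1 : ℝ) / 2) ≤ ENNReal.ofReal K * G ^ ((1 : ℝ) / 2) := by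
  have h1 := ENNReal.rpow_le_rpow h (z := (1 : ℝ) / 2) (by positivity)
  rw [ENNReal.mul_rpow_of_nonneg _ _ (by positivity), ENNReal.ofReal_pow hmu, ← ENNReal.rpow_natCast,
    ← ENNReal.rpow_mul] at h1
  norm_num at h1
  rw [hlam, ENNReal.ofReal_mul hK, mul_assoc]
  refine mul_le_mul_right ?_ _
  rw [mul_comm]
  norm_num
  exact h1

theorem sqrt_sum_le {ι : Type*} (s : Finset ι) (g : ι → ℝ≥0∞) :
    (∑ i ∈ s, g i) ^ ((1 : ℝ) / 2) ≤ ∑ i ∈ s, g i ^ ((1 : ℝ) / 2) := by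
  classical
  induction s using Finset.induction_on with
  | empty => simp
  | insert i s hi ih =>
    rw [Finset.sum_insert hi, Finset.sum_insert hi]
    exact (ENNReal.rpow_add_le_add_rpow _ _ (by norm_num) (by norm_num)).trans
      (add_le_add le_rfl ih)

end Jump

/-! ### Decomposition of complex functions into nonnegative parts -/

section Parts

/-- The real part, the imaginary part and their negatives. -/
def signedPart : Fin 4 → ℂ → ℝ :=
  ![fun z => z.re, fun z => -z.re, fun z => z.im, fun z => -z.im]

/-- The units corresponding to the four signed parts. -/
def partUnit : Fin 4 → ℂ := ![1, -1, Complex.I, -Complex.I]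

theorem norm_partUnit (i : Fin 4) : ‖partUnit i‖ = 1 := by
  fin_cases i <;> simp [partUnit]

theorem abs_signedPart_sub_le (i : Fin 4) (z w : ℂ) :
    |signedPart i z - signedPart i w| ≤ ‖z - w‖ := by
  have h1 := Complex.abs_re_le_norm (z - w)
  have h2 := Complex.abs_im_le_norm (z - w)
  rw [Complex.sub_re] at h1
  rw [Complex.sub_im] at h2
  fin_cases i
  · exact h1
  · simpa [signedPart, abs_sub_comm, neg_add_eq_sub] using h1
  · exact h2
  · simpa [signedPart, abs_sub_comm, neg_add_eq_sub] using h2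

theorem signedPart_le_norm (i : Fin 4) (z : ℂ) : signedPart i z ≤ ‖z‖ := by
  have h := abs_signedPart_sub_le i z 0
  have h0 : signedPart i 0 = 0 := by fin_cases i <;> simp [signedPart]
  rw [h0, sub_zero, sub_zero] at h
  exact (le_abs_self _).trans h

theorem continuous_signedPart (i : Fin 4) : Continuous (signedPart i) :=
  (LipschitzWith.of_dist_le_mul (K := 1) fun z w => by
    simpa [Real.dist_eq, dist_eq_norm] using abs_signedPart_sub_le i z w).continuous

theorem sum_partUnit_mul (z : ℂ) :
    ∑ i, partUnit i * ((ENNReal.ofReal (signedPart i z)).toReal : ℂ) = z := by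
  have h : ∀ t : ℝ, max t 0 - max (-t) 0 = t := fun t => by
    rcases le_total t 0 with ht | ht <;> simp [ht]
  simp only [Fin.sum_univ_four, partUnit, signedPart, ENNReal.toReal_ofReal', Matrix.cons_val]
  apply Complex.ext
  · simpa [sub_eq_add_neg] using h z.re
  · simpa [sub_eq_add_neg] using h z.im

variable {n : ℕ}

/-- The nonnegative parts of a complex function. -/
def posPart4 (f : En n → ℂ) (i : Fin 4) (x : En n) : ℝ≥0∞ := ENNReal.ofReal (signedPart i (f x))

theorem posPart4_le_enorm (f : En n → ℂ) (i : Fin 4) (x : En n) : posPart4 f i x ≤ ‖f x‖ₑ := by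
  rw [← ofReal_norm]
  exact ENNReal.ofReal_le_ofReal (signedPart_le_norm i _)

theorem isNice_posPart4 {f : En n → ℂ} {M : ℝ≥0} (hu : UniformContinuous f) (hM : ∀ x, ‖f x‖ ≤ M)
    (hi : Integrable f) (i : Fin 4) : IsNice (posPart4 f i) M where
  measurable := by
    have h1 := hu.continuous
    have h2 := continuous_signedPart i
    unfold posPart4
    fun_prop
  bdd x := by
    refine (posPart4_le_enorm f i x).trans ?_
    rw [← ofReal_norm, ← ENNReal.ofReal_coe_nnreal]
    exact ENNReal.ofReal_le_ofReal (hM x)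
  integrable := ne_top_of_le_ne_top hi.2.ne (lintegral_mono (posPart4_le_enorm f i))
  unif ε hε := by
    obtain ⟨δ, hδ, H⟩ := EMetric.uniformContinuous_iff.1 hu ε hε
    obtain ⟨δ', hδ', hδδ'⟩ := ENNReal.lt_iff_exists_real_btwn.1 hδ
    refine ⟨δ', ENNReal.ofReal_pos.1 hδδ'.1, fun x y hxy => ?_⟩
    have hxy' : edist x y < δ := by
      rw [edist_dist]
      exact (ENNReal.ofReal_le_ofReal hxy.le).trans_lt hδδ'.2
    refine le_trans ?_ (H hxy').le
    rw [posPart4, posPart4, ediff_eq_edist ENNReal.ofReal_ne_top ENNReal.ofReal_ne_top,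
      ENNReal.toReal_ofReal', ENNReal.toReal_ofReal', edist_dist, edist_dist, Real.dist_eq,
      dist_eq_norm]
    exact ENNReal.ofReal_le_ofReal
      ((abs_max_sub_max_le_abs _ _ _).trans (abs_signedPart_sub_le i _ _))

variable {S : En n → ℝ} {L : ℝ≥0}

theorem IsBump.integrable_dilKer_sub (hS : IsBump S L) (k : ℤ) (x : En n) :
    Integrable fun y => dilKer S k (x - y) :=
  ((hS.integrable.comp_smul (R := (2 : ℝ) ^ k) (by positivity)).const_mul _).comp_sub_left x

theorem IsBump.Sconv_eq (hS : IsBump S L) {f : En n → ℂ} {M : ℝ≥0} (hu : UniformContinuous f)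
    (hM : ∀ x, ‖f x‖ ≤ M) (hi : Integrable f) (k : ℤ) (x : En n) :
    Sconv n S k f x = ∑ i, partUnit i * ((smAvg S k (posPart4 f i) x).toReal : ℂ) := by
  have h1 : Sconv n S k f x = ∫ y, f y * (dilKer S k (x - y) : ℂ) := by
    rw [← integral_sub_left_eq_self (fun y => f y * (dilKer S k (x - y) : ℂ)) volume x]
    simp only [sub_sub_cancel]
    rfl
  have hnice := isNice_posPart4 hu hM hi
  have hprod : ∀ i, Integrable fun y => (dilKer S k (x - y)) * (posPart4 f i y).toReal := by
    intro i
    refine (hS.integrable_dilKer_sub k x).mul_bdd (c := M)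
      ((hnice i).measurable.ennreal_toReal).aestronglyMeasurable (Eventually.of_forall fun y => ?_)
    rw [Real.norm_of_nonneg ENNReal.toReal_nonneg]
    exact ENNReal.toReal_le_coe_of_le_coe ((hnice i).bdd y)
  have h2 : ∀ y, f y * (dilKer S k (x - y) : ℂ) =
      ∑ i, partUnit i * ((dilKer S k (x - y) * (posPart4 f i y).toReal : ℝ) : ℂ) := by
    intro y
    conv_lhs => rw [← sum_partUnit_mul (f y), Finset.sum_mul]
    refine Finset.sum_congr rfl fun i _ => ?_
    rw [posPart4]
    push_cast
    ring
  rw [h1]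
  simp_rw [h2]
  rw [integral_finsetSum _ fun i _ => (hprod i).ofReal.const_mul _]
  refine Finset.sum_congr rfl fun i _ => ?_
  rw [integral_const_mul, integral_complex_ofReal]
  congr 2
  rw [integral_eq_lintegral_of_nonneg_ae (Eventually.of_forall fun y =>
    mul_nonneg (hS.dilKer_nonneg _ _) ENNReal.toReal_nonneg) (hprod i).aestronglyMeasurable, smAvg]
  congr 1
  refine lintegral_congr fun y => ?_
  rw [ENNReal.ofReal_mul (hS.dilKer_nonneg _ _), ENNReal.ofReal_toReal
    (ne_top_of_le_ne_top ENNReal.coe_ne_top ((hnice i).bdd y))]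

end Parts

/-! ### The jump inequality for the smooth averages -/

section Final

variable {n : ℕ} {S : En n → ℝ} {L M : ℝ≥0} {p : ℝ}

/-- An upper bound for the distance of `smAvg S (k - ℓ) g` to `stdAvg k g`. -/
def shiftErr (S : En n → ℝ) (g : En n → ℝ≥0∞) (ℓ : ℕ) (k : ℤ) (x : En n) : ℝ≥0∞ :=
  avgDiff S g (k + -ℓ) x + ∑ j ∈ Finset.range ℓ, mdiff g (k + -j) x

theorem edist_smAvg_stdAvg_le_shiftErr {g : En n → ℝ≥0∞} (hg : IsNice g M)
    (ℓ : ℕ) (k : ℤ) (x : En n) :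
    edist (smAvg S (k - ℓ) g x).toReal (stdAvg k g x).toReal ≤ shiftErr S g ℓ k x := by
  refine (edist_triangle _ (stdAvg (k - ℓ) g x).toReal _).trans ?_
  rw [shiftErr, ← sub_eq_add_neg]
  refine add_le_add le_rfl ?_
  rw [edist_comm]
  have h := edist_le_range_sum_edist (fun j : ℕ => (stdAvg (k - j) g x).toReal) ℓ
  simp only [Nat.cast_zero, sub_zero] at h
  refine h.trans (Finset.sum_le_sum fun j _ => ?_)
  rw [mdiff, ediff_eq_edist (stdAvg_ne_top _ hg.bdd x) (stdAvg_ne_top _ hg.bdd x)]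
  simp only [← sub_eq_add_neg, Nat.cast_add, Nat.cast_one, ← sub_sub]
  exact le_rfl

theorem IsBump.measurable_avgDiff (hS : IsBump S L) {g : En n → ℝ≥0∞} (hg : Measurable g) (k : ℤ) :
    Measurable (avgDiff S g k) :=
  (hS.measurable_smAvg hg).ennreal_toReal.edist (measurable_stdAvg k g).ennreal_toReal

theorem IsBump.measurable_shiftErr (hS : IsBump S L) {g : En n → ℝ≥0∞} (hg : Measurable g)
    (ℓ : ℕ) (k : ℤ) : Measurable (shiftErr S g ℓ k) :=
  (hS.measurable_avgDiff hg _).add (Finset.measurable_sum _ fun _ _ => measurable_mdiff g _)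

theorem IsBump.exists_mixNorm_shiftErr_le (hS : IsBump S L) (hn : 1 ≤ n) (hp : 1 < p) :
    ∃ C : ℝ≥0∞, C ≠ ∞ ∧ ∀ (g : En n → ℝ≥0∞) (M : ℝ≥0), IsNice g M → ∀ ℓ : ℕ,
      mixNorm volume p (shiftErr S g ℓ) ≤ (1 + ℓ) * C * lpNn volume p g := by
  obtain ⟨C, hC, h⟩ := hS.exists_mixNorm_avgDiff_le hn hp
  refine ⟨(C + 1) * anchorConst p ^ (1 / p), ENNReal.mul_ne_top (by simp [hC])
    (ENNReal.rpow_ne_top_of_nonneg (by positivity) (anchorConst_ne_top hp)), fun g M hg ℓ => ?_⟩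
  calc mixNorm volume p (shiftErr S g ℓ)
      ≤ mixNorm volume p (fun k => avgDiff S g (k + -ℓ)) +
        ∑ j ∈ Finset.range ℓ, mixNorm volume p (fun k => mdiff g (k + -j)) :=
        (mixNorm_add_le hp.le (fun k => hS.measurable_avgDiff hg.measurable _) fun k =>
          Finset.measurable_sum _ fun _ _ => measurable_mdiff g _).trans
          (add_le_add le_rfl (mixNorm_sum_le hp.le _ fun j k => measurable_mdiff g _))
    _ = mixNorm volume p (avgDiff S g) + ℓ * mixNorm volume p (mdiff g) := by
        simp only [mixNorm_shift, Finset.sum_const, Finset.card_range, nsmul_eq_mul]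
    _ ≤ C * mixNorm volume p (mdiff g) + ℓ * mixNorm volume p (mdiff g) :=
        add_le_add (h g M hg) le_rfl
    _ = (C + ℓ) * mixNorm volume p (mdiff g) := (add_mul _ _ _).symm
    _ ≤ ((1 + ℓ) * (C + 1)) * (anchorConst p ^ (1 / p) * lpNn volume p g) := by
        refine mul_le_mul' ?_ (hg.mixNorm_mdiff_le hp)
        calc C + ℓ ≤ C + ℓ + (1 + ℓ * C) := le_self_add
          _ = (1 + ℓ) * (C + 1) := by ring
    _ = _ := by ring

/-- The martingale of dyadic averages of a complex function. -/
def stdAvgC (f : En n → ℂ) (k : ℤ) (x : En n) : ℂ :=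
  ∑ i, partUnit i * ((stdAvg k (posPart4 f i) x).toReal : ℂ)

section Approx

variable {f : En n → ℂ}

theorem IsBump.enorm_Sconv_sub_le (hS : IsBump S L) (hu : UniformContinuous f)
    (hM : ∀ x, ‖f x‖ ≤ M) (hi : Integrable f) (ℓ : ℕ) (k : ℤ) (x : En n) :
    ‖Sconv n S (k - ℓ) f x - stdAvgC f k x‖ₑ ≤ ∑ i, shiftErr S (posPart4 f i) ℓ k x := by
  rw [hS.Sconv_eq hu hM hi, stdAvgC, ← Finset.sum_sub_distrib]
  refine (enorm_sum_le _ _).trans (Finset.sum_le_sum fun i _ => ?_)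
  refine le_trans (le_of_eq ?_) (edist_smAvg_stdAvg_le_shiftErr (isNice_posPart4 hu hM hi i) ℓ k x)
  rw [← mul_sub, enorm_mul, ← ofReal_norm, norm_partUnit, ENNReal.ofReal_one, one_mul,
    ← Complex.ofReal_sub, edist_eq_enorm_sub, ← ofReal_norm, Complex.norm_real, ofReal_norm]

theorem IsBump.norm_Sconv_le (hS : IsBump S L) (hu : UniformContinuous f)
    (hM : ∀ x, ‖f x‖ ≤ M) (hi : Integrable f) (k : ℤ) (x : En n) :
    ‖Sconv n S k f x‖ ≤ 4 * M := by
  rw [hS.Sconv_eq hu hM hi]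
  refine (norm_sum_le _ _).trans ?_
  have h : ∀ i ∈ Finset.univ,
      ‖partUnit i * ((smAvg S k (posPart4 f i) x).toReal : ℂ)‖ ≤ M := fun i _ => by
    rw [norm_mul, norm_partUnit, one_mul, Complex.norm_real,
      Real.norm_of_nonneg ENNReal.toReal_nonneg]
    exact ENNReal.toReal_le_coe_of_le_coe (hS.smAvg_le fun y _ => (isNice_posPart4 hu hM hi i).bdd y)
  simpa using Finset.sum_le_sum h

theorem IsBump.enorm_StildeConv_sub_le (hS : IsBump S L) (hu : UniformContinuous f)
    (hM : ∀ x, ‖f x‖ ≤ M) (hi : Integrable f) {c : ℕ → ℂ} (hc : Summable fun ℓ => ‖c ℓ‖)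
    (k : ℤ) (x : En n) :
    ‖StildeConv n S c k f x - (∑' ℓ, c ℓ) * stdAvgC f k x‖ₑ ≤
      ∑' ℓ : ℕ, ‖c ℓ‖ₑ * ∑ i, shiftErr S (posPart4 f i) ℓ k x := by
  have h1 : Summable fun ℓ : ℕ => c ℓ * Sconv n S (k - ℓ) f x :=
    Summable.of_norm_bounded (hc.mul_right (4 * M : ℝ)) fun ℓ => by
      rw [norm_mul]
      exact mul_le_mul_of_nonneg_left (hS.norm_Sconv_le hu hM hi _ x) (norm_nonneg _)
  have h2 : Summable fun ℓ : ℕ => c ℓ * stdAvgC f k x := hc.of_norm.mul_right _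
  rw [StildeConv, ← tsum_mul_right, ← h1.tsum_sub h2]
  refine (enorm_tsum_le_tsum_enorm).trans (ENNReal.tsum_le_tsum fun ℓ => ?_)
  rw [← mul_sub, enorm_mul]
  exact mul_le_mul_right (hS.enorm_Sconv_sub_le hu hM hi ℓ k x) _

end Approx

theorem tsum_enorm_mul_ne_top {c : ℕ → ℂ} {a M : ℝ} (ha : 0 < a)
    (hc : ∀ ℓ : ℕ, ‖c ℓ‖ ≤ M * (2 : ℝ) ^ (-(a * ℓ))) :
    ∑' ℓ : ℕ, ‖c ℓ‖ₑ * (1 + ℓ) ≠ ∞ := by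
  set r : ℝ := 2 ^ (-a) with hr
  have hr0 : 0 < r := by positivity
  have hr1 : ‖r‖ < 1 := by
    rw [Real.norm_of_nonneg hr0.le]
    exact Real.rpow_lt_one_of_one_lt_of_neg one_lt_two (by linarith)
  have hc' : ∀ ℓ : ℕ, ‖c ℓ‖ ≤ M * r ^ ℓ := fun ℓ => by
    rw [hr, ← Real.rpow_natCast, ← Real.rpow_mul zero_le_two, neg_mul]
    exact hc ℓ
  have hs : Summable fun ℓ : ℕ => M * r ^ ℓ * (1 + ℓ) := by
    have h := ((summable_pow_mul_geometric_of_norm_lt_one 0 hr1).add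
      (summable_pow_mul_geometric_of_norm_lt_one 1 hr1)).mul_left M
    refine h.congr fun ℓ => ?_
    ring
  refine ne_top_of_le_ne_top hs.tsum_ofReal_ne_top (ENNReal.tsum_le_tsum fun ℓ => ?_)
  rw [← ofReal_norm, ← ENNReal.ofReal_natCast, ← ENNReal.ofReal_one,
    ← ENNReal.ofReal_add zero_le_one (by positivity), ← ENNReal.ofReal_mul (norm_nonneg _)]
  exact ENNReal.ofReal_le_ofReal (mul_le_mul_of_nonneg_right (hc' ℓ) (by positivity))

end Final

section Assembly

variable {n : ℕ} {S : En n → ℝ} {L M : ℝ≥0} {p : ℝ}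

/-- The bound for the distance of `StildeConv n S c k f` to a multiple of the dyadic martingale. -/
def tildeErr (S : En n → ℝ) (c : ℕ → ℂ) (f : En n → ℂ) (k : ℤ) (x : En n) : ℝ≥0∞ :=
  ∑' ℓ : ℕ, ‖c ℓ‖ₑ * ∑ i, shiftErr S (posPart4 f i) ℓ k x

theorem lpNn_posPart4_le (hp : 0 ≤ p) (f : En n → ℂ) (i : Fin 4) :
    lpNn volume p (posPart4 f i) ≤ lpNn volume p fun x => ‖f x‖ₑ :=
  lpNn_mono hp (posPart4_le_enorm f i)

theorem IsBump.measurable_tildeErr (hS : IsBump S L) (c : ℕ → ℂ) {f : En n → ℂ}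
    (hf : ∀ i, Measurable (posPart4 f i)) (k : ℤ) : Measurable (tildeErr S c f k) :=
  Measurable.tsum fun ℓ => (Finset.measurable_sum _ fun i _ =>
    hS.measurable_shiftErr (hf i) ℓ k).const_mul _

theorem IsBump.exists_mixNorm_tildeErr_le (hS : IsBump S L) (hn : 1 ≤ n) (hp : 1 < p) {c : ℕ → ℂ}
    (hc : ∑' ℓ : ℕ, ‖c ℓ‖ₑ * (1 + ℓ) ≠ ∞) :
    ∃ C : ℝ≥0∞, C ≠ ∞ ∧ ∀ (f : En n → ℂ) (M : ℝ≥0), (∀ i, IsNice (posPart4 f i) M) →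
      mixNorm volume p (tildeErr S c f) ≤ C * lpNn volume p fun x => ‖f x‖ₑ := by
  have hp0 : 0 < p := zero_lt_one.trans hp
  obtain ⟨C, hC, h⟩ := hS.exists_mixNorm_shiftErr_le hn hp
  refine ⟨(∑' ℓ : ℕ, ‖c ℓ‖ₑ * (1 + ℓ)) * (4 * C),
    ENNReal.mul_ne_top hc (ENNReal.mul_ne_top (by simp) hC), fun f M hf => ?_⟩
  set A := lpNn volume p fun x => ‖f x‖ₑ
  have hm : ∀ i ℓ k, Measurable (shiftErr S (posPart4 f i) ℓ k) := fun i =>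
    hS.measurable_shiftErr (hf i).measurable
  have hms : ∀ (ℓ : ℕ) (k : ℤ), Measurable fun x => ∑ i, shiftErr S (posPart4 f i) ℓ k x :=
    fun ℓ k => Finset.measurable_sum _ fun i _ => hm i ℓ k
  have hone : ∀ ℓ : ℕ, mixNorm volume p (fun k x => ∑ i, shiftErr S (posPart4 f i) ℓ k x) ≤
      (1 + ℓ) * (4 * C * A) := by
    intro ℓ
    refine (mixNorm_sum_le hp.le _ fun i k => hm i ℓ k).trans ?_
    calc ∑ i, mixNorm volume p (shiftErr S (posPart4 f i) ℓ)
        ≤ ∑ _i : Fin 4, (1 + ℓ) * C * A := Finset.sum_le_sum fun i _ =>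
          (h _ M (hf i) ℓ).trans (mul_le_mul_right (lpNn_posPart4_le hp0.le f i) _)
      _ = (1 + ℓ) * (4 * C * A) := by
          rw [Finset.sum_const, Finset.card_univ, Fintype.card_fin, nsmul_eq_mul]
          push_cast
          ring
  calc mixNorm volume p (tildeErr S c f)
      ≤ ∑' ℓ : ℕ, mixNorm volume p (fun k x => ‖c ℓ‖ₑ * ∑ i, shiftErr S (posPart4 f i) ℓ k x) :=
        mixNorm_tsum_le hp.le fun ℓ k => (hms ℓ k).const_mul _
    _ ≤ ∑' ℓ : ℕ, ‖c ℓ‖ₑ * (1 + ℓ) * (4 * C * A) := ENNReal.tsum_le_tsum fun ℓ => by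
        rw [mixNorm_const_mul hp0 _ (hms ℓ), mul_assoc]
        exact mul_le_mul_right (hone ℓ) _
    _ = _ := by rw [ENNReal.tsum_mul_right, ← mul_assoc]

theorem jumpCount_le_jumpCount_parts {lam : ℝ} {γ : ℂ} {u : ℤ → ℂ} {v : Fin 4 → ℤ → ℂ} :
    jumpCount lam univ u ≤ jumpCount (lam / 5) univ (fun k => u k - γ * ∑ i, partUnit i * v i k) +
      ∑ i, jumpCount (lam / (5 * (‖γ‖ + 1))) univ (v i) := by
  have hγ : 0 < ‖γ‖ + 1 := by positivity
  have h := jumpCount_le_sum (κ := Option (Fin 4)) (lam := lam) (J := univ) (a := u)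
    (mu := fun o => o.elim (lam / 5) fun _ => lam / (5 * (‖γ‖ + 1)))
    (b := fun o => o.elim (fun k => u k - γ * ∑ i, partUnit i * v i k) v) ?_
  · simpa only [Fintype.sum_option, Option.elim] using h
  intro s t hst
  by_contra! hcon
  have h0 := hcon none
  have hv : ∀ i ∈ Finset.univ, ‖partUnit i * (v i t - v i s)‖ ≤ lam / (5 * (‖γ‖ + 1)) := by
    intro i _
    rw [norm_mul, norm_partUnit, one_mul]
    exact hcon (some i)
  simp only [Option.elim] at h0
  have hsum : ‖∑ i, partUnit i * (v i t - v i s)‖ ≤ 4 * (lam / (5 * (‖γ‖ + 1))) := by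
    refine (norm_sum_le _ _).trans ?_
    simpa using Finset.sum_le_sum hv
  have hdec : u t - u s = (u t - γ * ∑ i, partUnit i * v i t - (u s - γ * ∑ i, partUnit i * v i s))
      + γ * ∑ i, partUnit i * (v i t - v i s) := by
    simp only [mul_sub, Finset.sum_sub_distrib]
    ring
  have hlam : 0 ≤ lam / (5 * (‖γ‖ + 1)) := (norm_nonneg _).trans (hv 0 (Finset.mem_univ _))
  have hprod : ‖γ * ∑ i, partUnit i * (v i t - v i s)‖ ≤ 4 * (lam / 5) := by
    rw [norm_mul]
    calc ‖γ‖ * ‖∑ i, partUnit i * (v i t - v i s)‖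
        ≤ (‖γ‖ + 1) * (4 * (lam / (5 * (‖γ‖ + 1)))) :=
          mul_le_mul (by linarith) hsum (norm_nonneg _) hγ.le
      _ = 4 * (lam / 5) := by field_simp
  rw [hdec] at hst
  linarith [norm_add_le (u t - γ * ∑ i, partUnit i * v i t -
    (u s - γ * ∑ i, partUnit i * v i s)) (γ * ∑ i, partUnit i * (v i t - v i s))]

theorem IsBump.exists_lpNn_jumpCount_le (hS : IsBump S L) (hn : 1 ≤ n) (hp : 1 < p) {c : ℕ → ℂ}
    (hc : ∑' ℓ : ℕ, ‖c ℓ‖ₑ * (1 + ℓ) ≠ ∞) :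
    ∃ C : ℝ≥0∞, C ≠ ∞ ∧ ∀ (f : En n → ℂ) (M : ℝ≥0), UniformContinuous f → (∀ x, ‖f x‖ ≤ M) →
      Integrable f → ∀ lam : ℝ, 0 < lam →
        lpNn volume p (fun x => ENNReal.ofReal lam *
          jumpCount lam univ (fun k : ℤ => StildeConv n S c k f x) ^ ((1 : ℝ) / 2)) ≤
          C * lpNn volume p fun x => ‖f x‖ₑ := by
  have hp0 : 0 < p := zero_lt_one.trans hp
  have hcs : Summable fun ℓ => ‖c ℓ‖ := by
    have h : ∑' ℓ, ‖c ℓ‖ₑ ≠ ∞ := ne_top_of_le_ne_top hc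
      (ENNReal.tsum_le_tsum fun ℓ => le_mul_of_one_le_right' le_self_add)
    simpa using ENNReal.summable_toReal h
  obtain ⟨C, hC, h⟩ := hS.exists_mixNorm_tildeErr_le hn hp hc
  set γ := ∑' ℓ, c ℓ with hγ
  set K : ℝ := 5 * (‖γ‖ + 1) with hK
  have hK0 : 0 < K := by positivity
  set D := (4 ^ (p / 2) * anchorConst p) ^ (1 / p) with hD
  have hDtop : D ≠ ∞ := ENNReal.rpow_ne_top_of_nonneg (by positivity)
    (ENNReal.mul_ne_top (ENNReal.rpow_ne_top_of_nonneg (by positivity) (by simp))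
      (anchorConst_ne_top hp))
  refine ⟨10 * C + 4 * (ENNReal.ofReal K * D), by finiteness, fun f M hu hM hi lam hlam => ?_⟩
  set A := lpNn volume p fun x => ‖f x‖ₑ with hA
  have hnice := isNice_posPart4 hu hM hi
  choose G hGm hG hGint using fun i => exists_jumpCount_cellAvg_le
    (isNestedInt_lat (n := n) fun _ => false) (hnice i).measurable (hnice i).bdd hp
    ((hnice i).lintegral_rpow_ne_top hp) (div_pos hlam hK0)
  have hGlp : ∀ i, lpNn volume p (fun x => G i x ^ ((1 : ℝ) / 2)) ≤ D * A := by
    intro i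
    refine le_trans ?_ (mul_le_mul_right (lpNn_posPart4_le hp0.le f i) D)
    rw [lpNn, lpNn, hD, ← ENNReal.mul_rpow_of_nonneg _ _ (by positivity)]
    refine ENNReal.rpow_le_rpow ?_ (by positivity)
    simp_rw [← ENNReal.rpow_mul, one_div_mul_eq_div]
    exact hGint i
  have hmE := hS.measurable_tildeErr c fun i => (hnice i).measurable
  have hpt : ∀ x, ENNReal.ofReal lam *
      jumpCount lam univ (fun k : ℤ => StildeConv n S c k f x) ^ ((1 : ℝ) / 2) ≤
      10 * sqNorm (fun k => tildeErr S c f k x) +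
        ∑ i, ENNReal.ofReal K * G i x ^ ((1 : ℝ) / 2) := by
    intro x
    have h1 := jumpCount_le_jumpCount_parts (lam := lam) (γ := γ)
      (u := fun k : ℤ => StildeConv n S c k f x)
      (v := fun i k => ((stdAvg k (posPart4 f i) x).toReal : ℂ))
    have h2 := ENNReal.rpow_le_rpow h1 (z := (1 : ℝ) / 2) (by positivity)
    refine (mul_le_mul_right (h2.trans ((ENNReal.rpow_add_le_add_rpow _ _ (by norm_num)
      (by norm_num)).trans (add_le_add le_rfl (sqrt_sum_le _ _)))) _).trans ?_
    rw [mul_add, Finset.mul_sum]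
    refine add_le_add ?_ (Finset.sum_le_sum fun i _ => ?_)
    · refine (ofReal_mul_sqrt_le (K := 5) (by norm_num) (by ring) (by positivity)
        (jumpCount_mul_sq_le (by positivity) _)).trans ?_
      rw [ENNReal.mul_rpow_of_nonneg _ _ (by positivity), ← mul_assoc, ← sqNorm_eq]
      refine mul_le_mul' (le_of_eq ?_) (sqNorm_mono fun k =>
        hS.enorm_StildeConv_sub_le hu hM hi hcs k x)
      have h4 : (4 : ℝ≥0∞) ^ ((1 : ℝ) / 2) = 2 := by
        rw [show (4 : ℝ≥0∞) = 2 ^ (2 : ℝ) by norm_num, ← ENNReal.rpow_mul]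
        norm_num
      rw [h4, ENNReal.ofReal_ofNat]
      norm_num
    · exact ofReal_mul_sqrt_le hK0.le (by field_simp) (by positivity) (hG i x)
  have hmG : ∀ i, Measurable fun x => ENNReal.ofReal K * G i x ^ ((1 : ℝ) / 2) := fun i =>
    ((hGm i).pow_const _).const_mul _
  calc lpNn volume p (fun x => ENNReal.ofReal lam *
          jumpCount lam univ (fun k : ℤ => StildeConv n S c k f x) ^ ((1 : ℝ) / 2))
      ≤ lpNn volume p (fun x => 10 * sqNorm (fun k => tildeErr S c f k x)) +
        ∑ i, lpNn volume p (fun x => ENNReal.ofReal K * G i x ^ ((1 : ℝ) / 2)) :=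
        (lpNn_mono hp0.le hpt).trans ((lpNn_add_le hp.le ((measurable_sqNorm hmE).const_mul _)
          (Finset.measurable_sum _ fun i _ => hmG i)).trans
          (add_le_add le_rfl (lpNn_sum_le hp.le _ hmG)))
    _ ≤ 10 * (C * A) + ∑ _i : Fin 4, ENNReal.ofReal K * (D * A) := by
        refine add_le_add ?_ (Finset.sum_le_sum fun i _ => ?_)
        · rw [lpNn_const_mul hp0 _ (measurable_sqNorm hmE)]
          exact mul_le_mul_right (h f M hnice) _
        · rw [lpNn_const_mul hp0 _ ((hGm i).pow_const _)]
          exact mul_le_mul_right (hGlp i) _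
    _ = (10 * C + 4 * (ENNReal.ofReal K * D)) * A := by
        rw [Finset.sum_const, Finset.card_univ, Fintype.card_fin, nsmul_eq_mul]
        push_cast
        ring

theorem exists_isBump_of_contDiff (hS0 : ∀ x, 0 ≤ S x) (hSsmooth : ContDiff ℝ (⊤ : ℕ∞) S)
    (hSsupp : ∀ x : En n, (∃ i, 1 < |x i|) → S x = 0) (hSint : ∫ x : En n, S x = 1) :
    ∃ L, IsBump S L := by
  have hcomp : HasCompactSupport S := by
    refine HasCompactSupport.intro (isCompact_closedBall (0 : En n) √n) fun x hx => hSsupp x ?_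
    by_contra! hcon
    refine hx (mem_closedBall_zero_iff.2 ?_)
    rw [EuclideanSpace.norm_eq]
    refine Real.sqrt_le_sqrt ?_
    calc ∑ i, ‖x i‖ ^ 2 ≤ ∑ _i : Fin n, (1 : ℝ) := Finset.sum_le_sum fun i _ =>
          pow_le_one₀ (norm_nonneg _) (hcon i)
      _ = n := by simp
  obtain ⟨L, hL⟩ := hSsmooth.lipschitzWith_of_hasCompactSupport hcomp (by simp)
  exact ⟨L, hS0, hL, hSsupp, hSint⟩

end Assembly

theorem statement6 (n : ℕ) (hn : 1 ≤ n) (S : En n → ℝ)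
    (hS0 : ∀ x, 0 ≤ S x) (hSsmooth : ContDiff ℝ (⊤ : ℕ∞) S)
    (hSsupp : ∀ x : En n, (∃ i, 1 < |x i|) → S x = 0)
    (hSint : ∫ x : En n, S x = 1)
    (c : ℕ → ℂ) (a : ℝ) (ha : 0 < a) (M : ℝ) (hc : ∀ ℓ : ℕ, ‖c ℓ‖ ≤ M * (2 : ℝ) ^ (-(a * ℓ)))
    (p : ℝ) (hp1 : 1 < p) :
    ∃ C : ℝ≥0, ∀ f : SchwartzMap (En n) ℂ, ∀ lam : ℝ, 0 < lam →
      (∫⁻ x : En n,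
          (ENNReal.ofReal lam *
            (jumpCount lam Set.univ
                fun k : ℤ => StildeConv n S c k (fun y => f y) x) ^ ((1 : ℝ) / 2)) ^ p) ^
          (1 / p) ≤
        C * eLpNorm (fun x => f x) (ENNReal.ofReal p) volume := by
  have hp0 : 0 < p := zero_lt_one.trans hp1
  obtain ⟨L, hS⟩ := exists_isBump_of_contDiff hS0 hSsmooth hSsupp hSint
  obtain ⟨C, hC, h⟩ := hS.exists_lpNn_jumpCount_le hn hp1 (tsum_enorm_mul_ne_top ha hc)
  refine ⟨C.toNNReal, fun f lam hlam => ?_⟩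
  have hf := h (fun y => f y) ‖f.toBoundedContinuousFunction‖₊
    (ZeroAtInftyContinuousMap.uniformContinuous f.toZeroAtInfty)
    (fun x => f.toBoundedContinuousFunction.norm_coe_le_norm x) f.integrable lam hlam
  rw [ENNReal.coe_toNNReal hC, eLpNorm_eq_lintegral_rpow_enorm_toReal
    (ENNReal.ofReal_pos.2 hp0).ne' ENNReal.ofReal_ne_top, ENNReal.toReal_ofReal hp0.le]
  exact hf

end
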